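/- arXiv:quant-ph/0611147 — 2 statements merged into one kernel-verified Lean document; each statement's English description precedes it below -/
import Mathlib

section
/- Let A := sgn Q(0) + sgn Q(2π/3) + sgn Q(4π/3). Then the operator A² − 1 is a Hilbert–Schmidt operator on L²(ℝ): for any (equivalently, every) Hilbert (orthonormal) basis (eₙ) of L²(ℝ), Σₙ ‖(A² − 1)eₙ‖² < ∞; equivalently, trace((A² − 1)²) < ∞. Consequently the spectrum of A is discrete except for the two possible accumulation points −1 and 1. -/
open MeasureTheory Complex Real
open scoped InnerProductSpace ComplexConjugate

noncomputable section

/-- The complex Hilbert space `L²(ℝ, ℂ)`. -/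
abbrev L2 : Type := Lp ℂ 2 (volume : Measure ℝ)

/-- `F` is the Fourier–Plancherel unitary operator on `L²(ℝ)`,
with convention `(Fψ)(p) = (2π)^{-1/2} ∫ e^{-ipq} ψ(q) dq`
(this property on the dense subspace `L¹ ∩ L²` determines `F` uniquely). -/
def IsFourier (F : L2 ≃ₗᵢ[ℂ] L2) : Prop :=
  ∀ ψ : L2, Integrable (⇑ψ) volume →
    (F ψ : ℝ → ℂ) =ᵐ[volume]
      fun p : ℝ => (((2 * π) ^ (-(1:ℝ)/2) : ℝ) : ℂ) *
        ∫ q : ℝ, Complex.exp (-(Complex.I) * (p : ℂ) * (q : ℂ)) * ψ q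

/-- `T` is the bounded multiplication operator `M_g` by `g` on `L²(ℝ)`. -/
def IsMulOp (g : ℝ → ℂ) (T : L2 →L[ℂ] L2) : Prop :=
  ∀ ψ : L2, (T ψ : ℝ → ℂ) =ᵐ[volume] fun q => g q * ψ q

/-- `T = sgn P := 𝓕⁻¹ ∘ M_sgn ∘ 𝓕`. -/
def IsSgnP (T : L2 →L[ℂ] L2) : Prop :=
  ∃ F : L2 ≃ₗᵢ[ℂ] L2, IsFourier F ∧
    ∀ ψ : L2, (F (T ψ) : ℝ → ℂ) =ᵐ[volume]
      fun p => ((Real.sign p : ℝ) : ℂ) * (F ψ : ℝ → ℂ) p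

/-- `χ_t(q) = exp(−(i/2)(cot t) q²)`. -/
def chi (t q : ℝ) : ℂ :=
  Complex.exp (-(Complex.I / 2) * ((Real.cos t / Real.sin t : ℝ) : ℂ) * (q : ℂ) ^ 2)

/-- `T = sgn Q(t)`: for `t = 0` this is `M_sgn`, and for `sin t ≠ 0` it is
`sgn(sin t) · M_{χ_t} ∘ (sgn P) ∘ M_{χ_t}⁻¹`, which realizes `sgn(Q cos t + P sin t)`. -/
def IsSgnQ (t : ℝ) (T : L2 →L[ℂ] L2) : Prop :=
  if t = 0 then IsMulOp (fun q => ((Real.sign q : ℝ) : ℂ)) T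
  else ∃ P Mc Mci : L2 →L[ℂ] L2, IsSgnP P ∧ IsMulOp (chi t) Mc ∧
    IsMulOp (fun q => (chi t q)⁻¹) Mci ∧
    T = (((Real.sign (Real.sin t) : ℝ) : ℂ) • (Mc ∘L P ∘L Mci))

/-- The primitive of the Gaussian `exp (-b v²)` vanishing at `0`. -/
def gaussPrim (b : ℂ) (u : ℝ) : ℂ := ∫ v in (0:ℝ)..u, cexp (-b * (v : ℂ) ^ 2)

/-- The Fresnel integral `∫₀ᵘ exp (i v²) dv`. -/
def fresnel (u : ℝ) : ℂ := ∫ v in (0:ℝ)..u, cexp (I * (v : ℂ) ^ 2)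

/-- The limit of the Fresnel integral at `+∞`, that is `(√π / 2) exp (iπ/4)`. -/
def fresnelLim : ℂ := (√(π / 8) : ℝ) * (1 + I)

lemma hasDerivAt_gaussPrim (b : ℂ) (u : ℝ) :
    HasDerivAt (gaussPrim b) (cexp (-b * (u : ℂ) ^ 2)) u := by
  have hc : Continuous fun v : ℝ => cexp (-b * (v : ℂ) ^ 2) := by fun_prop
  exact intervalIntegral.integral_hasDerivAt_right (hc.intervalIntegrable _ _)
    (hc.stronglyMeasurableAtFilter _ _) hc.continuousAt

lemma gaussPrim_neg_I (u : ℝ) : gaussPrim (-I) u = fresnel u := by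
  simp [gaussPrim, fresnel]

lemma hasDerivAt_fresnel (u : ℝ) : HasDerivAt fresnel (cexp (I * (u : ℂ) ^ 2)) u := by
  have h := hasDerivAt_gaussPrim (-I) u
  rw [neg_neg] at h
  rwa [show gaussPrim (-I) = fresnel from funext gaussPrim_neg_I] at h

lemma continuous_fresnel : Continuous fresnel :=
  continuous_iff_continuousAt.2 fun u => (hasDerivAt_fresnel u).continuousAt

lemma norm_exp_I_mul_sq (u : ℝ) : ‖cexp (I * (u : ℂ) ^ 2)‖ = 1 := by
  rw [mul_comm]; simpa using norm_exp_ofReal_mul_I (u ^ (2 : ℕ))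

lemma norm_fresnel_le (u : ℝ) : ‖fresnel u‖ ≤ |u| := by
  have := intervalIntegral.norm_integral_le_of_norm_le_const (a := 0) (b := u) (C := 1)
    (f := fun v : ℝ => cexp (I * (v : ℂ) ^ 2)) (fun v _ => (norm_exp_I_mul_sq v).le)
  simpa [fresnel] using this

lemma fresnel_zero : fresnel 0 = 0 := by simp [fresnel]

lemma fresnel_neg (u : ℝ) : fresnel (-u) = -fresnel u := by
  have := intervalIntegral.integral_comp_neg (a := 0) (b := u)
    (fun v : ℝ => cexp (I * (v : ℂ) ^ 2))
  simp only [ofReal_neg, even_two, Even.neg_pow, neg_zero] at this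
  rw [fresnel, fresnel, intervalIntegral.integral_symm, ← this]

lemma conj_fresnel (u : ℝ) :
    conj (fresnel u) = ∫ v in (0:ℝ)..u, cexp (-I * (v : ℂ) ^ 2) := by
  rw [fresnel, intervalIntegral, intervalIntegral, map_sub, ← integral_conj, ← integral_conj]
  simp_rw [← Complex.exp_conj]
  simp

lemma norm_sub_le_of_norm_deriv_le {f f' : ℝ → ℂ} {g g' : ℝ → ℝ} {u v : ℝ} (huv : u ≤ v)
    (hf : ∀ t ∈ Set.Icc u v, HasDerivAt f (f' t) t)
    (hg : ∀ t ∈ Set.Icc u v, HasDerivAt g (g' t) t)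
    (hle : ∀ t ∈ Set.Icc u v, ‖f' t‖ ≤ g' t) : ‖f v - f u‖ ≤ g v - g u := by
  have := image_norm_le_of_norm_deriv_right_le_deriv_boundary' (a := u) (b := v)
    (f := fun t => f t - f u) (f' := f') (B := fun t => g t - g u) (B' := g')
    (fun t ht => ((hf t ht).continuousAt.sub continuousAt_const).continuousWithinAt)
    (fun t ht => ((hf t ⟨ht.1, ht.2.le⟩).sub_const _).hasDerivWithinAt) (by simp)
    (fun t ht => ((hg t ht).continuousAt.sub continuousAt_const).continuousWithinAt)
    (fun t ht => ((hg t ⟨ht.1, ht.2.le⟩).sub_const _).hasDerivWithinAt)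
    (fun t ht => hle t ⟨ht.1, ht.2.le⟩)
  exact this ⟨huv, le_rfl⟩

/-- The Gaussian primitive corrected by the first two terms of its asymptotic expansion. -/
def gaussCorr (b : ℂ) (u : ℝ) : ℂ :=
  gaussPrim b u + cexp (-b * (u : ℂ) ^ 2) * (1 / (2 * b * u) - 1 / (4 * b ^ 2 * u ^ 3))

lemma hasDerivAt_gaussCorr {b : ℂ} (hb : b ≠ 0) {u : ℝ} (hu : u ≠ 0) :
    HasDerivAt (gaussCorr b) (cexp (-b * (u : ℂ) ^ 2) * (3 / (4 * b ^ 2 * u ^ 4))) u := by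
  have hu' : (u : ℂ) ≠ 0 := by exact_mod_cast hu
  have h1 := hasDerivAt_gaussPrim b u
  have hid : HasDerivAt (fun t : ℝ => (t : ℂ)) 1 u := Complex.ofRealCLM.hasDerivAt
  have h2 := ((hid.pow 2).const_mul (-b)).cexp
  have h3 := (hid.const_mul (2 * b)).fun_inv (by simp [hb, hu])
  have h4 := ((hid.pow 3).const_mul (4 * b ^ 2)).fun_inv (by simp [hb, hu])
  have := h1.add (h2.mul (h3.sub h4))
  refine HasDerivAt.congr_of_eventuallyEq (HasDerivAt.congr_deriv this ?_) ?_
  · simp only [Pi.pow_apply, Pi.sub_apply]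
    field_simp
    ring
  · filter_upwards with t
    simp [gaussCorr, one_div]

lemma norm_gaussCorr_sub_le {b : ℂ} (hb : 0 ≤ b.re) (hb1 : 1 ≤ ‖b‖) {u v : ℝ} (hu : 0 < u)
    (huv : u ≤ v) : ‖gaussCorr b v - gaussCorr b u‖ ≤ 1 / (4 * u ^ 3) := by
  have hb0 : b ≠ 0 := norm_pos_iff.1 (by linarith)
  have key := norm_sub_le_of_norm_deriv_le (f := gaussCorr b)
    (f' := fun u => cexp (-b * (u : ℂ) ^ 2) * (3 / (4 * b ^ 2 * u ^ 4)))
    (g := fun t => -(4 * t ^ 3)⁻¹) (g' := fun t => 3 / (4 * t ^ 4)) huv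
    (fun t ht => hasDerivAt_gaussCorr hb0 (ne_of_gt (by linarith [ht.1]))) ?_ ?_
  · refine key.trans ?_
    have : 0 < (4 * v ^ 3)⁻¹ := by have := hu.trans_le huv; positivity
    rw [one_div]
    linarith
  · intro t ht
    have ht0 : 0 < t := by linarith [ht.1]
    have := (((hasDerivAt_id t).pow 3).const_mul 4).fun_inv (by simp; positivity) |>.fun_neg
    refine this.congr_deriv ?_
    simp
    field_simp
  · intro t ht
    have ht0 : 0 < t := by linarith [ht.1]
    have h1 : ‖cexp (-b * (t : ℂ) ^ 2)‖ ≤ 1 := by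
      rw [Complex.norm_exp, Real.exp_le_one_iff]
      rw [← ofReal_pow, re_mul_ofReal, neg_re]
      nlinarith [sq_nonneg t]
    rw [norm_mul, norm_div, norm_mul, norm_mul, norm_pow, norm_pow, norm_real, Real.norm_eq_abs,
      abs_of_pos ht0]
    simp only [RCLike.norm_ofNat]
    have h2 : 3 / (4 * ‖b‖ ^ 2 * t ^ 4) ≤ 3 / (4 * t ^ 4) := by
      gcongr
      nlinarith
    calc _ ≤ 1 * (3 / (4 * ‖b‖ ^ 2 * t ^ 4)) := by gcongr
      _ ≤ _ := by rwa [one_mul]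

lemma tendsto_expansion_zero {b : ℂ} (hb : 0 ≤ b.re) :
    Filter.Tendsto (fun v : ℝ => cexp (-b * (v : ℂ) ^ 2) *
      (1 / (2 * b * v) - 1 / (4 * b ^ 2 * v ^ 3))) Filter.atTop (nhds 0) := by
  have hinv : Filter.Tendsto (fun v : ℝ => (v : ℂ)⁻¹) Filter.atTop (nhds 0) := by
    have := (Complex.continuous_ofReal.tendsto 0).comp tendsto_inv_atTop_zero
    simpa [Function.comp_def] using this
  have h1 : Filter.Tendsto (fun v : ℝ => (1 / (2 * b) * (v : ℂ)⁻¹ -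
      1 / (4 * b ^ 2) * (v : ℂ)⁻¹ ^ 3)) Filter.atTop (nhds 0) := by
    have := (hinv.const_mul (1 / (2 * b))).sub ((hinv.pow 3).const_mul (1 / (4 * b ^ 2)))
    simpa using this
  refine squeeze_zero_norm (fun v => ?_) (norm_zero (E := ℂ) ▸ h1.norm)
  have h2 : ‖cexp (-b * (v : ℂ) ^ 2)‖ ≤ 1 := by
    rw [Complex.norm_exp, Real.exp_le_one_iff]
    rw [← ofReal_pow, re_mul_ofReal, neg_re]
    nlinarith [sq_nonneg v]
  rw [norm_mul]
  refine (mul_le_of_le_one_left (norm_nonneg _) h2).trans (le_of_eq ?_)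
  congr 1
  simp only [one_div, mul_inv, inv_pow]

lemma norm_gaussLim_sub_gaussCorr_le {b : ℂ} (hb : 0 < b.re) (hb1 : 1 ≤ ‖b‖) {u : ℝ}
    (hu : 0 < u) : ‖(π / b) ^ (1 / 2 : ℂ) / 2 - gaussCorr b u‖ ≤ 1 / (4 * u ^ 3) := by
  have h1 : Filter.Tendsto (gaussPrim b) Filter.atTop (nhds ((π / b) ^ (1 / 2 : ℂ) / 2)) := by
    rw [← integral_gaussian_complex_Ioi hb]
    exact intervalIntegral_tendsto_integral_Ioi 0 (integrable_cexp_neg_mul_sq hb).integrableOn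
      Filter.tendsto_id
  have h2 := h1.add (tendsto_expansion_zero hb.le)
  rw [add_zero] at h2
  refine le_of_tendsto (h2.sub_const (gaussCorr b u)).norm ?_
  filter_upwards [Filter.eventually_ge_atTop u] with v hv
  exact norm_gaussCorr_sub_le hb.le hb1 hu hv

lemma pi_mul_I_cpow_half : (π / (-I) : ℂ) ^ (1 / 2 : ℂ) / 2 = fresnelLim := by
  have h : (π / (-I) : ℂ) = (π : ℝ) * I := by
    rw [div_neg, div_I, neg_neg]
  have hn : ‖((π : ℝ) : ℂ) * I‖ = π := by simp [abs_of_pos pi_pos]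
  have hs : √π * √2 / 4 = √(π / 8) := by
    rw [eq_comm, Real.sqrt_eq_iff_mul_self_eq (by positivity) (by positivity)]
    have h1 := Real.mul_self_sqrt pi_pos.le
    have h2 := Real.mul_self_sqrt (zero_le_two (α := ℝ))
    linear_combination (-1 / 16 * √2 * √2) * h1 - π / 16 * h2
  rw [h, show (1 / 2 : ℂ) = ((1 / 2 : ℝ) : ℂ) by simp, cpow_ofReal, hn, arg_real_mul I pi_pos,
    arg_I, show π / 2 * (1 / 2) = π / 4 by ring, Real.cos_pi_div_four, Real.sin_pi_div_four,
    ← Real.sqrt_eq_rpow, fresnelLim, ← hs]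
  push_cast
  ring

lemma norm_fresnelLim_sub_gaussCorr_le {u : ℝ} (hu : 0 < u) :
    ‖fresnelLim - gaussCorr (-I) u‖ ≤ 1 / (4 * u ^ 3) := by
  have hb : Filter.Tendsto (fun ε : ℝ => (ε : ℂ) - I) (nhdsWithin 0 (Set.Ioi 0)) (nhds (-I)) := by
    have : Continuous fun ε : ℝ => (ε : ℂ) - I := by fun_prop
    simpa using (this.tendsto 0).mono_left nhdsWithin_le_nhds
  have h1 : Filter.Tendsto (fun ε : ℝ => (π / ((ε : ℂ) - I)) ^ (1 / 2 : ℂ) / 2)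
      (nhdsWithin 0 (Set.Ioi 0)) (nhds fresnelLim) := by
    rw [← pi_mul_I_cpow_half]
    refine Filter.Tendsto.div_const (Filter.Tendsto.cpow (tendsto_const_nhds.div hb (by simp))
      tendsto_const_nhds ?_) 2
    simp [slitPlane, div_neg, div_I, pi_ne_zero]
  have h2 : Filter.Tendsto (fun ε : ℝ => gaussCorr ((ε : ℂ) - I) u)
      (nhdsWithin 0 (Set.Ioi 0)) (nhds (gaussCorr (-I) u)) := by
    have hc : ContinuousAt (fun b => gaussCorr b u) (-I) := by
      refine ContinuousAt.add ?_ (ContinuousAt.mul (by fun_prop) (ContinuousAt.sub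
        (ContinuousAt.div (by fun_prop) (by fun_prop) ?_)
        (ContinuousAt.div (by fun_prop) (by fun_prop) ?_)))
      · refine Continuous.continuousAt ?_
        refine intervalIntegral.continuous_parametric_intervalIntegral_of_continuous' ?_ _ _
        fun_prop
      · simp [hu.ne']
      · simp [hu.ne']
    exact hc.tendsto.comp hb
  refine le_of_tendsto (h1.sub h2).norm ?_
  filter_upwards [self_mem_nhdsWithin] with ε hε
  refine norm_gaussLim_sub_gaussCorr_le (by simpa using hε) ?_ hu
  have := Complex.abs_im_le_norm ((ε : ℂ) - I)
  simpa using this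

lemma fresnelLim_sq : fresnelLim ^ 2 = I * (π / 4 : ℝ) := by
  have h : ((√(π / 8) : ℝ) : ℂ) ^ 2 = ((π / 8 : ℝ) : ℂ) := by
    rw [← ofReal_pow, Real.sq_sqrt (by positivity)]
  rw [fresnelLim, mul_pow, h]
  push_cast
  linear_combination (π / 8 : ℂ) * I_sq

lemma I_mul_conj_fresnelLim : I * conj fresnelLim = fresnelLim := by
  simp only [fresnelLim, map_mul, conj_ofReal, map_add, map_one, conj_I]
  linear_combination (-√(π / 8) : ℂ) * I_sq

lemma norm_fresnelLim_le : ‖fresnelLim‖ ≤ 1 := by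
  have h : ‖fresnelLim‖ ^ 2 = π / 4 := by
    rw [← norm_pow, fresnelLim_sq, norm_mul, norm_I, one_mul, norm_real, Real.norm_eq_abs,
      abs_of_pos (by positivity)]
  have := pi_lt_four
  nlinarith [norm_nonneg fresnelLim]

/-- The remainder of the Fresnel integral, with its oscillation removed. -/
def fresnelRem (u : ℝ) : ℂ := cexp (-I * (u : ℂ) ^ 2) * (fresnel u - (Real.sign u : ℝ) * fresnelLim)

lemma fresnelRem_neg (u : ℝ) : fresnelRem (-u) = -fresnelRem u := by
  rw [fresnelRem, fresnelRem, fresnel_neg, Real.sign_neg]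
  push_cast
  ring_nf

lemma norm_exp_neg_I_mul_sq (u : ℝ) : ‖cexp (-I * (u : ℂ) ^ 2)‖ = 1 := by
  rw [neg_mul, Complex.exp_neg, norm_inv, norm_exp_I_mul_sq, inv_one]

lemma norm_fresnelRem_sub_le {u : ℝ} (hu : 0 < u) :
    ‖fresnelRem u - 1 / (2 * I * u)‖ ≤ 1 / (2 * u ^ 3) := by
  have h := norm_fresnelLim_sub_gaussCorr_le hu
  have hu' : (u : ℂ) ≠ 0 := by exact_mod_cast hu.ne'
  have he : cexp (-I * (u : ℂ) ^ 2) * cexp (I * (u : ℂ) ^ 2) = 1 := by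
    rw [← Complex.exp_add]; simp
  have h1 : fresnelRem u - 1 / (2 * I * u) =
      -(cexp (-I * (u : ℂ) ^ 2) * (fresnelLim - gaussCorr (-I) u)) - 1 / (4 * u ^ 3) := by
    rw [fresnelRem, gaussCorr, gaussPrim_neg_I, Real.sign_of_pos hu, neg_neg]
    have e1 : (1 / (2 * -I * u) : ℂ) = - (1 / (2 * I * u)) := by
      rw [mul_neg, neg_mul, div_neg]
    have e2 : (1 / (4 * (-I) ^ 2 * u ^ 3) : ℂ) = - (1 / (4 * u ^ 3)) := by
      rw [neg_sq, I_sq]; ring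
    rw [e1, e2]
    push_cast
    linear_combination (-1 / (4 * u ^ 3) + 1 / (2 * I * u) : ℂ) * he
  rw [h1]
  refine (norm_sub_le _ _).trans ?_
  rw [norm_neg, norm_mul, norm_exp_neg_I_mul_sq, one_mul]
  have h2 : ‖(1 / (4 * u ^ 3) : ℂ)‖ = 1 / (4 * u ^ 3) := by
    rw [norm_div, norm_mul, norm_pow, norm_real, Real.norm_eq_abs, abs_of_pos hu]
    simp
  rw [h2]
  calc _ ≤ 1 / (4 * u ^ 3) + 1 / (4 * u ^ 3) := by gcongr
    _ = _ := by field_simp; norm_num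

lemma norm_inv_two_I_mul {u : ℝ} (hu : 0 < u) : ‖(1 / (2 * I * u) : ℂ)‖ = 1 / (2 * u) := by
  simp [abs_of_pos hu]

lemma norm_fresnelRem_le_of_pos {u : ℝ} (hu : 0 < u) : ‖fresnelRem u‖ ≤ 4 / (1 + u) := by
  rw [le_div_iff₀ (by positivity)]
  rcases le_total u 1 with h | h
  · have h1 : ‖fresnelRem u‖ ≤ 2 := by
      rw [fresnelRem, norm_mul, norm_exp_neg_I_mul_sq, one_mul, Real.sign_of_pos hu]
      refine (norm_sub_le _ _).trans ?_
      have := norm_fresnel_le u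
      rw [abs_of_pos hu] at this
      have := norm_fresnelLim_le
      simp
      linarith
    nlinarith [norm_nonneg (fresnelRem u)]
  · have h1 : ‖fresnelRem u‖ ≤ 1 / (2 * u ^ 3) + 1 / (2 * u) := by
      calc _ = ‖(fresnelRem u - 1 / (2 * I * u)) + 1 / (2 * I * u)‖ := by rw [sub_add_cancel]
        _ ≤ _ := (norm_add_le _ _).trans
          (add_le_add (norm_fresnelRem_sub_le hu) (norm_inv_two_I_mul hu).le)
    have h2 : 1 / (2 * u ^ 3) ≤ 1 / (2 * u) := by
      gcongr
      exact le_self_pow₀ h (by norm_num)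
    have h3 : 1 / (2 * u) * (1 + u) ≤ 1 := by
      rw [div_mul_eq_mul_div, div_le_one (by positivity)]; linarith
    nlinarith

lemma norm_fresnelRem_le {u : ℝ} : ‖fresnelRem u‖ ≤ 4 / (1 + |u|) := by
  rcases lt_trichotomy u 0 with h | rfl | h
  · have := norm_fresnelRem_le_of_pos (neg_pos.2 h)
    rwa [fresnelRem_neg, norm_neg, ← abs_of_neg h] at this
  · simp [fresnelRem, fresnel_zero]
  · rw [abs_of_pos h]; exact norm_fresnelRem_le_of_pos h

lemma hasDerivAt_fresnelRem {u : ℝ} (hu : 0 < u) :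
    HasDerivAt fresnelRem (1 - 2 * I * u * fresnelRem u) u := by
  have hid : HasDerivAt (fun t : ℝ => (t : ℂ)) 1 u := Complex.ofRealCLM.hasDerivAt
  have h := ((hid.pow 2).const_mul (-I)).cexp.mul ((hasDerivAt_fresnel u).sub_const fresnelLim)
  have he : cexp (-I * (u : ℂ) ^ 2) * cexp (I * (u : ℂ) ^ 2) = 1 := by
    rw [← Complex.exp_add]; simp
  refine HasDerivAt.congr_of_eventuallyEq (h.congr_deriv ?_) ?_
  · rw [fresnelRem, Real.sign_of_pos hu]
    simp only [Pi.pow_apply]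
    push_cast
    linear_combination he
  · filter_upwards [lt_mem_nhds hu] with t ht
    simp [fresnelRem, Real.sign_of_pos ht]

lemma norm_deriv_fresnelRem_le {u : ℝ} (hu : 0 < u) :
    ‖1 - 2 * I * u * fresnelRem u‖ ≤ 10 / (1 + u) := by
  rw [le_div_iff₀ (by positivity)]
  have hu' : (u : ℂ) ≠ 0 := by exact_mod_cast hu.ne'
  rcases le_total u 1 with h | h
  · have h1 : ‖1 - 2 * I * u * fresnelRem u‖ ≤ 1 + 2 * u * ‖fresnelRem u‖ := by
      refine (norm_sub_le _ _).trans (le_of_eq ?_)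
      simp [abs_of_pos hu]
    have h2 := norm_fresnelRem_le_of_pos hu
    rw [le_div_iff₀ (by positivity)] at h2
    nlinarith [norm_nonneg (fresnelRem u)]
  · have h1 : ‖1 - 2 * I * u * fresnelRem u‖ ≤ 1 / u ^ 2 := by
      have e : 1 - 2 * I * u * fresnelRem u =
          -(2 * I * u) * (fresnelRem u - 1 / (2 * I * u)) := by
        have := I_ne_zero
        field_simp
        ring
      have := norm_fresnelRem_sub_le hu
      rw [e, norm_mul]
      calc _ ≤ 2 * u * (1 / (2 * u ^ 3)) := by
            gcongr
            simp [abs_of_pos hu]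
        _ = _ := by field_simp
    have h2 : 1 / u ^ 2 * (1 + u) ≤ 2 := by
      rw [div_mul_eq_mul_div, div_le_iff₀ (by positivity)]; nlinarith
    nlinarith [norm_nonneg (1 - 2 * I * u * fresnelRem u)]

lemma norm_fresnelRem_sub_fresnelRem_le {u v : ℝ} (hu : 0 < u) (huv : u ≤ v) :
    ‖fresnelRem v - fresnelRem u‖ ≤ 10 / (1 + u) * (v - u) := by
  have := norm_sub_le_of_norm_deriv_le (f := fresnelRem)
    (f' := fun t => 1 - 2 * I * t * fresnelRem t)
    (g := fun t => 10 / (1 + u) * t) (g' := fun _ => 10 / (1 + u)) huv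
    (fun t ht => hasDerivAt_fresnelRem (by linarith [ht.1]))
    (fun t _ => by simpa using (hasDerivAt_id t).const_mul (10 / (1 + u)))
    (fun t ht => (norm_deriv_fresnelRem_le (by linarith [ht.1])).trans
      (by have := ht.1; gcongr))
  rwa [← mul_sub] at this

lemma tendsto_fresnel_atTop : Filter.Tendsto fresnel Filter.atTop (nhds fresnelLim) := by
  rw [tendsto_iff_norm_sub_tendsto_zero]
  have h : Filter.Tendsto (fun u : ℝ => 4 / (1 + u)) Filter.atTop (nhds 0) :=
    tendsto_const_nhds.div_atTop (Filter.tendsto_atTop_add_const_left _ _ Filter.tendsto_id)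
  refine squeeze_zero' (Filter.Eventually.of_forall fun _ => norm_nonneg _) ?_ h
  filter_upwards [Filter.eventually_gt_atTop 0] with u hu
  have := norm_fresnelRem_le_of_pos hu
  rw [fresnelRem, norm_mul, norm_exp_neg_I_mul_sq, one_mul, Real.sign_of_pos hu] at this
  simpa using this

lemma norm_fresnel_le_five (u : ℝ) : ‖fresnel u‖ ≤ 5 := by
  have h := norm_fresnelRem_le (u := u)
  have h1 : ‖fresnelRem u‖ ≤ 4 := h.trans (div_le_self (by norm_num) (by simp))
  rw [fresnelRem, norm_mul, norm_exp_neg_I_mul_sq, one_mul] at h1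
  have h2 : ‖((Real.sign u : ℝ) : ℂ) * fresnelLim‖ ≤ 1 := by
    have h3 : ‖((Real.sign u : ℝ) : ℂ)‖ ≤ 1 := by
      rcases Real.sign_apply_eq u with h | h | h <;> simp [h]
    rw [norm_mul]
    nlinarith [norm_fresnelLim_le, norm_nonneg fresnelLim]
  calc _ = ‖(fresnel u - (Real.sign u : ℝ) * fresnelLim) + (Real.sign u : ℝ) * fresnelLim‖ := by
        rw [sub_add_cancel]
    _ ≤ _ := (norm_add_le _ _).trans (by linarith)

/-- The divided difference of `t ↦ exp (i t)` between `0` and `x² - z²`. -/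
def expQuot (x z : ℝ) : ℂ := (cexp (I * ((x ^ 2 - z ^ 2 : ℝ) : ℂ)) - 1) / ((x ^ 2 - z ^ 2 : ℝ) : ℂ)

lemma norm_exp_I_mul (w : ℝ) : ‖cexp (I * (w : ℂ))‖ = 1 := by
  rw [mul_comm]; exact norm_exp_ofReal_mul_I w

lemma norm_expQuot_le (x z : ℝ) : ‖expQuot x z‖ ≤ (x ^ 2 + 3) * (1 + z ^ 2)⁻¹ := by
  set w := x ^ 2 - z ^ 2 with hw
  have h1 : ‖cexp (I * (w : ℂ)) - 1‖ ≤ |w| := by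
    simpa using Real.norm_exp_I_mul_ofReal_sub_one_le (x := w)
  have h2 : ‖cexp (I * (w : ℂ)) - 1‖ ≤ 2 := by
    refine (norm_sub_le _ _).trans ?_
    rw [norm_exp_I_mul]; norm_num
  rw [← div_eq_mul_inv, le_div_iff₀ (by positivity), expQuot, ← hw, norm_div, norm_real,
    Real.norm_eq_abs]
  rcases eq_or_ne w 0 with h | h
  · rw [h]; simp; positivity
  have hp : 0 < |w| := abs_pos.2 h
  rw [div_mul_eq_mul_div, div_le_iff₀ hp]
  have h3 : 1 + z ^ 2 ≤ (1 + x ^ 2) + |w| := by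
    have := neg_abs_le w
    rw [hw] at this ⊢
    linarith
  calc _ ≤ ‖cexp (I * (w : ℂ)) - 1‖ * ((1 + x ^ 2) + |w|) := by gcongr
    _ = ‖cexp (I * (w : ℂ)) - 1‖ * (1 + x ^ 2) + ‖cexp (I * (w : ℂ)) - 1‖ * |w| := by ring
    _ ≤ |w| * (1 + x ^ 2) + 2 * |w| := by gcongr
    _ = _ := by ring

lemma integrable_expQuot (x : ℝ) : Integrable (expQuot x) := by
  refine (integrable_inv_one_add_sq.const_mul (x ^ 2 + 3)).mono' ?_
    (Filter.Eventually.of_forall (norm_expQuot_le x))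
  unfold expQuot
  exact Measurable.aestronglyMeasurable (by fun_prop)

lemma expQuot_eq_integral {x z : ℝ} (h : x ^ 2 ≠ z ^ 2) :
    expQuot x z = ∫ u in (0:ℝ)..1, I * (2 * u) *
      (cexp (I * ((u * x : ℝ) : ℂ) ^ 2) * cexp (-I * ((u * z : ℝ) : ℂ) ^ 2)) := by
  have hw : ((x : ℂ) ^ 2 - z ^ 2) ≠ 0 := by
    rw [sub_ne_zero]; exact_mod_cast h
  have hd : ∀ u ∈ Set.uIcc (0:ℝ) 1, HasDerivAt
      (fun u : ℝ => cexp (I * (u : ℂ) ^ 2 * ((x : ℂ) ^ 2 - z ^ 2)) / ((x : ℂ) ^ 2 - z ^ 2))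
      (I * (2 * u) * (cexp (I * ((u * x : ℝ) : ℂ) ^ 2) * cexp (-I * ((u * z : ℝ) : ℂ) ^ 2))) u := by
    intro u _
    have hid : HasDerivAt (fun t : ℝ => (t : ℂ)) 1 u := Complex.ofRealCLM.hasDerivAt
    have := ((((hid.pow 2).const_mul I).mul_const ((x : ℂ) ^ 2 - z ^ 2)).cexp).div_const
      ((x : ℂ) ^ 2 - z ^ 2)
    refine this.congr_deriv ?_
    rw [← Complex.exp_add]
    simp only [Pi.pow_apply]
    push_cast
    field_simp
    ring_nf
  rw [intervalIntegral.integral_eq_sub_of_hasDerivAt hd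
    (Continuous.intervalIntegrable (by fun_prop) _ _), expQuot]
  push_cast
  simp [sub_div]

lemma fresnel_mul (x Z : ℝ) :
    x * ∫ u in (0:ℝ)..Z, cexp (I * ((x * u : ℝ) : ℂ) ^ 2) = fresnel (x * Z) := by
  have := intervalIntegral.smul_integral_comp_mul_left (a := 0) (b := Z)
    (fun v : ℝ => cexp (I * (v : ℂ) ^ 2)) x
  rw [mul_zero] at this
  rw [fresnel, ← this]
  simp

lemma conj_fresnel_mul (u Z : ℝ) :
    u * ∫ z in (0:ℝ)..Z, cexp (-I * ((u * z : ℝ) : ℂ) ^ 2) = conj (fresnel (u * Z)) := by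
  have := intervalIntegral.smul_integral_comp_mul_left (a := 0) (b := Z)
    (fun v : ℝ => cexp (-I * (v : ℂ) ^ 2)) u
  rw [mul_zero] at this
  rw [conj_fresnel, ← this]
  simp

lemma intervalIntegral_expQuot (x Z : ℝ) :
    ∫ z in (0:ℝ)..Z, expQuot x z =
      ∫ u in (0:ℝ)..1, 2 * I * cexp (I * ((u * x : ℝ) : ℂ) ^ 2) * conj (fresnel (u * Z)) := by
  have h1 : ∫ z in (0:ℝ)..Z, expQuot x z = ∫ z in (0:ℝ)..Z, ∫ u in (0:ℝ)..1, I * (2 * u) *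
      (cexp (I * ((u * x : ℝ) : ℂ) ^ 2) * cexp (-I * ((u * z : ℝ) : ℂ) ^ 2)) := by
    refine intervalIntegral.integral_congr_ae ?_
    have : ∀ᵐ z : ℝ, z ∉ ({x, -x} : Set ℝ) :=
      (Set.Finite.measure_zero (by simp) volume : volume ({x, -x} : Set ℝ) = 0)
        |> compl_mem_ae_iff.2
    filter_upwards [this] with z hz _
    refine expQuot_eq_integral fun h => hz ?_
    rcases sq_eq_sq_iff_eq_or_eq_neg.1 h.symm with h | h <;> simp [h]
  rw [h1, intervalIntegral_intervalIntegral_swap]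
  · refine intervalIntegral.integral_congr fun u _ => ?_
    rw [← conj_fresnel_mul, intervalIntegral.integral_const_mul,
      intervalIntegral.integral_const_mul]
    ring
  · refine (ContinuousOn.integrableOn_compact (isCompact_uIcc.prod isCompact_uIcc)
      (Continuous.continuousOn ?_)).mono_set
        (Set.prod_mono Set.uIoc_subset_uIcc Set.uIoc_subset_uIcc)
    simp only [Function.uncurry_def]
    fun_prop

lemma integral_expQuot (x : ℝ) :
    x * ∫ z in Set.Ioi (0:ℝ), expQuot x z = 2 * fresnelLim * fresnel x := by
  have h1 := intervalIntegral_tendsto_integral_Ioi 0 (integrable_expQuot x).integrableOn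
    Filter.tendsto_id
  have h2 : Filter.Tendsto (fun Z : ℝ => ∫ z in (0:ℝ)..Z, expQuot x z) Filter.atTop
      (nhds (∫ u in (0:ℝ)..1, 2 * I * cexp (I * ((u * x : ℝ) : ℂ) ^ 2) * conj fresnelLim)) := by
    simp_rw [intervalIntegral_expQuot]
    refine intervalIntegral.tendsto_integral_filter_of_dominated_convergence (fun _ => 10)
      (Filter.Eventually.of_forall fun Z => ?_) (Filter.Eventually.of_forall fun Z => ?_)
      (by simp) ?_
    · have := continuous_fresnel
      have : Continuous fun u : ℝ => conj (fresnel (u * Z)) :=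
        continuous_conj.comp (by fun_prop)
      exact Continuous.aestronglyMeasurable (by fun_prop)
    · filter_upwards with u _
      rw [norm_mul, norm_mul, norm_exp_I_mul_sq, RCLike.norm_conj]
      have := norm_fresnel_le_five (u * Z)
      simp; linarith
    · filter_upwards with u hu
      have hu0 : 0 < u := by
        rw [Set.uIoc_of_le zero_le_one] at hu; exact hu.1
      have : Filter.Tendsto (fun Z => conj (fresnel (u * Z))) Filter.atTop
          (nhds (conj fresnelLim)) :=
        (continuous_conj.tendsto _).comp
          (tendsto_fresnel_atTop.comp (Filter.tendsto_id.const_mul_atTop hu0))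
      exact this.const_mul _
  have h3 := tendsto_nhds_unique h1 h2
  rw [h3, intervalIntegral.integral_mul_const, intervalIntegral.integral_const_mul]
  have h4 := fresnel_mul x 1
  rw [mul_one] at h4
  simp_rw [mul_comm _ x]
  rw [← h4]
  linear_combination (2 * x * ∫ u in (0:ℝ)..1, cexp (I * ((x * u : ℝ) : ℂ) ^ 2)) *
    I_mul_conj_fresnelLim

/-- The kernel `sin ((x² - y²) / 2) / (x - y)`. -/
def sinKer (x y : ℝ) : ℝ := Real.sin ((x ^ 2 - y ^ 2) / 2) / (x - y)

lemma abs_sinKer_mul_le (x y : ℝ) : |sinKer x y| * |x - y| ≤ 1 := by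
  rcases eq_or_ne x y with rfl | h
  · simp
  · rw [sinKer, abs_div, div_mul_cancel₀ _ (abs_ne_zero.2 (sub_ne_zero.2 h))]
    exact Real.abs_sin_le_one _

lemma abs_sinKer_le (x y : ℝ) : |sinKer x y| ≤ |x + y| / 2 := by
  rcases eq_or_ne x y with rfl | h
  · simp [sinKer]; positivity
  · rw [sinKer, abs_div, div_le_iff₀ (abs_pos.2 (sub_ne_zero.2 h))]
    refine (Real.abs_sin_le_abs).trans (le_of_eq ?_)
    rw [show (x ^ 2 - y ^ 2) / 2 = (x + y) / 2 * (x - y) by ring, abs_mul, abs_div]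
    norm_num

lemma abs_sinKer_le_of_abs_le {r x : ℝ} (hx : |x| ≤ r) (z : ℝ) :
    |sinKer z x| ≤ ((1 + r) ^ 2 + 1) * (1 + |z|)⁻¹ := by
  have hr : 0 ≤ r := (abs_nonneg x).trans hx
  rw [← div_eq_mul_inv, le_div_iff₀ (by positivity)]
  have h1 := abs_sinKer_mul_le z x
  have h2 := abs_sinKer_le z x
  have h3 : |z| ≤ |z - x| + |x| := by
    simpa using abs_add_le (z - x) x
  have h4 : |z + x| ≤ |z - x| + 2 * |x| := by
    have := abs_add_le (z - x) (2 * x)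
    rw [abs_mul, abs_two] at this
    rwa [show z - x + 2 * x = z + x by ring] at this
  have h5 : |sinKer z x| ≤ 1 + r := by
    rcases le_total |z - x| 1 with h | h
    · linarith
    · nlinarith [abs_nonneg (sinKer z x)]
  nlinarith [abs_nonneg (sinKer z x)]

lemma abs_sinKer_mul_sinKer_le {r x y : ℝ} (hx : |x| ≤ r) (hy : |y| ≤ r) (z : ℝ) :
    |sinKer z x * sinKer z y| ≤ ((1 + r) ^ 2 + 1) ^ 2 * (1 + z ^ 2)⁻¹ := by
  have hr : 0 ≤ r := (abs_nonneg x).trans hx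
  rw [abs_mul]
  calc _ ≤ (((1 + r) ^ 2 + 1) * (1 + |z|)⁻¹) * (((1 + r) ^ 2 + 1) * (1 + |z|)⁻¹) := by
        gcongr
        · exact abs_sinKer_le_of_abs_le hx z
        · exact abs_sinKer_le_of_abs_le hy z
    _ = ((1 + r) ^ 2 + 1) ^ 2 * ((1 + |z|) ^ 2)⁻¹ := by rw [← inv_pow]; ring
    _ ≤ _ := by
        gcongr
        nlinarith [abs_nonneg z, sq_abs z]

lemma integrable_sinKer_mul_sinKer (x y : ℝ) : Integrable fun z => sinKer z x * sinKer z y := by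
  refine (integrable_inv_one_add_sq.const_mul (((1 + max |x| |y|) ^ 2 + 1) ^ 2)).mono' ?_
    (Filter.Eventually.of_forall
      (abs_sinKer_mul_sinKer_le (le_max_left _ _) (le_max_right _ _)))
  unfold sinKer
  exact Measurable.aestronglyMeasurable (by fun_prop)

lemma re_exp_mul_expQuot (c x z : ℝ) :
    (cexp (I * (c : ℂ)) * expQuot x z).re =
      (Real.cos (c + (x ^ 2 - z ^ 2)) - Real.cos c) / (x ^ 2 - z ^ 2) := by
  rw [expQuot, mul_div_assoc', mul_sub, mul_one, ← Complex.exp_add, ← mul_add, ← ofReal_add,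
    div_ofReal_re, sub_re, mul_comm I, mul_comm I, exp_ofReal_mul_I_re, exp_ofReal_mul_I_re]

lemma sinKer_mul_sinKer_add_neg {x y z : ℝ} (hxy : x ≠ y) (hx : x ^ 2 ≠ z ^ 2)
    (hy : y ^ 2 ≠ z ^ 2) :
    sinKer z x * sinKer z y + sinKer (-z) x * sinKer (-z) y =
      (x * (cexp (I * ((-((x ^ 2 - y ^ 2) / 2) : ℝ) : ℂ)) * expQuot x z).re -
        y * (cexp (I * (((x ^ 2 - y ^ 2) / 2 : ℝ) : ℂ)) * expQuot y z).re) / (x - y) := by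
  rw [re_exp_mul_expQuot, re_exp_mul_expQuot]
  set α := (z ^ 2 - x ^ 2) / 2
  set β := (z ^ 2 - y ^ 2) / 2
  rw [show -((x ^ 2 - y ^ 2) / 2) + (x ^ 2 - z ^ 2) = -(α + β) by simp only [α, β]; ring,
    show ((x ^ 2 - y ^ 2) / 2) + (y ^ 2 - z ^ 2) = -(α + β) by simp only [α, β]; ring,
    show (x ^ 2 - y ^ 2) / 2 = -(α - β) by simp only [α, β]; ring, neg_neg, Real.cos_neg,
    Real.cos_neg, Real.cos_add, Real.cos_sub, sinKer, sinKer, sinKer, sinKer, neg_sq]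
  have h1 : x - y ≠ 0 := sub_ne_zero.2 hxy
  have h2 : x ^ 2 - z ^ 2 ≠ 0 := sub_ne_zero.2 hx
  have h3 : y ^ 2 - z ^ 2 ≠ 0 := sub_ne_zero.2 hy
  have h4 : z - x ≠ 0 := fun h => h2 (by linear_combination (-z - x) * h)
  have h5 : -z - x ≠ 0 := fun h => h2 (by linear_combination (z - x) * h)
  have h6 : z - y ≠ 0 := fun h => h3 (by linear_combination (-z - y) * h)
  have h7 : -z - y ≠ 0 := fun h => h3 (by linear_combination (z - y) * h)
  change Real.sin α / (z - x) * (Real.sin β / (z - y)) +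
    Real.sin α / (-z - x) * (Real.sin β / (-z - y)) = _
  field_simp
  ring

lemma integral_sinKer_mul_sinKer {x y : ℝ} (hxy : x ≠ y) :
    ∫ z, sinKer z x * sinKer z y = 2 * (fresnelLim *
      (cexp (I * ((-((x ^ 2 - y ^ 2) / 2) : ℝ) : ℂ)) * fresnel x -
        cexp (I * (((x ^ 2 - y ^ 2) / 2 : ℝ) : ℂ)) * fresnel y)).re / (x - y) := by
  have hi := integrable_sinKer_mul_sinKer x y
  rw [← intervalIntegral.integral_Iic_add_Ioi (b := 0) hi.integrableOn hi.integrableOn]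
  have h1 := integral_comp_neg_Ioi 0 (fun z => sinKer z x * sinKer z y)
  rw [neg_zero] at h1
  rw [← h1, add_comm, ← integral_add hi.integrableOn hi.comp_neg.integrableOn]
  have h2 : ∀ᵐ z ∂(volume.restrict (Set.Ioi (0:ℝ))),
      sinKer z x * sinKer z y + sinKer (-z) x * sinKer (-z) y =
      (x * (cexp (I * ((-((x ^ 2 - y ^ 2) / 2) : ℝ) : ℂ)) * expQuot x z).re -
        y * (cexp (I * (((x ^ 2 - y ^ 2) / 2 : ℝ) : ℂ)) * expQuot y z).re) / (x - y) := by
    refine ae_restrict_of_ae ?_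
    have : ∀ᵐ z : ℝ, z ∉ ({x, -x, y, -y} : Set ℝ) :=
      compl_mem_ae_iff.2 (Set.Finite.measure_zero (by simp) volume)
    filter_upwards [this] with z hz
    refine sinKer_mul_sinKer_add_neg hxy (fun h => hz ?_) (fun h => hz ?_) <;>
    rcases sq_eq_sq_iff_eq_or_eq_neg.1 h.symm with h | h <;> simp [h]
  rw [integral_congr_ae h2, integral_div]
  have e : ∀ c w : ℝ, Integrable (fun z => (cexp (I * (c : ℂ)) * expQuot w z))
      (volume.restrict (Set.Ioi (0:ℝ))) :=
    fun c w => ((integrable_expQuot w).const_mul _).integrableOn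
  have e1 : ∀ c w : ℝ, Integrable (fun z => w * (cexp (I * (c : ℂ)) * expQuot w z).re)
      (volume.restrict (Set.Ioi (0:ℝ))) := fun c w => (e c w).re.const_mul w
  have e2 : ∀ c w : ℝ, ∫ z in Set.Ioi (0:ℝ), w * (cexp (I * (c : ℂ)) * expQuot w z).re =
      2 * (fresnelLim * (cexp (I * (c : ℂ)) * fresnel w)).re := by
    intro c w
    have := integral_re (e c w)
    simp only [RCLike.re_to_complex] at this
    rw [integral_const_mul, this, integral_const_mul, ← re_ofReal_mul]
    rw [mul_left_comm, integral_expQuot]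
    simp only [mul_re, mul_im, re_ofNat, im_ofNat]
    ring
  rw [integral_sub (e1 _ _) (e1 _ _), e2, e2, mul_sub, sub_re, mul_sub]

/-- Up to a constant factor, the kernel of `A² - 1` multiplied by `x - y`. -/
def resNum (x y : ℝ) : ℝ :=
  (fresnelLim * cexp (I * (((x ^ 2 + y ^ 2) / 2 : ℝ) : ℂ)) * (fresnelRem x - fresnelRem y)).re

lemma resNum_eq (x y : ℝ) : resNum x y = (fresnelLim *
      (cexp (I * ((-((x ^ 2 - y ^ 2) / 2) : ℝ) : ℂ)) * fresnel x -
        cexp (I * (((x ^ 2 - y ^ 2) / 2 : ℝ) : ℂ)) * fresnel y)).re -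
      π / 4 * ((Real.sign x + Real.sign y) * Real.sin ((x ^ 2 - y ^ 2) / 2)) := by
  set δ := (x ^ 2 - y ^ 2) / 2 with hδ
  have e1 : cexp (I * (((x ^ 2 + y ^ 2) / 2 : ℝ) : ℂ)) * cexp (-I * (x : ℂ) ^ 2) =
      cexp (I * ((-δ : ℝ) : ℂ)) := by
    rw [← Complex.exp_add, hδ]; push_cast; congr 1; ring
  have e2 : cexp (I * (((x ^ 2 + y ^ 2) / 2 : ℝ) : ℂ)) * cexp (-I * (y : ℂ) ^ 2) =
      cexp (I * (δ : ℂ)) := by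
    rw [← Complex.exp_add, hδ]; push_cast; congr 1; ring
  have e3 : fresnelLim * cexp (I * (((x ^ 2 + y ^ 2) / 2 : ℝ) : ℂ)) *
      (fresnelRem x - fresnelRem y) = fresnelLim * (cexp (I * ((-δ : ℝ) : ℂ)) * fresnel x -
        cexp (I * (δ : ℂ)) * fresnel y) - ((π / 4 : ℝ) : ℂ) *
          (I * (((Real.sign x : ℝ) : ℂ) * cexp (I * ((-δ : ℝ) : ℂ)) -
          ((Real.sign y : ℝ) : ℂ) * cexp (I * (δ : ℂ)))) := by
    rw [← e1, ← e2, fresnelRem, fresnelRem]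
    linear_combination (- (cexp (I * (((x ^ 2 + y ^ 2) / 2 : ℝ) : ℂ)) *
      (cexp (-I * (x : ℂ) ^ 2) * ((Real.sign x : ℝ) : ℂ) -
        cexp (-I * (y : ℂ) ^ 2) * ((Real.sign y : ℝ) : ℂ)))) * fresnelLim_sq
  rw [resNum, e3, sub_re, re_ofReal_mul, mul_comm I (δ : ℂ), mul_comm I ((-δ : ℝ) : ℂ), I_mul_re,
    sub_im, im_ofReal_mul, im_ofReal_mul, exp_ofReal_mul_I_im, exp_ofReal_mul_I_im, Real.sin_neg]
  ring

lemma norm_fresnelLim_mul_exp_le (c : ℝ) : ‖fresnelLim * cexp (I * (c : ℂ))‖ ≤ 1 := by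
  rw [norm_mul, norm_exp_I_mul, mul_one]; exact norm_fresnelLim_le

lemma abs_resNum_le_norm (x y : ℝ) : |resNum x y| ≤ ‖fresnelRem x - fresnelRem y‖ := by
  refine (Complex.abs_re_le_norm _).trans ?_
  rw [norm_mul]
  exact mul_le_of_le_one_left (norm_nonneg _) (norm_fresnelLim_mul_exp_le _)

lemma abs_resNum_mul_le (x y : ℝ) : |resNum x y| * (1 + min |x| |y|) ≤ 8 := by
  rw [← le_div_iff₀ (by positivity)]
  refine (abs_resNum_le_norm x y).trans ((norm_sub_le _ _).trans ?_)
  have h1 : ‖fresnelRem x‖ ≤ 4 / (1 + min |x| |y|) :=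
    norm_fresnelRem_le.trans (by gcongr; exact min_le_left _ _)
  have h2 : ‖fresnelRem y‖ ≤ 4 / (1 + min |x| |y|) :=
    norm_fresnelRem_le.trans (by gcongr; exact min_le_right _ _)
  calc _ ≤ 4 / (1 + min |x| |y|) + 4 / (1 + min |x| |y|) := add_le_add h1 h2
    _ = _ := by ring

lemma resNum_swap (x y : ℝ) : resNum y x = -resNum x y := by
  rw [resNum, resNum, ← neg_sub (fresnelRem x), add_comm (y ^ 2), mul_neg, neg_re]

lemma resNum_neg (x y : ℝ) : resNum (-x) (-y) = -resNum x y := by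
  rw [resNum, resNum, fresnelRem_neg, fresnelRem_neg, neg_sq, neg_sq, ← neg_re]
  congr 1
  ring

lemma abs_resNum_mul_le_of_pos {x y : ℝ} (hx : 0 < x) (hxy : x ≤ y) :
    |resNum x y| * (1 + min |x| |y|) ≤ 10 * |x - y| := by
  rw [abs_of_pos hx, abs_of_pos (hx.trans_le hxy), min_eq_left hxy, abs_sub_comm,
    abs_of_nonneg (sub_nonneg.2 hxy), ← le_div_iff₀ (by positivity), mul_div_right_comm]
  refine (abs_resNum_le_norm x y).trans ?_
  rw [norm_sub_rev]
  exact norm_fresnelRem_sub_fresnelRem_le hx hxy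

lemma abs_resNum_le_of_neg_of_pos {x y : ℝ} (hx : x < 0) (hy : 0 < y) :
    |resNum x y| ≤ |x - y| := by
  rw [resNum_eq, Real.sign_of_neg hx, Real.sign_of_pos hy, neg_add_cancel, zero_mul, mul_zero,
    sub_zero]
  refine (Complex.abs_re_le_norm _).trans ?_
  rw [mul_sub, ← mul_assoc, ← mul_assoc]
  refine (norm_sub_le _ _).trans ?_
  rw [norm_mul _ (fresnel x), norm_mul _ (fresnel y)]
  calc _ ≤ 1 * |x| + 1 * |y| := by
        gcongr
        · exact norm_fresnelLim_mul_exp_le _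
        · exact norm_fresnel_le _
        · exact norm_fresnelLim_mul_exp_le _
        · exact norm_fresnel_le _
    _ = _ := by
        rw [abs_of_neg hx, abs_of_pos hy, abs_of_neg (by linarith)]; ring

lemma abs_resNum_mul_mul_le_of_lt {x y : ℝ} (hx : x ≠ 0) (hy : y ≠ 0) (hxy : x ≤ y) :
    |resNum x y| * ((1 + min |x| |y|) * (1 + |x - y|)) ≤ 20 * |x - y| := by
  have h0 : 0 ≤ |resNum x y| * (1 + min |x| |y|) := by positivity
  have hd := abs_nonneg (x - y)
  rw [← mul_assoc]
  rcases le_total 1 |x - y| with h | h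
  · nlinarith [abs_resNum_mul_le x y]
  have h2 : 1 + |x - y| ≤ 2 := by linarith
  suffices |resNum x y| * (1 + min |x| |y|) ≤ 10 * |x - y| by nlinarith
  rcases hx.lt_or_gt with hx | hx
  · rcases hy.lt_or_gt with hy | hy
    · have := abs_resNum_mul_le_of_pos (neg_pos.2 hy) (neg_le_neg hxy)
      rw [resNum_neg, resNum_swap, neg_neg, abs_neg, abs_neg, min_comm] at this
      rwa [show -y - -x = x - y by ring] at this
    · have h1 := abs_resNum_le_of_neg_of_pos hx hy
      have h3 : min |x| |y| ≤ |x - y| := by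
        refine (min_le_right _ _).trans ?_
        rw [abs_of_pos hy, abs_of_neg (by linarith)]; linarith
      nlinarith [abs_nonneg (resNum x y)]
  · exact abs_resNum_mul_le_of_pos hx hxy

lemma abs_resNum_mul_mul_le {x y : ℝ} (hx : x ≠ 0) (hy : y ≠ 0) :
    |resNum x y| * ((1 + min |x| |y|) * (1 + |x - y|)) ≤ 20 * |x - y| := by
  rcases le_total x y with h | h
  · exact abs_resNum_mul_mul_le_of_lt hx hy h
  · have := abs_resNum_mul_mul_le_of_lt hy hx h
    rwa [resNum_swap, abs_neg, min_comm, abs_sub_comm] at this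

lemma measurable_realSign : Measurable Real.sign := by
  unfold Real.sign
  exact Measurable.ite measurableSet_Iio measurable_const
    (Measurable.ite measurableSet_Ioi measurable_const measurable_const)

lemma abs_realSign_le (x : ℝ) : |Real.sign x| ≤ 1 := by
  rcases Real.sign_apply_eq x with h | h | h <;> simp [h]

lemma measurable_fresnelRem : Measurable fresnelRem := by
  have := continuous_fresnel.measurable
  have := measurable_realSign
  unfold fresnelRem
  fun_prop

lemma measurable_resNum : Measurable fun p : ℝ × ℝ => resNum p.1 p.2 := by
  have h1 : Measurable fun p : ℝ × ℝ => fresnelRem p.1 := measurable_fresnelRem.comp measurable_fst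
  have h2 : Measurable fun p : ℝ × ℝ => fresnelRem p.2 := measurable_fresnelRem.comp measurable_snd
  exact measurable_re.comp (Measurable.mul (by fun_prop) (h1.sub h2))

lemma ae_fst_ne_zero_and_snd_ne_zero : ∀ᵐ p : ℝ × ℝ, p.1 ≠ 0 ∧ p.2 ≠ 0 := by
  have h : ∀ᵐ x : ℝ, x ≠ 0 := by simp [ae_iff]
  exact (Measure.quasiMeasurePreserving_fst.ae h).and (Measure.quasiMeasurePreserving_snd.ae h)

lemma integrable_inv_one_add_sq_mul :
    Integrable fun p : ℝ × ℝ => (1 + p.2 ^ 2)⁻¹ * (1 + (p.1 - p.2) ^ 2)⁻¹ :=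
  Integrable.convolution_integrand (ContinuousLinearMap.mul ℝ ℝ)
    integrable_inv_one_add_sq integrable_inv_one_add_sq

lemma sq_resNum_div_le {x y : ℝ} (hx : x ≠ 0) (hy : y ≠ 0) :
    (resNum x y / (x - y)) ^ 2 ≤ 400 * ((1 + y ^ 2)⁻¹ * (1 + (x - y) ^ 2)⁻¹ +
      (1 + x ^ 2)⁻¹ * (1 + (y - x) ^ 2)⁻¹) := by
  rcases eq_or_ne x y with rfl | h
  · simp only [sub_self, div_zero, ne_eq, OfNat.ofNat_ne_zero, not_false_eq_true, zero_pow]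
    positivity
  have hd : 0 < |x - y| := abs_pos.2 (sub_ne_zero.2 h)
  have hm : 0 ≤ min |x| |y| := le_min (abs_nonneg _) (abs_nonneg _)
  have h1 : |resNum x y / (x - y)| ≤ 20 / ((1 + min |x| |y|) * (1 + |x - y|)) := by
    rw [abs_div, div_le_div_iff₀ hd (by positivity)]
    exact abs_resNum_mul_mul_le hx hy
  have h2 : (resNum x y / (x - y)) ^ 2 ≤
      400 * ((1 + min |x| |y| ^ 2)⁻¹ * (1 + (x - y) ^ 2)⁻¹) := by
    rw [← sq_abs]
    calc _ ≤ (20 / ((1 + min |x| |y|) * (1 + |x - y|))) ^ 2 := by gcongr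
      _ = 400 * (((1 + min |x| |y|) ^ 2)⁻¹ * ((1 + |x - y|) ^ 2)⁻¹) := by
        field_simp; norm_num
      _ ≤ _ := by
        gcongr
        · nlinarith
        · nlinarith [sq_abs (x - y)]
  refine h2.trans ?_
  rw [show (y - x) ^ 2 = (x - y) ^ 2 by ring, ← add_mul]
  gcongr
  rcases min_choice |x| |y| with h | h <;> rw [h, sq_abs]
  · exact le_add_of_nonneg_left (by positivity)
  · exact le_add_of_nonneg_right (by positivity)

lemma integrable_sq_resNum_div :
    Integrable fun p : ℝ × ℝ => (resNum p.1 p.2 / (p.1 - p.2)) ^ 2 := by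
  have h1 := integrable_inv_one_add_sq_mul
  have h2 : Integrable fun p : ℝ × ℝ => (1 + p.1 ^ 2)⁻¹ * (1 + (p.2 - p.1) ^ 2)⁻¹ := h1.swap
  refine ((h1.add h2).const_mul 400).mono' ?_ ?_
  · have := measurable_resNum
    exact Measurable.aestronglyMeasurable (by fun_prop)
  · filter_upwards [ae_fst_ne_zero_and_snd_ne_zero] with p hp
    rw [Real.norm_eq_abs, abs_of_nonneg (sq_nonneg _)]
    exact sq_resNum_div_le hp.1 hp.2

/-- The kernel of `A² - 1`, where `s² / 2` is the coefficient of the quadratic phase. -/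
def resKer (s x y : ℝ) : ℝ := s * (8 / π ^ 2) * (resNum (s * x) (s * y) / (s * x - s * y))

/-- The kernel of `sgn Q(2π/3) + sgn Q(4π/3)`. -/
def sumKer (s x y : ℝ) : ℝ := -(2 / π) * s * sinKer (s * x) (s * y)

lemma measurable_sumKer (s : ℝ) : Measurable fun p : ℝ × ℝ => sumKer s p.1 p.2 := by
  unfold sumKer sinKer; fun_prop

lemma memLp_resKer {s : ℝ} (hs : 0 < s) :
    MemLp (fun p : ℝ × ℝ => (resKer s p.1 p.2 : ℂ)) 2 := by
  have h := measurable_resNum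
  have hm : AEStronglyMeasurable (fun p : ℝ × ℝ => (resKer s p.1 p.2 : ℂ)) := by
    have : Measurable fun p : ℝ × ℝ => resNum (s * p.1) (s * p.2) :=
      h.comp (g := fun p : ℝ × ℝ => resNum p.1 p.2) (f := fun p : ℝ × ℝ => (s * p.1, s * p.2))
        (by fun_prop)
    unfold resKer
    exact Measurable.aestronglyMeasurable (by fun_prop)
  rw [memLp_two_iff_integrable_sq_norm hm]
  have h1 := (integrable_comp_smul_iff volume _ hs.ne').2 integrable_sq_resNum_div
  refine (h1.const_mul ((s * (8 / π ^ 2)) ^ 2)).congr (Filter.Eventually.of_forall fun p => ?_)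
  simp only [Prod.smul_fst, Prod.smul_snd, smul_eq_mul, norm_real, Real.norm_eq_abs, sq_abs,
    resKer]
  ring

lemma realSign_mul {s : ℝ} (hs : 0 < s) (x : ℝ) : Real.sign (s * x) = Real.sign x := by
  rcases lt_trichotomy x 0 with h | rfl | h
  · rw [Real.sign_of_neg h, Real.sign_of_neg (mul_neg_of_pos_of_neg hs h)]
  · simp
  · rw [Real.sign_of_pos h, Real.sign_of_pos (mul_pos hs h)]

lemma integral_sumKer_add {s x y : ℝ} (hs : 0 < s) (hxy : x ≠ y) :
    (∫ z, sumKer s z x * sumKer s z y) + (Real.sign x + Real.sign y) * sumKer s x y =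
      resKer s x y := by
  have hne : s * x ≠ s * y := fun h => hxy (mul_left_cancel₀ hs.ne' h)
  have h1 : ∫ z, sumKer s z x * sumKer s z y =
      4 / π ^ 2 * s * ∫ z, sinKer z (s * x) * sinKer z (s * y) := by
    have := Measure.integral_comp_mul_left (fun z => sinKer z (s * x) * sinKer z (s * y)) s
    rw [smul_eq_mul, abs_of_pos (inv_pos.2 hs)] at this
    calc _ = ∫ z, 4 / π ^ 2 * s ^ 2 * (sinKer (s * z) (s * x) * sinKer (s * z) (s * y)) :=
          integral_congr_ae (.of_forall fun z => by simp only [sumKer]; ring)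
      _ = _ := by rw [integral_const_mul, this]; field_simp
  rw [h1, integral_sinKer_mul_sinKer hne, resKer, resNum_eq, realSign_mul hs, realSign_mul hs,
    sumKer, sinKer]
  have := sub_ne_zero.2 hne
  have := pi_ne_zero
  field_simp
  ring

/-- The Abel regularisation `e^{-ε|p|} sgn p` of the symbol of `sgn P`. -/
def signReg (ε p : ℝ) : ℂ := cexp (-(ε : ℂ) * |p|) * Real.sign p

lemma measurable_signReg (ε : ℝ) : Measurable (signReg ε) := by
  have := measurable_realSign
  unfold signReg
  fun_prop

lemma norm_signReg_le {ε : ℝ} (hε : 0 ≤ ε) (p : ℝ) : ‖signReg ε p‖ ≤ 1 := by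
  rw [signReg, norm_mul, norm_exp, norm_real, Real.norm_eq_abs]
  refine mul_le_one₀ ?_ (abs_nonneg _) (abs_realSign_le p)
  rw [Real.exp_le_one_iff]
  have := mul_nonneg hε (abs_nonneg p)
  simpa using this

lemma signReg_eqOn_Ioi (ε u : ℝ) : Set.EqOn (fun p : ℝ => signReg ε p * cexp (I * p * u))
    (fun p : ℝ => cexp ((-ε + I * u) * p)) (Set.Ioi 0) := by
  intro p hp
  simp only [signReg, abs_of_pos hp.out, Real.sign_of_pos hp.out, ofReal_one, mul_one]
  rw [← Complex.exp_add]; congr 1; ring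

lemma signReg_eqOn_Iio (ε u : ℝ) : Set.EqOn (fun p : ℝ => signReg ε p * cexp (I * p * u))
    (fun p : ℝ => -cexp ((ε + I * u) * p)) (Set.Iio 0) := by
  intro p hp
  simp only [signReg, abs_of_neg hp.out, Real.sign_of_neg hp.out, ofReal_one, ofReal_neg, mul_neg,
    mul_one, neg_mul]
  rw [← Complex.exp_add]; congr 2; ring

lemma integrable_signReg_mul_exp {ε : ℝ} (hε : 0 < ε) (u : ℝ) :
    Integrable fun p : ℝ => signReg ε p * cexp (I * p * u) := by
  rw [← integrableOn_univ, ← Set.Iic_union_Ioi (a := 0), integrableOn_union,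
    integrableOn_Iic_iff_integrableOn_Iio]
  constructor
  · rw [integrableOn_congr_fun (signReg_eqOn_Iio ε u) measurableSet_Iio,
      ← integrableOn_Iic_iff_integrableOn_Iio]
    exact (integrableOn_exp_mul_complex_Iic (by simpa using hε) 0).neg
  · rw [integrableOn_congr_fun (signReg_eqOn_Ioi ε u) measurableSet_Ioi]
    exact integrableOn_exp_mul_complex_Ioi (by simpa using hε) 0

lemma integrable_signReg {ε : ℝ} (hε : 0 < ε) : Integrable (signReg ε) := by
  simpa using integrable_signReg_mul_exp hε 0

lemma integral_signReg_mul_exp {ε : ℝ} (hε : 0 < ε) (u : ℝ) :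
    ∫ p : ℝ, signReg ε p * cexp (I * p * u) = 2 * I * ((u / (u ^ 2 + ε ^ 2) : ℝ) : ℂ) := by
  have hi := integrable_signReg_mul_exp hε u
  rw [← intervalIntegral.integral_Iic_add_Ioi (b := 0) hi.integrableOn hi.integrableOn,
    integral_Iic_eq_integral_Iio, setIntegral_congr_fun measurableSet_Iio (signReg_eqOn_Iio ε u),
    setIntegral_congr_fun measurableSet_Ioi (signReg_eqOn_Ioi ε u), integral_neg,
    ← integral_Iic_eq_integral_Iio, integral_exp_mul_complex_Iic (by simpa using hε),
    integral_exp_mul_complex_Ioi (by simpa using hε)]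
  have h1 : (ε + I * u : ℂ) ≠ 0 := fun h => hε.ne' (by simpa using congrArg re h)
  have h2 : (-ε + I * u : ℂ) ≠ 0 := fun h => hε.ne' (by simpa using congrArg re h)
  have h3 : (u ^ 2 + ε ^ 2 : ℂ) ≠ 0 := by
    have : u ^ 2 + ε ^ 2 ≠ 0 := by positivity
    exact_mod_cast this
  push_cast
  simp only [mul_zero, Complex.exp_zero]
  field_simp
  linear_combination (-2 * I * u ^ 3) * I_sq

lemma tendsto_signReg (p : ℝ) :
    Filter.Tendsto (fun ε => signReg ε p) (nhdsWithin 0 (Set.Ioi 0)) (nhds (Real.sign p)) := by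
  have : Continuous fun ε : ℝ => signReg ε p := by unfold signReg; fun_prop
  simpa [signReg] using (this.tendsto 0).mono_left nhdsWithin_le_nhds

/-- The kernel of the regularised operator `sgn P`. -/
def cauchyReg (ε x y : ℝ) : ℂ := I / π * (((x - y) / ((x - y) ^ 2 + ε ^ 2) : ℝ) : ℂ)

lemma integral_signReg_mul_fourier {f g : ℝ → ℂ} (hf : Integrable f) (hg : Integrable g)
    {ε : ℝ} (hε : 0 < ε) :
    ∫ p : ℝ, signReg ε p *
      (conj ((((2 * π) ^ (-(1:ℝ)/2) : ℝ) : ℂ) * ∫ q : ℝ, cexp (-I * p * q) * f q) *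
        ((((2 * π) ^ (-(1:ℝ)/2) : ℝ) : ℂ) * ∫ q : ℝ, cexp (-I * p * q) * g q)) =
      ∫ p : ℝ × ℝ, conj (f p.1) * g p.2 * cauchyReg ε p.1 p.2 := by
  have hc : ((((2 * π) ^ (-(1:ℝ)/2) : ℝ) : ℂ)) * (((2 * π) ^ (-(1:ℝ)/2) : ℝ) : ℂ) =
      1 / (2 * π) := by
    rw [← ofReal_mul, ← Real.rpow_add (by positivity)]
    norm_num [Real.rpow_neg_one]
  have hfg : Integrable fun z : ℝ × ℝ => conj (f z.1) * g z.2 :=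
    (conjLIE.integrable_comp_iff.2 hf).mul_prod hg
  have h1 : ∀ p : ℝ, signReg ε p *
      (conj ((((2 * π) ^ (-(1:ℝ)/2) : ℝ) : ℂ) * ∫ q : ℝ, cexp (-I * p * q) * f q) *
        ((((2 * π) ^ (-(1:ℝ)/2) : ℝ) : ℂ) * ∫ q : ℝ, cexp (-I * p * q) * g q)) =
      ∫ z : ℝ × ℝ, 1 / (2 * π) * (conj (f z.1) * g z.2) *
        (signReg ε p * cexp (I * p * (z.1 - z.2 : ℝ))) := by
    intro p
    rw [map_mul, ← integral_conj, conj_ofReal, mul_mul_mul_comm, hc,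
      ← integral_prod_mul, ← integral_const_mul, ← integral_const_mul]
    refine integral_congr_ae (.of_forall fun z => ?_)
    have : cexp (I * p * (z.1 - z.2 : ℝ)) = conj (cexp (-I * p * z.1)) * cexp (-I * p * z.2) := by
      rw [← exp_conj, ← Complex.exp_add]
      simp only [map_mul, map_neg, conj_I, conj_ofReal]
      push_cast; congr 1; ring
    simp only [this, map_mul]
    ring
  simp_rw [h1]
  rw [integral_integral_swap]
  · refine integral_congr_ae (.of_forall fun z => ?_)
    simp only []
    rw [integral_const_mul, integral_signReg_mul_exp hε, cauchyReg]
    field_simp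
  · have h2 : Integrable (fun w : ℝ × ℝ × ℝ => signReg ε w.1 * (conj (f w.2.1) * g w.2.2)) :=
      (integrable_signReg hε).mul_prod hfg
    have h3 : Integrable (fun w : ℝ × ℝ × ℝ => (1 / (2 * π) * cexp (I * w.1 * (w.2.1 - w.2.2 : ℝ)))
        * (signReg ε w.1 * (conj (f w.2.1) * g w.2.2))) := by
      refine h2.bdd_mul (c := ‖(1 / (2 * π) : ℂ)‖) ?_ (.of_forall fun w => ?_)
      · exact Continuous.aestronglyMeasurable (by fun_prop)
      · rw [norm_mul, show I * w.1 * (w.2.1 - w.2.2 : ℝ) = ((w.1 * (w.2.1 - w.2.2) : ℝ) : ℂ) * I by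
          push_cast; ring, norm_exp_ofReal_mul_I, mul_one]
    refine h3.congr (.of_forall fun w => ?_)
    simp only [Function.uncurry]
    ring

lemma IsSgnP.tendsto_inner {P : L2 →L[ℂ] L2} (hP : IsSgnP P) {f g : L2}
    (hf : Integrable f) (hg : Integrable g) :
    Filter.Tendsto (fun ε => ∫ p : ℝ × ℝ, conj (f p.1) * g p.2 * cauchyReg ε p.1 p.2)
      (nhdsWithin 0 (Set.Ioi 0)) (nhds ⟪f, P g⟫_ℂ) := by
  obtain ⟨F, hF, hPF⟩ := hP
  have h1 : ⟪f, P g⟫_ℂ = ∫ p, (Real.sign p : ℂ) * (conj (F f p) * F g p) := by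
    rw [← F.inner_map_map, L2.inner_def]
    refine integral_congr_ae ?_
    filter_upwards [hPF g] with p hp
    rw [hp, RCLike.inner_apply]; ring
  have hi : Integrable fun p => conj (F f p) * F g p := by
    refine (L2.integrable_inner (𝕜 := ℂ) (F f) (F g)).congr (.of_forall fun p => ?_)
    simp only [RCLike.inner_apply]; ring
  have h2 : Filter.Tendsto (fun ε => ∫ p, signReg ε p * (conj (F f p) * F g p))
      (nhdsWithin 0 (Set.Ioi 0)) (nhds ⟪f, P g⟫_ℂ) := by
    rw [h1]
    refine tendsto_integral_filter_of_dominated_convergence (fun p => ‖conj (F f p) * F g p‖)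
      (.of_forall fun ε => ?_) ?_ hi.norm (.of_forall fun p => ?_)
    · exact (measurable_signReg ε).aestronglyMeasurable.mul hi.aestronglyMeasurable
    · filter_upwards [self_mem_nhdsWithin] with ε hε
      refine .of_forall fun p => ?_
      rw [norm_mul]
      exact mul_le_of_le_one_left (norm_nonneg _) (norm_signReg_le hε.out.le p)
    · exact (tendsto_signReg p).mul_const _
  refine h2.congr' ?_
  filter_upwards [self_mem_nhdsWithin] with ε hε
  rw [← integral_signReg_mul_fourier hf hg hε]
  refine integral_congr_ae ?_
  filter_upwards [hF f hf, hF g hg] with p h3 h4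
  rw [h3, h4]

/-- The function `f` vanishes almost everywhere outside a bounded set. -/
def BddSupp (f : L2) : Prop := ∃ r : ℝ, ∀ᵐ x : ℝ, r < |x| → f x = 0

lemma BddSupp.integrable {f : L2} (hf : BddSupp f) : Integrable f := by
  obtain ⟨r, hr⟩ := hf
  have : IntegrableOn f (Set.Icc (-r) r) := by
    have : IsFiniteMeasure (volume.restrict (Set.Icc (-r) r)) := ⟨by simp⟩
    exact ((Lp.memLp f).restrict _).integrable one_le_two
  refine this.integrable_of_ae_notMem_eq_zero ?_
  filter_upwards [hr] with x hx h
  exact hx (not_le.1 fun h' => h (abs_le.1 h'))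

lemma IsMulOp.bddSupp {g : ℝ → ℂ} {T : L2 →L[ℂ] L2} (hT : IsMulOp g T) {f : L2}
    (hf : BddSupp f) : BddSupp (T f) := by
  obtain ⟨r, hr⟩ := hf
  refine ⟨r, ?_⟩
  filter_upwards [hr, hT f] with x hx h h'
  rw [h, hx h', mul_zero]

lemma IsMulOp.inner_map_right {g g' : ℝ → ℂ} {T T' : L2 →L[ℂ] L2} (hT : IsMulOp g T)
    (hT' : IsMulOp g' T') (hg : ∀ q, conj (g' q) = g q) (u v : L2) :
    ⟪u, T v⟫_ℂ = ⟪T' u, v⟫_ℂ := by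
  rw [L2.inner_def, L2.inner_def]
  refine integral_congr_ae ?_
  filter_upwards [hT v, hT' u] with x h h'
  rw [h, h', RCLike.inner_apply, RCLike.inner_apply, map_mul, hg]
  ring

lemma chi_eq (t q : ℝ) : chi t q = cexp ((-(Real.cos t / Real.sin t) * q ^ 2 / 2 : ℝ) * I) := by
  rw [chi]; congr 1; push_cast; ring

lemma chi_inv (t q : ℝ) : (chi t q)⁻¹ = conj (chi t q) := by
  rw [chi_eq, ← Complex.exp_neg, ← exp_conj, map_mul, conj_ofReal, conj_I, mul_neg]

lemma norm_chi (t q : ℝ) : ‖chi t q‖ = 1 := by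
  rw [chi_eq, norm_exp_ofReal_mul_I]

lemma norm_cauchyReg_le {ε : ℝ} (hε : 0 < ε) (x y : ℝ) : ‖cauchyReg ε x y‖ ≤ (π * ε)⁻¹ := by
  rw [cauchyReg, norm_mul, norm_div, norm_I, norm_real, norm_real, Real.norm_eq_abs,
    Real.norm_eq_abs, abs_of_pos pi_pos, abs_div,
    abs_of_pos (by positivity : 0 < (x - y) ^ 2 + ε ^ 2),
    mul_inv, one_div]
  gcongr
  rw [div_le_iff₀ (by positivity), ← sq_abs (x - y), inv_mul_eq_div, le_div_iff₀ hε]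
  nlinarith [sq_nonneg (|x - y| - ε), abs_nonneg (x - y)]

lemma IsSgnP.inner_map_right {P : L2 →L[ℂ] L2} (hP : IsSgnP P) (u v : L2) :
    ⟪u, P v⟫_ℂ = ⟪P u, v⟫_ℂ := by
  obtain ⟨F, -, hPF⟩ := hP
  rw [← F.inner_map_map u, ← F.inner_map_map (P u), L2.inner_def, L2.inner_def]
  refine integral_congr_ae ?_
  filter_upwards [hPF u, hPF v] with p h h'
  rw [h, h', RCLike.inner_apply, RCLike.inner_apply, map_mul, conj_ofReal]
  ring

lemma isSgnQ_zero {T : L2 →L[ℂ] L2} :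
    IsSgnQ 0 T ↔ IsMulOp (fun q => ((Real.sign q : ℝ) : ℂ)) T := by
  simp [IsSgnQ]

lemma IsSgnQ.inner_map_right {t : ℝ} {T : L2 →L[ℂ] L2} (hT : IsSgnQ t T) (u v : L2) :
    ⟪u, T v⟫_ℂ = ⟪T u, v⟫_ℂ := by
  by_cases ht : t = 0
  · subst ht
    exact (isSgnQ_zero.1 hT).inner_map_right (isSgnQ_zero.1 hT) (fun q => conj_ofReal _) u v
  · rw [IsSgnQ, if_neg ht] at hT
    obtain ⟨P, Mc, Mci, hP, hMc, hMci, rfl⟩ := hT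
    simp only [_root_.smul_apply, ContinuousLinearMap.comp_apply, inner_smul_left,
      inner_smul_right, conj_ofReal]
    rw [hMc.inner_map_right hMci (fun q => by rw [chi_inv, conj_conj]), hP.inner_map_right,
      hMci.inner_map_right hMc (fun q => (chi_inv t q).symm)]

lemma IsSgnQ.tendsto_inner {t : ℝ} (ht : t ≠ 0) {T : L2 →L[ℂ] L2} (hT : IsSgnQ t T) {f g : L2}
    (hf : BddSupp f) (hg : BddSupp g) :
    Filter.Tendsto (fun ε => ∫ p : ℝ × ℝ, conj (f p.1) * g p.2 *
        (Real.sign (Real.sin t) * chi t p.1 * (chi t p.2)⁻¹ * cauchyReg ε p.1 p.2))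
      (nhdsWithin 0 (Set.Ioi 0)) (nhds ⟪f, T g⟫_ℂ) := by
  rw [IsSgnQ, if_neg ht] at hT
  obtain ⟨P, Mc, Mci, hP, hMc, hMci, rfl⟩ := hT
  have h1 := (hP.tendsto_inner (hMci.bddSupp hf).integrable (hMci.bddSupp hg).integrable).const_mul
    (Real.sign (Real.sin t) : ℂ)
  rw [← hMc.inner_map_right hMci (fun q => by rw [chi_inv, conj_conj]), ← inner_smul_right] at h1
  refine h1.congr fun ε => ?_
  rw [← integral_const_mul]
  refine integral_congr_ae ?_
  filter_upwards [Measure.quasiMeasurePreserving_fst.ae (hMci f),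
    Measure.quasiMeasurePreserving_snd.ae (hMci g)] with p h h'
  rw [h, h', map_mul, chi_inv, conj_conj]
  ring

lemma sin_two_pi_div_three : Real.sin (2 * π / 3) = √3 / 2 := by
  rw [show 2 * π / 3 = π - π / 3 by ring, Real.sin_pi_sub, Real.sin_pi_div_three]

lemma cos_two_pi_div_three : Real.cos (2 * π / 3) = -(1 / 2) := by
  rw [show 2 * π / 3 = π - π / 3 by ring, Real.cos_pi_sub, Real.cos_pi_div_three]

lemma sin_four_pi_div_three : Real.sin (4 * π / 3) = -(√3 / 2) := by
  rw [show 4 * π / 3 = π / 3 + π by ring, Real.sin_add_pi, Real.sin_pi_div_three]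

lemma cos_four_pi_div_three : Real.cos (4 * π / 3) = -(1 / 2) := by
  rw [show 4 * π / 3 = π / 3 + π by ring, Real.cos_add_pi, Real.cos_pi_div_three]

/-- The scale for which the quadratic phases of `sgn Q(2π/3)` and `sgn Q(4π/3)` are
`exp(± i (s q)² / 2)`. -/
def phaseScale : ℝ := √(1 / √3)

lemma phaseScale_pos : 0 < phaseScale := Real.sqrt_pos.2 (by positivity)

lemma phaseScale_sq : phaseScale ^ 2 = 1 / √3 := Real.sq_sqrt (by positivity)

lemma chi_two_pi_div_three (q : ℝ) :
    chi (2 * π / 3) q = cexp (((phaseScale * q) ^ 2 / 2 : ℝ) * I) := by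
  rw [chi_eq, sin_two_pi_div_three, cos_two_pi_div_three, mul_pow, phaseScale_sq]
  congr 3; field_simp

lemma chi_four_pi_div_three (q : ℝ) :
    chi (4 * π / 3) q = cexp (-((phaseScale * q) ^ 2 / 2 : ℝ) * I) := by
  rw [chi_eq, sin_four_pi_div_three, cos_four_pi_div_three, mul_pow, phaseScale_sq, ← ofReal_neg]
  congr 3; field_simp

lemma chi_mul_cauchyReg_add (ε x y : ℝ) :
    Real.sign (Real.sin (2 * π / 3)) * chi (2 * π / 3) x * (chi (2 * π / 3) y)⁻¹ *
        cauchyReg ε x y +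
      Real.sign (Real.sin (4 * π / 3)) * chi (4 * π / 3) x * (chi (4 * π / 3) y)⁻¹ *
        cauchyReg ε x y =
      ((sumKer phaseScale x y * ((x - y) ^ 2 / ((x - y) ^ 2 + ε ^ 2)) : ℝ) : ℂ) := by
  set s := phaseScale with hs
  have h2 : Real.sign (Real.sin (2 * π / 3)) = 1 := by
    rw [sin_two_pi_div_three]; exact Real.sign_of_pos (by positivity)
  have h4 : Real.sign (Real.sin (4 * π / 3)) = -1 := by
    rw [sin_four_pi_div_three]; exact Real.sign_of_neg (by rw [neg_lt_zero]; positivity)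
  set θ := ((s * x) ^ 2 - (s * y) ^ 2) / 2 with hθ
  have e2 : chi (2 * π / 3) x * (chi (2 * π / 3) y)⁻¹ = cexp (θ * I) := by
    rw [chi_two_pi_div_three, chi_two_pi_div_three, ← Complex.exp_neg, ← Complex.exp_add]
    congr 1; rw [hθ]; push_cast; ring
  have e4 : chi (4 * π / 3) x * (chi (4 * π / 3) y)⁻¹ = cexp (-θ * I) := by
    rw [chi_four_pi_div_three, chi_four_pi_div_three, ← Complex.exp_neg, ← Complex.exp_add]
    congr 1; rw [hθ]; push_cast; ring
  have hsin : cexp (θ * I) - cexp (-θ * I) = 2 * I * (Real.sin θ : ℝ) := by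
    rw [ofReal_sin, Complex.sin]
    linear_combination (cexp (θ * I) - cexp (-θ * I)) * I_sq
  rw [mul_assoc (Real.sign _ : ℂ), e2, mul_assoc (Real.sign _ : ℂ) (chi (4 * π / 3) x), e4, h2, h4]
  have : ((1 : ℝ) : ℂ) * cexp (θ * I) * cauchyReg ε x y +
      ((-1 : ℝ) : ℂ) * cexp (-θ * I) * cauchyReg ε x y =
      (cexp (θ * I) - cexp (-θ * I)) * cauchyReg ε x y := by push_cast; ring
  rw [this, hsin, cauchyReg]
  have h3 : sumKer s x y * ((x - y) ^ 2 / ((x - y) ^ 2 + ε ^ 2)) =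
      -(2 / π) * Real.sin θ * ((x - y) / ((x - y) ^ 2 + ε ^ 2)) := by
    rcases eq_or_ne x y with rfl | h
    · simp [hθ]
    · have := sub_ne_zero.2 h
      have : s ≠ 0 := phaseScale_pos.ne'
      rw [sumKer, sinKer, ← hθ, ← mul_sub]
      field_simp
  rw [h3]
  push_cast
  linear_combination (2 / π * Complex.sin θ * ((x - y) / ((x - y) ^ 2 + ε ^ 2))) * I_sq

lemma exists_abs_sumKer_le {s : ℝ} (hs : 0 < s) (r : ℝ) :
    ∃ M, 0 ≤ M ∧ ∀ z x, |x| ≤ r → |sumKer s z x| ≤ M := by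
  refine ⟨2 / π * s * ((1 + s * r) ^ 2 + 1), by positivity, fun z x hx => ?_⟩
  have h1 : |s * x| ≤ s * r := by rw [abs_mul, abs_of_pos hs]; gcongr
  have h2 := abs_sinKer_le_of_abs_le h1 (s * z)
  rw [sumKer, abs_mul, abs_mul, abs_neg, abs_of_pos hs, abs_of_pos (by positivity : 0 < 2 / π)]
  gcongr
  exact h2.trans (mul_le_of_le_one_right (by positivity)
    (inv_le_one_of_one_le₀ (le_add_of_nonneg_right (abs_nonneg _))))

lemma integrable_mul_sumKer {s : ℝ} (hs : 0 < s) {f g : L2} (hf : Integrable f)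
    (hg : BddSupp g) :
    Integrable fun p : ℝ × ℝ => conj (f p.1) * g p.2 * (sumKer s p.1 p.2 : ℂ) := by
  have hgi := hg.integrable
  obtain ⟨r, hr⟩ := hg
  obtain ⟨M, -, hM⟩ := exists_abs_sumKer_le hs r
  have hfg : Integrable fun z : ℝ × ℝ => conj (f z.1) * g z.2 :=
    (conjLIE.integrable_comp_iff.2 hf).mul_prod hgi
  refine (hfg.norm.const_mul M).mono' (hfg.aestronglyMeasurable.mul
    (measurable_ofReal.comp (measurable_sumKer s)).aestronglyMeasurable) ?_
  filter_upwards [Measure.quasiMeasurePreserving_snd.ae hr] with p hp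
  rcases le_or_gt |p.2| r with h | h
  · rw [norm_mul, norm_real, mul_comm]
    exact mul_le_mul_of_nonneg_right (hM _ _ h) (norm_nonneg _)
  · simp [hp h]

lemma inner_add_eq_integral {A2 A4 : L2 →L[ℂ] L2} (h2 : IsSgnQ (2 * π / 3) A2)
    (h4 : IsSgnQ (4 * π / 3) A4) {f g : L2} (hf : BddSupp f) (hg : BddSupp g) :
    ⟪f, (A2 + A4) g⟫_ℂ =
      ∫ p : ℝ × ℝ, conj (f p.1) * g p.2 * (sumKer phaseScale p.1 p.2 : ℂ) := by
  have hi := integrable_mul_sumKer phaseScale_pos hf.integrable hg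
  set F : ℝ → ℝ × ℝ → ℂ := fun ε p => conj (f p.1) * g p.2 *
    ((sumKer phaseScale p.1 p.2 * ((p.1 - p.2) ^ 2 / ((p.1 - p.2) ^ 2 + ε ^ 2)) : ℝ) : ℂ) with hF
  have hInt : ∀ t ε, 0 < ε → Integrable fun p : ℝ × ℝ => conj (f p.1) * g p.2 *
      (Real.sign (Real.sin t) * chi t p.1 * (chi t p.2)⁻¹ * cauchyReg ε p.1 p.2) := by
    intro t ε hε
    refine ((conjLIE.integrable_comp_iff.2 hf.integrable).mul_prod hg.integrable).mul_bdd
      (c := (π * ε)⁻¹) (Measurable.aestronglyMeasurable (by unfold chi cauchyReg; fun_prop))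
      (.of_forall fun p => ?_)
    rw [norm_mul, norm_mul, norm_mul, norm_inv, norm_chi, norm_chi, inv_one, mul_one, mul_one,
      norm_real]
    exact (mul_le_of_le_one_left (norm_nonneg _) (abs_realSign_le _)).trans
      (norm_cauchyReg_le hε _ _)
  have hl : Filter.Tendsto (fun ε => ∫ p, F ε p) (nhdsWithin 0 (Set.Ioi 0))
      (nhds ⟪f, (A2 + A4) g⟫_ℂ) := by
    rw [_root_.add_apply, inner_add_right]
    refine ((h2.tendsto_inner (by positivity) hf hg).add
      (h4.tendsto_inner (by positivity) hf hg)).congr' ?_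
    filter_upwards [self_mem_nhdsWithin] with ε hε
    rw [← integral_add (hInt _ ε hε) (hInt _ ε hε)]
    refine integral_congr_ae (.of_forall fun p => ?_)
    simp only [hF, ← chi_mul_cauchyReg_add, mul_add]
  refine tendsto_nhds_unique hl ?_
  refine tendsto_integral_filter_of_dominated_convergence
    (fun p => ‖conj (f p.1) * g p.2 * (sumKer phaseScale p.1 p.2 : ℂ)‖)
    (.of_forall fun ε => ?_) (.of_forall fun ε => .of_forall fun p => ?_) hi.norm
    (.of_forall fun p => ?_)
  · have : Measurable fun p : ℝ × ℝ => (p.1 - p.2) ^ 2 / ((p.1 - p.2) ^ 2 + ε ^ 2) := by fun_prop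
    refine (hi.aestronglyMeasurable.mul
      (measurable_ofReal.comp this).aestronglyMeasurable).congr (.of_forall fun p => ?_)
    simp only [hF, Pi.mul_apply, Function.comp_apply, ofReal_mul, mul_assoc]
  · simp only [hF, ofReal_mul, ← mul_assoc]
    rw [norm_mul, norm_real, Real.norm_eq_abs, abs_of_nonneg (by positivity)]
    exact mul_le_of_le_one_right (norm_nonneg _)
      (div_le_one_of_le₀ (le_add_of_nonneg_right (sq_nonneg ε)) (by positivity))
  · refine Filter.Tendsto.const_mul _ ((continuous_ofReal.tendsto _).comp ?_)
    rcases eq_or_ne p.1 p.2 with h | h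
    · simp [h, sumKer, sinKer]
    · have h' : (p.1 - p.2) ^ 2 ≠ 0 := pow_ne_zero 2 (sub_ne_zero.2 h)
      have : Filter.Tendsto (fun ε : ℝ => (p.1 - p.2) ^ 2 / ((p.1 - p.2) ^ 2 + ε ^ 2)) (nhds 0)
          (nhds ((p.1 - p.2) ^ 2 / ((p.1 - p.2) ^ 2 + 0 ^ 2))) :=
        ContinuousAt.tendsto (f := fun ε : ℝ => (p.1 - p.2) ^ 2 / ((p.1 - p.2) ^ 2 + ε ^ 2))
          (ContinuousAt.div (by fun_prop) (by fun_prop) (by simpa using h'))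
      rw [zero_pow two_ne_zero, add_zero, div_self h'] at this
      simpa using (this.mono_left nhdsWithin_le_nhds).const_mul (sumKer phaseScale p.1 p.2)

/-- The action of the integral operator with kernel `sumKer s` on `g`. -/
def sumKerOp (s : ℝ) (g : ℝ → ℂ) (x : ℝ) : ℂ := ∫ y, g y * (sumKer s x y : ℂ)

lemma locallyIntegrable_sumKerOp {s : ℝ} (hs : 0 < s) {g : L2} (hg : BddSupp g) :
    LocallyIntegrable (sumKerOp s g) := by
  have hgi := hg.integrable
  obtain ⟨r, hr⟩ := hg
  obtain ⟨M, -, hM⟩ := exists_abs_sumKer_le hs r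
  have hm : AEStronglyMeasurable (sumKerOp s g) := by
    refine AEStronglyMeasurable.integral_prod_right'
      (f := fun p : ℝ × ℝ => g p.2 * (sumKer s p.1 p.2 : ℂ)) ?_
    exact hgi.aestronglyMeasurable.comp_snd.mul
      (measurable_ofReal.comp (measurable_sumKer s)).aestronglyMeasurable
  refine (memLp_top_of_bound hm (∫ y, ‖g y‖ * M) (.of_forall fun x => ?_)).locallyIntegrable le_top
  refine norm_integral_le_of_norm_le (hgi.norm.mul_const M) ?_
  filter_upwards [hr] with y hy
  rw [norm_mul, norm_real]
  rcases le_or_gt |y| r with h | h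
  · exact mul_le_mul_of_nonneg_left (hM _ _ h) (norm_nonneg _)
  · simp [hy h]

lemma coeFn_add_apply_ae_eq {A2 A4 : L2 →L[ℂ] L2} (h2 : IsSgnQ (2 * π / 3) A2)
    (h4 : IsSgnQ (4 * π / 3) A4) {g : L2} (hg : BddSupp g) :
    ((A2 + A4) g : ℝ → ℂ) =ᵐ[volume] sumKerOp phaseScale g := by
  refine ae_eq_of_integral_contDiff_smul_eq ((Lp.memLp _).locallyIntegrable one_le_two)
    (locallyIntegrable_sumKerOp phaseScale_pos hg) fun h hh hc => ?_
  have hL : MemLp (fun x => (h x : ℂ)) 2 :=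
    (continuous_ofReal.comp hh.continuous).memLp_of_hasCompactSupport
      (hc.comp_left ofReal_zero)
  have hfb : BddSupp (hL.toLp _) := by
    obtain ⟨r, hr⟩ := hc.isBounded.exists_norm_le
    refine ⟨r, ?_⟩
    filter_upwards [hL.coeFn_toLp] with x hx hrx
    rw [hx, image_eq_zero_of_notMem_tsupport (fun h' => (hr x h').not_gt hrx), ofReal_zero]
  have h5 := inner_add_eq_integral h2 h4 hfb hg
  have h6 := integral_prod _ (integrable_mul_sumKer phaseScale_pos hfb.integrable hg)
  rw [L2.inner_def] at h5
  calc _ = ∫ x, ⟪hL.toLp _ x, (A2 + A4) g x⟫_ℂ := by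
        refine integral_congr_ae ?_
        filter_upwards [hL.coeFn_toLp] with x hx
        rw [hx, RCLike.inner_apply, conj_ofReal, real_smul, mul_comm]
    _ = _ := h5.trans h6
    _ = _ := by
        refine integral_congr_ae ?_
        filter_upwards [hL.coeFn_toLp] with x hx
        simp only [hx, conj_ofReal, real_smul, sumKerOp, mul_assoc]
        rw [integral_const_mul]

lemma exists_abs_sumKer_mul_sumKer_le {s : ℝ} (hs : 0 < s) (r : ℝ) :
    ∃ M, 0 ≤ M ∧ ∀ z x y, |x| ≤ r → |y| ≤ r →
      |sumKer s z x * sumKer s z y| ≤ M * (1 + (s * z) ^ 2)⁻¹ := by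
  refine ⟨(2 / π * s) ^ 2 * ((1 + s * r) ^ 2 + 1) ^ 2, by positivity, fun z x y hx hy => ?_⟩
  have h : ∀ {x}, |x| ≤ r → |s * x| ≤ s * r := fun hx => by
    rw [abs_mul, abs_of_pos hs]; gcongr
  have h3 := abs_sinKer_mul_sinKer_le (h hx) (h hy) (s * z)
  have : sumKer s z x * sumKer s z y =
      (2 / π * s) ^ 2 * (sinKer (s * z) (s * x) * sinKer (s * z) (s * y)) := by
    simp only [sumKer]; ring
  rw [this, abs_mul, abs_of_nonneg (sq_nonneg _), mul_assoc]
  gcongr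

lemma integrable_mul_sumKer_mul_sumKer {s : ℝ} (hs : 0 < s) {f g : L2} (hf : BddSupp f)
    (hg : BddSupp g) :
    Integrable fun w : ℝ × ℝ × ℝ => conj (f w.2.1) * g w.2.2 *
      ((sumKer s w.1 w.2.1 * sumKer s w.1 w.2.2 : ℝ) : ℂ) := by
  have hfg : Integrable fun z : ℝ × ℝ => conj (f z.1) * g z.2 :=
    (conjLIE.integrable_comp_iff.2 hf.integrable).mul_prod hg.integrable
  obtain ⟨r, hr⟩ := hf
  obtain ⟨r', hr'⟩ := hg
  obtain ⟨M, -, hM⟩ := exists_abs_sumKer_mul_sumKer_le hs (max r r')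
  have hz : Integrable fun z : ℝ => M * (1 + (s * z) ^ 2)⁻¹ :=
    ((integrable_inv_one_add_sq.comp_mul_left' hs.ne').const_mul M)
  have hm : Measurable fun w : ℝ × ℝ × ℝ => sumKer s w.1 w.2.1 * sumKer s w.1 w.2.2 :=
    ((measurable_sumKer s).comp (g := fun p : ℝ × ℝ => sumKer s p.1 p.2)
      (f := fun w : ℝ × ℝ × ℝ => (w.1, w.2.1)) (by fun_prop)).mul
    ((measurable_sumKer s).comp (g := fun p : ℝ × ℝ => sumKer s p.1 p.2)
      (f := fun w : ℝ × ℝ × ℝ => (w.1, w.2.2)) (by fun_prop))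
  refine (hz.mul_prod hfg.norm).mono' ?_ ?_
  · exact hfg.aestronglyMeasurable.comp_snd.mul
      (measurable_ofReal.comp hm).aestronglyMeasurable
  · filter_upwards [
      Measure.quasiMeasurePreserving_snd.ae (Measure.quasiMeasurePreserving_fst.ae hr),
      Measure.quasiMeasurePreserving_snd.ae (Measure.quasiMeasurePreserving_snd.ae hr')] with w h h'
    rcases le_or_gt |w.2.1| r with h3 | h3
    · rcases le_or_gt |w.2.2| r' with h4 | h4
      · rw [norm_mul, norm_real, mul_comm]
        exact mul_le_mul_of_nonneg_right (hM _ _ _ (h3.trans (le_max_left _ _))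
          (h4.trans (le_max_right _ _))) (norm_nonneg _)
      · simp [h' h4]
    · simp [h h3]

lemma integral_mul_sumKer_mul_sumKer (s : ℝ) (c : ℂ) (x y : ℝ) :
    ∫ z, c * ((sumKer s z x * sumKer s z y : ℝ) : ℂ) =
      c * ((∫ z, sumKer s z x * sumKer s z y : ℝ) : ℂ) := by
  rw [integral_const_mul, integral_complex_ofReal]

lemma integral_conj_sumKerOp_mul {s : ℝ} (hs : 0 < s) {f g : L2} (hf : BddSupp f)
    (hg : BddSupp g) :
    ∫ z, conj (sumKerOp s f z) * sumKerOp s g z =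
      ∫ p : ℝ × ℝ, conj (f p.1) * g p.2 * ((∫ z, sumKer s z p.1 * sumKer s z p.2 : ℝ) : ℂ) := by
  have h1 : ∀ z, conj (sumKerOp s f z) * sumKerOp s g z = ∫ p : ℝ × ℝ,
      conj (f p.1) * g p.2 * ((sumKer s z p.1 * sumKer s z p.2 : ℝ) : ℂ) := by
    intro z
    rw [sumKerOp, sumKerOp, ← integral_conj, ← integral_prod_mul]
    refine integral_congr_ae (.of_forall fun p => ?_)
    simp only [map_mul, conj_ofReal, ofReal_mul]
    ring
  simp_rw [h1]
  rw [integral_integral_swap (integrable_mul_sumKer_mul_sumKer hs hf hg)]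
  exact integral_congr_ae (.of_forall fun p => integral_mul_sumKer_mul_sumKer ..)

lemma ae_fst_ne_snd : ∀ᵐ p : ℝ × ℝ, p.1 ≠ p.2 := by
  have : {p : ℝ × ℝ | ¬ p.1 ≠ p.2} = Set.diagonal ℝ := by ext; simp
  rw [ae_iff, this, Measure.volume_eq_prod, Measure.measure_prod_null measurableSet_diagonal]
  exact .of_forall fun x => by
    have : Prod.mk x ⁻¹' Set.diagonal ℝ = {x} := by ext y; simp [eq_comm]
    simp [this]

lemma IsSgnQ.mul_self_eq_one {A0 : L2 →L[ℂ] L2} (h0 : IsSgnQ 0 A0) : A0 * A0 = 1 := by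
  rw [isSgnQ_zero] at h0
  ext1 f
  refine Lp.ext ?_
  have h : ∀ᵐ x : ℝ, x ≠ 0 := by simp [ae_iff]
  filter_upwards [h0 f, h0 (A0 f), h] with x h1 h2 h3
  rw [mul_apply_eq_comp, h2, h1, ← mul_assoc, ← ofReal_mul]
  rcases h3.lt_or_gt with h | h
  · simp [Real.sign_of_neg h]
  · simp [Real.sign_of_pos h]

lemma inner_sq_sub_one_eq_integral {A0 A2 A4 : L2 →L[ℂ] L2} (h0 : IsSgnQ 0 A0)
    (h2 : IsSgnQ (2 * π / 3) A2) (h4 : IsSgnQ (4 * π / 3) A4)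
    {f g : L2} (hf : BddSupp f) (hg : BddSupp g) :
    ⟪f, ((A0 + A2 + A4) ^ 2 - 1 : L2 →L[ℂ] L2) g⟫_ℂ =
      ∫ p : ℝ × ℝ, conj (f p.1) * g p.2 * (resKer phaseScale p.1 p.2 : ℂ) := by
  have hs := phaseScale_pos
  set C := A2 + A4 with hC
  have hCs : ∀ u v, ⟪u, C v⟫_ℂ = ⟪C u, v⟫_ℂ := fun u v => by
    rw [hC, _root_.add_apply, _root_.add_apply, inner_add_left,
      inner_add_right, h2.inner_map_right, h4.inner_map_right]
  have hT : (A0 + A2 + A4) ^ 2 - 1 = A0 * C + C * A0 + C * C := by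
    rw [add_assoc, ← hC, sq, ← IsSgnQ.mul_self_eq_one h0]
    noncomm_ring
  have hm := isSgnQ_zero.1 h0
  have e1 : ⟪f, A0 (C g)⟫_ℂ = ∫ p : ℝ × ℝ, (Real.sign p.1 : ℂ) *
      (conj (f p.1) * g p.2 * (sumKer phaseScale p.1 p.2 : ℂ)) := by
    rw [h0.inner_map_right, inner_add_eq_integral h2 h4 (hm.bddSupp hf) hg]
    refine integral_congr_ae ?_
    filter_upwards [Measure.quasiMeasurePreserving_fst.ae (hm f)] with p hp
    rw [hp, map_mul, conj_ofReal]; ring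
  have e2 : ⟪f, C (A0 g)⟫_ℂ = ∫ p : ℝ × ℝ, (Real.sign p.2 : ℂ) *
      (conj (f p.1) * g p.2 * (sumKer phaseScale p.1 p.2 : ℂ)) := by
    rw [inner_add_eq_integral h2 h4 hf (hm.bddSupp hg)]
    refine integral_congr_ae ?_
    filter_upwards [Measure.quasiMeasurePreserving_snd.ae (hm g)] with p hp
    rw [hp]; ring
  have e3 : ⟪f, C (C g)⟫_ℂ = ∫ p : ℝ × ℝ, conj (f p.1) * g p.2 *
      ((∫ z, sumKer phaseScale z p.1 * sumKer phaseScale z p.2 : ℝ) : ℂ) := by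
    rw [hCs, L2.inner_def, ← integral_conj_sumKerOp_mul hs hf hg]
    refine integral_congr_ae ?_
    filter_upwards [coeFn_add_apply_ae_eq h2 h4 hf, coeFn_add_apply_ae_eq h2 h4 hg] with x h h'
    rw [h, h', RCLike.inner_apply, mul_comm]
  have hi1 := integrable_mul_sumKer hs hf.integrable hg
  have hi3 : Integrable fun p : ℝ × ℝ => conj (f p.1) * g p.2 *
      ((∫ z, sumKer phaseScale z p.1 * sumKer phaseScale z p.2 : ℝ) : ℂ) :=
    (integrable_mul_sumKer_mul_sumKer hs hf hg).integral_prod_right.congr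
      (.of_forall fun p =>
        integral_mul_sumKer_mul_sumKer phaseScale (conj (f p.1) * g p.2) p.1 p.2)
  have hsgn : ∀ {q : ℝ × ℝ → ℝ}, Measurable q → Integrable fun p : ℝ × ℝ =>
      (Real.sign (q p) : ℂ) * (conj (f p.1) * g p.2 * (sumKer phaseScale p.1 p.2 : ℂ)) :=
    fun hq => hi1.bdd_mul (c := 1)
      (measurable_ofReal.comp (measurable_realSign.comp hq)).aestronglyMeasurable
      (.of_forall fun p => by simpa using abs_realSign_le _)
  rw [hT]
  simp only [_root_.add_apply, mul_apply_eq_comp, inner_add_right]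
  rw [e1, e2, e3, ← integral_add' (hsgn measurable_fst) (hsgn measurable_snd),
    ← integral_add' ((hsgn measurable_fst).add (hsgn measurable_snd)) hi3]
  refine integral_congr_ae ?_
  filter_upwards [ae_fst_ne_snd] with p hp
  rw [← integral_sumKer_add hs hp]
  simp only [Pi.add_apply]
  push_cast
  ring

lemma memLp_mul_conj (f g : L2) : MemLp (fun p : ℝ × ℝ => f p.1 * conj (g p.2)) 2 := by
  have hf := (Lp.memLp f).aestronglyMeasurable
  have hg := (Lp.memLp g).aestronglyMeasurable
  have hm : AEStronglyMeasurable (fun p : ℝ × ℝ => f p.1 * conj (g p.2)) :=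
    hf.comp_fst.mul (continuous_conj.comp_aestronglyMeasurable hg.comp_snd)
  refine (memLp_two_iff_integrable_sq_norm hm).2 ?_
  refine (((memLp_two_iff_integrable_sq_norm hf).1 (Lp.memLp f)).mul_prod
    ((memLp_two_iff_integrable_sq_norm hg).1 (Lp.memLp g))).congr (.of_forall fun p => ?_)
  simp only [norm_mul, RCLike.norm_conj, mul_pow]

/-- The function `(x, y) ↦ f x * conj (g y)` as an element of `L²(ℝ × ℝ)`. -/
def tens (f g : L2) : Lp ℂ 2 (volume : Measure (ℝ × ℝ)) := (memLp_mul_conj f g).toLp _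

lemma coeFn_tens (f g : L2) : tens f g =ᵐ[volume] fun p : ℝ × ℝ => f p.1 * conj (g p.2) :=
  (memLp_mul_conj f g).coeFn_toLp

lemma inner_tens_tens (f g f' g' : L2) :
    ⟪tens f g, tens f' g'⟫_ℂ = ⟪f, f'⟫_ℂ * ⟪g', g⟫_ℂ := by
  rw [L2.inner_def, L2.inner_def, L2.inner_def, ← integral_prod_mul]
  refine integral_congr_ae ?_
  filter_upwards [coeFn_tens f g, coeFn_tens f' g'] with p h h'
  simp only [h, h', RCLike.inner_apply, map_mul, conj_conj]
  ring

lemma norm_tens (f g : L2) : ‖tens f g‖ = ‖f‖ * ‖g‖ := by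
  have h := inner_tens_tens f g f g
  rw [inner_self_eq_norm_sq_to_K, inner_self_eq_norm_sq_to_K, inner_self_eq_norm_sq_to_K,
    ← mul_pow] at h
  have h2 : ‖tens f g‖ ^ 2 = (‖f‖ * ‖g‖) ^ 2 := by exact_mod_cast h
  exact (pow_left_inj₀ (norm_nonneg _) (by positivity) two_ne_zero).1 h2

lemma tens_add_left (f f' g : L2) : tens (f + f') g = tens f g + tens f' g := by
  refine Lp.ext ?_
  filter_upwards [coeFn_tens (f + f') g, coeFn_tens f g, coeFn_tens f' g,
    Lp.coeFn_add (tens f g) (tens f' g),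
    Measure.quasiMeasurePreserving_fst.ae (Lp.coeFn_add f f')] with p h1 h2 h3 h4 h5
  rw [h1, h4, Pi.add_apply, h2, h3, h5, Pi.add_apply, add_mul]

lemma tens_add_right (f g g' : L2) : tens f (g + g') = tens f g + tens f g' := by
  refine Lp.ext ?_
  filter_upwards [coeFn_tens f (g + g'), coeFn_tens f g, coeFn_tens f g',
    Lp.coeFn_add (tens f g) (tens f g'),
    Measure.quasiMeasurePreserving_snd.ae (Lp.coeFn_add g g')] with p h1 h2 h3 h4 h5
  rw [h1, h4, Pi.add_apply, h2, h3, h5, Pi.add_apply, map_add, mul_add]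

lemma continuous_tens_left (g : L2) : Continuous fun f => tens f g :=
  AddMonoidHomClass.continuous_of_bound (AddMonoidHom.mk' (fun f => tens f g)
    fun f f' => tens_add_left f f' g) ‖g‖ fun f => by simp [norm_tens, mul_comm]

lemma continuous_tens_right (f : L2) : Continuous fun g => tens f g :=
  AddMonoidHomClass.continuous_of_bound (AddMonoidHom.mk' (fun g => tens f g)
    fun g g' => tens_add_right f g g') ‖f‖ fun g => by simp [norm_tens]

lemma dense_bddSupp : Dense {f : L2 | BddSupp f} := by
  refine (Lp.dense_hasCompactSupport_contDiff (E := ℝ) (F := ℂ) (μ := volume) (p := 2)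
    (by simp)).mono ?_
  rintro f ⟨h, hfh, hc, -⟩
  obtain ⟨r, hr⟩ := hc.isBounded.exists_norm_le
  refine ⟨r, ?_⟩
  filter_upwards [hfh] with x hx hrx
  rw [hx, image_eq_zero_of_notMem_tsupport (fun h' => (hr x h').not_gt hrx)]

lemma inner_apply_eq_inner_tens {T : L2 →L[ℂ] L2} {R : Lp ℂ 2 (volume : Measure (ℝ × ℝ))}
    (h : ∀ f g, BddSupp f → BddSupp g → ⟪f, T g⟫_ℂ = ⟪tens f g, R⟫_ℂ) (f g : L2) :
    ⟪f, T g⟫_ℂ = ⟪tens f g, R⟫_ℂ := by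
  have h1 : ∀ g, BddSupp g → (fun f => ⟪f, T g⟫_ℂ) = fun f => ⟪tens f g, R⟫_ℂ := fun g hg =>
    Continuous.ext_on dense_bddSupp (by fun_prop) ((continuous_tens_left g).inner continuous_const)
      fun f hf => h f g hf hg
  have h2 : (fun g => ⟪f, T g⟫_ℂ) = fun g => ⟪tens f g, R⟫_ℂ :=
    Continuous.ext_on dense_bddSupp (by fun_prop) ((continuous_tens_right f).inner continuous_const)
      fun g hg => congrFun (h1 g hg) f
  exact congrFun h2 g

section HilbertSchmidt

variable {E : Type*} [NormedAddCommGroup E] [InnerProductSpace ℂ E]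

lemma HilbertBasis.hasSum_norm_inner_sq {ι : Type*} (e : HilbertBasis ι ℂ E) (x : E) :
    HasSum (fun i => ‖⟪e i, x⟫_ℂ‖ ^ 2) (‖x‖ ^ 2) := by
  have h := e.hasSum_inner_mul_inner x x
  rw [inner_self_eq_norm_sq_to_K] at h
  have h1 : ∀ i, ⟪x, e i⟫_ℂ * ⟪e i, x⟫_ℂ = ((‖⟪e i, x⟫_ℂ‖ ^ 2 : ℝ) : ℂ) := fun i => by
    rw [← inner_conj_symm x (e i), RCLike.conj_mul]
    push_cast
    rfl
  simp_rw [h1] at h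
  exact Complex.hasSum_ofReal.1 (by push_cast at h ⊢; exact h)

lemma summable_norm_sq_of_inner_eq {ι : Type*} (e : HilbertBasis ι ℂ L2) {T : L2 →L[ℂ] L2}
    {R : Lp ℂ 2 (volume : Measure (ℝ × ℝ))} (h : ∀ f g, ⟪f, T g⟫_ℂ = ⟪tens f g, R⟫_ℂ) :
    Summable fun i => ‖T (e i)‖ ^ 2 := by
  classical
  have hv : Orthonormal ℂ fun q : ι × ι => tens (e q.2) (e q.1) := by
    rw [orthonormal_iff_ite]
    rintro ⟨i, j⟩ ⟨i', j'⟩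
    have := orthonormal_iff_ite.1 e.orthonormal
    rw [inner_tens_tens, this, this]
    simp only [Prod.mk.injEq, eq_comm (a := i')]
    split_ifs <;> simp_all
  have hs := hv.inner_products_summable R
  simp_rw [← h] at hs
  exact hs.prod.congr fun j => (e.hasSum_norm_inner_sq (T (e j))).tsum_eq

lemma norm_sum_smul_le {ι : Type*} (e : HilbertBasis ι ℂ E) (T : E →L[ℂ] E) (s : Finset ι)
    (x : E) : ‖∑ i ∈ s, ⟪e i, x⟫_ℂ • T (e i)‖ ≤ √(∑ i ∈ s, ‖T (e i)‖ ^ 2) * ‖x‖ := by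
  calc _ ≤ ∑ i ∈ s, ‖⟪e i, x⟫_ℂ‖ * ‖T (e i)‖ :=
        (norm_sum_le _ _).trans_eq (by simp only [norm_smul])
    _ ≤ √(∑ i ∈ s, ‖⟪e i, x⟫_ℂ‖ ^ 2) * √(∑ i ∈ s, ‖T (e i)‖ ^ 2) := Real.sum_mul_le_sqrt_mul_sqrt ..
    _ ≤ ‖x‖ * √(∑ i ∈ s, ‖T (e i)‖ ^ 2) := by
        gcongr
        exact Real.sqrt_le_iff.2 ⟨norm_nonneg _, e.orthonormal.sum_inner_products_le x⟩
    _ = _ := mul_comm _ _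

lemma isCompactOperator_of_summable_norm_sq [CompleteSpace E] {ι : Type*} (e : HilbertBasis ι ℂ E)
    (T : E →L[ℂ] E) (h : Summable fun i => ‖T (e i)‖ ^ 2) : IsCompactOperator T := by
  classical
  let F : Finset ι → E →L[ℂ] E := fun s => ∑ i ∈ s, (innerSL ℂ (e i)).smulRight (T (e i))
  have hFa : ∀ s x, F s x = ∑ i ∈ s, ⟪e i, x⟫_ℂ • T (e i) := fun s x => by
    simp [F, _root_.sum_apply]
  refine isCompactOperator_of_tendsto (F := F) (l := Filter.atTop) ?_ (.of_forall fun s => ?_)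
  · rw [Metric.tendsto_atTop]
    intro ε hε
    obtain ⟨s, hs⟩ := summable_iff_vanishing_norm.1 h ((ε / 2) ^ 2) (by positivity)
    refine ⟨s, fun t hst => ?_⟩
    rw [dist_comm, dist_eq_norm]
    refine (ContinuousLinearMap.opNorm_le_bound _ (half_pos hε).le fun x => ?_).trans_lt
      (half_lt_self hε)
    have hx : HasSum (fun i => ⟪e i, x⟫_ℂ • T (e i)) (T x) := by
      have := (e.hasSum_repr x).mapL T
      simpa only [map_smul, e.repr_apply_apply] using this
    rw [_root_.sub_apply, hFa]
    have hlim : Filter.Tendsto (fun u => ∑ i ∈ u, ⟪e i, x⟫_ℂ • T (e i) -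
        ∑ i ∈ t, ⟪e i, x⟫_ℂ • T (e i)) Filter.atTop
        (nhds (T x - ∑ i ∈ t, ⟪e i, x⟫_ℂ • T (e i))) := hx.sub_const _
    refine le_of_tendsto hlim.norm ?_
    filter_upwards [Filter.eventually_ge_atTop t] with u hu
    rw [← Finset.sum_sdiff hu, add_sub_cancel_right]
    refine (norm_sum_smul_le e T _ x).trans ?_
    gcongr
    rw [Real.sqrt_le_left (half_pos hε).le]
    have := hs (u \ t) (Finset.disjoint_of_subset_right hst Finset.sdiff_disjoint)
    exact (le_abs_self _).trans this.le
  · refine Finset.sum_induction _ (fun T : E →L[ℂ] E => IsCompactOperator T)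
      (fun _ _ => IsCompactOperator.add) isCompactOperator_zero fun i _ => ?_
    exact (isCompactOperator_of_locallyCompactSpace_rng
      (ContinuousLinearMap.toSpanSingleton ℂ (T (e i)))).comp_clm (innerSL ℂ (e i))

lemma finite_spectrum_norm_ge {E : Type} [NormedAddCommGroup E] [InnerProductSpace ℂ E]
    [CompleteSpace E] {T : E →L[ℂ] E} (hT : ∀ x y, ⟪T x, y⟫_ℂ = ⟪x, T y⟫_ℂ)
    (hs : ∀ (ι : Type) (e : HilbertBasis ι ℂ E), Summable fun i => ‖T (e i)‖ ^ 2)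
    {δ : ℝ} (hδ : 0 < δ) : {μ ∈ spectrum ℂ T | δ ≤ ‖μ‖}.Finite := by
  obtain ⟨w₀, e₀, -⟩ := exists_hilbertBasis ℂ E
  have hc := isCompactOperator_of_summable_norm_sq e₀ T (hs _ e₀)
  have hsym : (T : E →ₗ[ℂ] E).IsSymmetric := hT
  by_contra hinf
  set S := {μ ∈ spectrum ℂ T | δ ≤ ‖μ‖} with hS
  have : Infinite S := Set.infinite_coe_iff.2 hinf
  have hex : ∀ μ : S, ∃ v : Module.End.eigenspace (T : E →ₗ[ℂ] E) μ, ‖v‖ = 1 := by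
    rintro ⟨μ, hμ, hμδ⟩
    have h0 : μ ≠ 0 := norm_pos_iff.1 (hδ.trans_le hμδ)
    have := (Submodule.nontrivial_iff_ne_bot).2 ((hc.hasEigenvalue_iff_mem_spectrum h0).2 hμ)
    exact exists_norm_eq _ zero_le_one
  choose v hv using hex
  have ho : Orthonormal ℂ fun μ : S => (v μ : E) :=
    ⟨hv, fun μ ν h => hsym.orthogonalFamily_eigenspaces (Subtype.val_injective.ne h) (v μ) (v ν)⟩
  obtain ⟨w, b, hw, hb⟩ := ((orthonormal_subtype_range ho.linearIndependent.injective).2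
    ho).exists_hilbertBasis_extension
  have h1 := (hs _ b).comp_injective (i := fun μ : S => (⟨v μ, hw ⟨μ, rfl⟩⟩ : w))
    fun μ ν h => ho.linearIndependent.injective (congrArg Subtype.val h)
  have h2 : Summable fun _ : S => δ ^ 2 := by
    refine h1.of_nonneg_of_le (fun _ => by positivity) fun μ => ?_
    have : T (v μ : E) = (μ : ℂ) • (v μ : E) := Module.End.mem_eigenspace_iff.1 (v μ).2
    simp only [Function.comp_apply, hb, this, norm_smul]
    rw [← Submodule.coe_norm, hv, mul_one]
    exact pow_le_pow_left₀ hδ.le μ.2.2 2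
  exact (pow_pos hδ 2).ne' ((summable_const_iff _).1 h2)

end HilbertSchmidt

lemma sq_sub_one_mem_spectrum {R : Type*} [Ring R] [Algebra ℂ R] {a : R} {w : ℂ}
    (hw : w ∈ spectrum ℂ a) : w ^ 2 - 1 ∈ spectrum ℂ (a ^ 2 - 1) := by
  have := spectrum.subset_polynomial_aeval a (Polynomial.X ^ 2 - 1 : Polynomial ℂ)
    (Set.mem_image_of_mem _ hw)
  simpa using this

lemma exists_isolating_radius {R : Type*} [Ring R] [Algebra ℂ R] {a : R}
    (h : ∀ δ > 0, {μ ∈ spectrum ℂ (a ^ 2 - 1) | δ ≤ ‖μ‖}.Finite) {z : ℂ} (h1 : z ≠ 1)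
    (h2 : z ≠ -1) : ∃ ε > (0 : ℝ), ∀ w ∈ spectrum ℂ a, ‖w - z‖ < ε → w = z := by
  have hz : z ^ 2 - 1 ≠ 0 := fun h0 => by
    rcases sq_eq_sq_iff_eq_or_eq_neg.1 ((sub_eq_zero.1 h0).trans (one_pow 2).symm) with h | h
    exacts [h1 h, h2 h]
  set δ := ‖z ^ 2 - 1‖ / 2 with hδ
  have hδ0 : 0 < δ := half_pos (norm_pos_iff.2 hz)
  have hf : Filter.Tendsto (fun w : ℂ => w ^ 2 - 1) (nhds z) (nhds (z ^ 2 - 1)) :=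
    Continuous.tendsto (by fun_prop) z
  have e1 : ∀ᶠ w in nhds z, w ^ 2 - 1 ∉
      {μ ∈ spectrum ℂ (a ^ 2 - 1) | δ ≤ ‖μ‖} \ {z ^ 2 - 1} :=
    hf.eventually (((h δ hδ0).subset Set.sdiff_subset).isClosed.isOpen_compl.mem_nhds (by simp))
  have e2 : ∀ᶠ w in nhds z, δ < ‖w ^ 2 - 1‖ :=
    hf.norm.eventually (lt_mem_nhds (half_lt_self (norm_pos_iff.2 hz)))
  have e3 : ∀ᶠ w in nhds z, w = -z → w = z := by
    rcases eq_or_ne z (-z) with h | h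
    · exact .of_forall fun w hw => hw.trans h.symm
    · exact (eventually_ne_nhds h).mono fun w hw hw' => absurd hw' hw
  obtain ⟨ε, hε, H⟩ := Metric.eventually_nhds_iff.1 (e1.and (e2.and e3))
  refine ⟨ε, hε, fun w hw hwz => ?_⟩
  obtain ⟨h3, h4, h5⟩ := H (by rwa [dist_eq_norm])
  have h6 : w ^ 2 - 1 = z ^ 2 - 1 := by
    by_contra hne
    exact h3 ⟨⟨sq_sub_one_mem_spectrum hw, h4.le⟩, hne⟩
  rcases sq_eq_sq_iff_eq_or_eq_neg.1 (sub_left_injective h6) with h | h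
  exacts [h, h5 h]

lemma inner_sq_sub_one_eq_inner_tens {A0 A2 A4 : L2 →L[ℂ] L2} (h0 : IsSgnQ 0 A0)
    (h2 : IsSgnQ (2 * π / 3) A2) (h4 : IsSgnQ (4 * π / 3) A4) (f g : L2) :
    ⟪f, ((A0 + A2 + A4) ^ 2 - 1 : L2 →L[ℂ] L2) g⟫_ℂ =
      ⟪tens f g, (memLp_resKer phaseScale_pos).toLp _⟫_ℂ := by
  refine inner_apply_eq_inner_tens (fun f g hf hg => ?_) f g
  rw [inner_sq_sub_one_eq_integral h0 h2 h4 hf hg, L2.inner_def]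
  refine integral_congr_ae ?_
  filter_upwards [coeFn_tens f g, (memLp_resKer phaseScale_pos).coeFn_toLp] with p h h'
  rw [h, h', RCLike.inner_apply, map_mul, conj_conj, mul_comm]

/-- With `A := sgn Q(0) + sgn Q(2π/3) + sgn Q(4π/3)`, the operator
`A² − 1` is Hilbert–Schmidt: for every Hilbert (orthonormal) basis `(eₙ)` of `L²(ℝ)`,
`Σₙ ‖(A² − 1)eₙ‖² < ∞`. Consequently the spectrum of `A` is discrete except for the
two possible accumulation points `−1` and `1`. -/
theorem A_sq_sub_one_hilbertSchmidt (A0 A2 A4 : L2 →L[ℂ] L2)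
    (h0 : IsSgnQ 0 A0) (h2 : IsSgnQ (2 * π / 3) A2) (h4 : IsSgnQ (4 * π / 3) A4) :
    (∀ (ι : Type) (e : HilbertBasis ι ℂ L2),
      Summable (fun i => ‖(((A0 + A2 + A4) ^ 2 - 1 : L2 →L[ℂ] L2)) (e i)‖ ^ 2)) ∧
    (∀ z ∈ spectrum ℂ (A0 + A2 + A4), z ≠ 1 → z ≠ -1 →
      ∃ ε > (0:ℝ), ∀ w ∈ spectrum ℂ (A0 + A2 + A4), ‖w - z‖ < ε → w = z) := by
  have hs : ∀ (ι : Type) (e : HilbertBasis ι ℂ L2),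
      Summable (fun i => ‖(((A0 + A2 + A4) ^ 2 - 1 : L2 →L[ℂ] L2)) (e i)‖ ^ 2) := fun ι e =>
    summable_norm_sq_of_inner_eq e (inner_sq_sub_one_eq_inner_tens h0 h2 h4)
  have hA : ∀ u v, ⟪(A0 + A2 + A4) u, v⟫_ℂ = ⟪u, (A0 + A2 + A4) v⟫_ℂ := fun u v => by
    simp only [_root_.add_apply, inner_add_left, inner_add_right, h0.inner_map_right,
      h2.inner_map_right, h4.inner_map_right]
  refine ⟨hs, fun z _ h1 h2 => exists_isolating_radius (fun δ hδ => ?_) h1 h2⟩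
  refine finite_spectrum_norm_ge (fun u v => ?_) hs hδ
  simp only [sq, _root_.sub_apply, mul_apply_eq_comp, one_apply_eq_self, inner_sub_left,
    inner_sub_right, hA]
end
end

section
/- Let s, t ∈ ℝ satisfy s < π < t < s + π (so that 0 < s < π and π < t < 2π, hence sin s ≠ 0, sin t ≠ 0 and sin(t − s) ≠ 0). Then the operator norm of sgn Q(0) + sgn Q(s) + sgn Q(t) on L²(ℝ) is strictly less than 3. -/
open MeasureTheory Complex Real
open scoped InnerProductSpace ComplexConjugate

noncomputable section

lemma norm_involution_sum_lt_three {E : Type*} [NormedAddCommGroup E] [InnerProductSpace ℂ E]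
    (S B C : E →L[ℂ] E) (hS : ∀ x, ‖S x‖ = ‖x‖) (hB : ∀ x, ‖B x‖ = ‖x‖)
    (hC : ∀ x, ‖C x‖ = ‖x‖) (hBB : ∀ x, B (B x) = x)
    (hCC : ∀ x, C (C x) = x) {γ : ℝ} (hγ : γ < 2)
    (hpos : ∀ x, (⟪x + S x, B (x + S x) + C (x + S x)⟫_ℂ).re ≤ γ * ‖x + S x‖ ^ 2)
    (hneg : ∀ x, -(γ * ‖x - S x‖ ^ 2) ≤ (⟪x - S x, B (x - S x) + C (x - S x)⟫_ℂ).re) :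
    ‖S + B + C‖ < 3 := by
  have key : ∀ T : E →L[ℂ] E, (∀ x, ‖T x‖ = ‖x‖) → (∀ x, T (T x) = x) → ∀ x,
      ‖x + S x‖ ^ 2 - 2 * ‖S x - T x‖ * ‖x + S x‖ ≤ (⟪x + S x, T (x + S x)⟫_ℂ).re ∧
      (⟪x - S x, T (x - S x)⟫_ℂ).re ≤ -‖x - S x‖ ^ 2 + 2 * ‖S x - T x‖ * ‖x - S x‖ := by
    intro T hT hTT x
    have h1 : ‖T (S x) - x‖ = ‖S x - T x‖ := by
      rw [← hT (S x - T x), map_sub, hTT]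
    have e1 : ‖T (x + S x) - (x + S x)‖ ≤ 2 * ‖S x - T x‖ := by
      have : T (x + S x) - (x + S x) = (T (S x) - x) - (S x - T x) := by
        rw [map_add]; abel
      rw [this]
      refine (norm_sub_le _ _).trans ?_
      linarith
    have e2 : ‖T (x - S x) + (x - S x)‖ ≤ 2 * ‖S x - T x‖ := by
      have : T (x - S x) + (x - S x) = -(T (S x) - x) - (S x - T x) := by
        rw [map_sub]; abel
      rw [this]
      refine (norm_sub_le _ _).trans ?_
      rw [norm_neg]; linarith
    have b1 : ∀ u v : E, |(⟪u, v⟫_ℂ).re| ≤ ‖u‖ * ‖v‖ := fun u v =>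
      (Complex.abs_re_le_norm _).trans (norm_inner_le_norm u v)
    have s1 : ∀ u : E, (⟪u, u⟫_ℂ).re = ‖u‖ ^ 2 := fun u => by
      rw [inner_self_eq_norm_sq_to_K]; norm_cast
    constructor
    · have := (abs_le.1 (b1 (x + S x) (T (x + S x) - (x + S x)))).1
      rw [inner_sub_right, Complex.sub_re, s1] at this
      nlinarith [norm_nonneg (x + S x)]
    · have := (abs_le.1 (b1 (x - S x) (T (x - S x) + (x - S x)))).2
      rw [inner_add_right, Complex.add_re, s1] at this
      nlinarith [norm_nonneg (x - S x)]
  set η : ℝ := (2 - γ) / 2 with hη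
  have hη0 : 0 < η := by rw [hη]; linarith
  have main : ∀ x, ‖(S + B + C) x‖ ^ 2 ≤ (9 - η ^ 2 / 2) * ‖x‖ ^ 2 := by
    intro x
    obtain ⟨p1, n1⟩ := key B hB hBB x
    obtain ⟨p2, n2⟩ := key C hC hCC x
    have p3 := hpos x
    have n3 := hneg x
    rw [inner_add_right, Complex.add_re] at p3 n3
    have par := parallelogram_law_with_norm ℂ x (S x)
    rw [hS] at par
    have t1 : ‖x + S x‖ ≤ 2 * ‖x‖ := (norm_add_le _ _).trans (by rw [hS]; linarith)
    have t2 : ‖x - S x‖ ≤ 2 * ‖x‖ := (norm_sub_le _ _).trans (by rw [hS]; linarith)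
    set β := ‖S x - B x‖
    set δ := ‖S x - C x‖
    have hβ : 0 ≤ β := norm_nonneg _
    have hδ : 0 ≤ δ := norm_nonneg _
    have q1 : β * ‖x + S x‖ ≤ β * (2 * ‖x‖) := by gcongr
    have q2 : β * ‖x - S x‖ ≤ β * (2 * ‖x‖) := by gcongr
    have q3 : δ * ‖x + S x‖ ≤ δ * (2 * ‖x‖) := by gcongr
    have q4 : δ * ‖x - S x‖ ≤ δ * (2 * ‖x‖) := by gcongr
    have hsum : (2 - γ) * (4 * ‖x‖ ^ 2) ≤ 8 * (β + δ) * ‖x‖ := by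
      have : ‖x + S x‖ ^ 2 + ‖x - S x‖ ^ 2 = 4 * ‖x‖ ^ 2 := by nlinarith
      rw [← this]
      nlinarith
    have hlow : η * ‖x‖ ≤ β + δ := by
      rcases (norm_nonneg x).eq_or_lt with h | h
      · rw [← h]; simp; positivity
      · have : (η * ‖x‖) * ‖x‖ ≤ (β + δ) * ‖x‖ := by rw [hη]; nlinarith
        exact le_of_mul_le_mul_right this h
    have hsq : η ^ 2 * ‖x‖ ^ 2 / 2 ≤ β ^ 2 + δ ^ 2 := by
      have : (η * ‖x‖) ^ 2 ≤ (β + δ) ^ 2 := by gcongr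
      nlinarith [sq_nonneg (β - δ)]
    have idn : ‖S x + B x + C x‖ ^ 2 + ‖S x - B x‖ ^ 2 + ‖S x - C x‖ ^ 2 + ‖B x - C x‖ ^ 2
        = 9 * ‖x‖ ^ 2 := by
      have := @norm_add_sq ℂ E _ _ _ (S x + B x) (C x)
      rw [this, @norm_add_sq ℂ E _ _ _ (S x) (B x), @norm_sub_sq ℂ E _ _ _ (S x) (B x),
        @norm_sub_sq ℂ E _ _ _ (S x) (C x), @norm_sub_sq ℂ E _ _ _ (B x) (C x),
        inner_add_left, map_add, hS, hB, hC]
      ring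
    have : (S + B + C) x = S x + B x + C x := rfl
    rw [this]
    nlinarith [sq_nonneg ‖B x - C x‖]
  have hle : ‖S + B + C‖ ≤ √(max 0 (9 - η ^ 2 / 2)) := by
    refine ContinuousLinearMap.opNorm_le_bound _ (Real.sqrt_nonneg _) fun x => ?_
    refine le_of_sq_le_sq ?_ (by positivity)
    rw [mul_pow, Real.sq_sqrt (le_max_left _ _)]
    exact (main x).trans (by gcongr; exact le_max_right _ _)
  refine hle.trans_lt ?_
  rw [Real.sqrt_lt' (by norm_num)]
  refine max_lt (by norm_num) ?_
  nlinarith [sq_pos_of_pos hη0]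

lemma lintegral_schur_weight {x : ℝ} (hx : 0 < x) :
    ∫⁻ y in Set.Ioi (0:ℝ), ENNReal.ofReal (√x / √y / (√x + √y) ^ 2) = 2 := by
  have hsx : 0 < √x := Real.sqrt_pos.2 hx
  have hd : ∀ y ∈ Set.Ioi (0:ℝ), HasDerivAt (fun y => -(2 * √x / (√x + √y)))
      (√x / √y / (√x + √y) ^ 2) y := by
    intro y hy
    have hsy : 0 < √y := Real.sqrt_pos.2 hy
    have h : HasDerivAt (fun y => -(2 * √x / (√x + √y)))
        (-((0 * (√x + √y) - 2 * √x * (1 / (2 * √y))) / (√x + √y) ^ 2)) y :=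
      (((hasDerivAt_const y (2 * √x)).div
        ((Real.hasDerivAt_sqrt (ne_of_gt hy)).const_add (√x)) (by positivity))).neg
    have e : √x / √y / (√x + √y) ^ 2 =
        -((0 * (√x + √y) - 2 * √x * (1 / (2 * √y))) / (√x + √y) ^ 2) := by
      field_simp
      ring
    rw [e]
    exact h
  have hc : ContinuousWithinAt (fun y => -(2 * √x / (√x + √y))) (Set.Ici 0) 0 := by
    apply Continuous.continuousWithinAt
    refine (Continuous.div continuous_const (by fun_prop) fun y => ?_).neg
    positivity
  have hl : Filter.Tendsto (fun y => -(2 * √x / (√x + √y))) Filter.atTop (nhds 0) := by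
    rw [← neg_zero]
    refine Filter.Tendsto.neg (Filter.Tendsto.div_atTop tendsto_const_nhds ?_)
    exact Filter.tendsto_atTop_add_const_left _ _ Real.tendsto_sqrt_atTop
  have hnn : ∀ y ∈ Set.Ioi (0:ℝ), 0 ≤ √x / √y / (√x + √y) ^ 2 := fun y _ => by positivity
  rw [← ofReal_integral_eq_lintegral_ofReal
    (integrableOn_Ioi_deriv_of_nonneg hc hd hnn hl)
    ((ae_restrict_iff' measurableSet_Ioi).2 (Filter.Eventually.of_forall hnn)),
    integral_Ioi_of_hasDerivAt_of_nonneg hc hd hnn hl]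
  simp [hsx.ne']

lemma lintegral_schur_le {f : ℝ → ℝ} (hf : Measurable f)
    (hpos : ∀ x ≤ 0, f x = 0) :
    ∫⁻ z : ℝ × ℝ, ENNReal.ofReal (f z.1 * f z.2 * (1 / (√z.1 + √z.2) ^ 2)) ≤
      2 * ∫⁻ x, ENNReal.ofReal (f x ^ 2) := by
  set G : ℝ → ℝ → ENNReal := fun x y => ENNReal.ofReal (f x ^ 2) *
    (Set.Ioi (0:ℝ)).indicator (fun y => ENNReal.ofReal (√x / √y / (√x + √y) ^ 2)) y with hG
  have hGm : Measurable (Function.uncurry G) := by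
    have : Function.uncurry G = fun z : ℝ × ℝ => ENNReal.ofReal (f z.1 ^ 2) *
        (Prod.snd ⁻¹' (Set.Ioi (0:ℝ))).indicator
          (fun z => ENNReal.ofReal (√z.1 / √z.2 / (√z.1 + √z.2) ^ 2)) z := by
      ext z
      simp only [Function.uncurry, hG, Set.indicator, Set.mem_preimage]
    rw [this]
    refine Measurable.mul (by fun_prop) (Measurable.indicator ?_ (measurable_snd measurableSet_Ioi))
    fun_prop
  have hint : ∀ x, ∫⁻ y, G x y = 2 * ENNReal.ofReal (f x ^ 2) := by
    intro x
    rcases le_or_gt x 0 with hx | hx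
    · simp [hG, hpos x hx]
    · simp only [hG]
      rw [lintegral_const_mul' _ _ ENNReal.ofReal_ne_top, lintegral_indicator measurableSet_Ioi,
        lintegral_schur_weight hx, mul_comm]
  have hpt : ∀ z : ℝ × ℝ, ENNReal.ofReal (f z.1 * f z.2 * (1 / (√z.1 + √z.2) ^ 2)) ≤
      2⁻¹ * (G z.1 z.2 + G z.2 z.1) := by
    rintro ⟨x, y⟩
    rcases le_or_gt x 0 with hx | hx
    · simp [hpos x hx]
    rcases le_or_gt y 0 with hy | hy
    · simp [hpos y hy]
    simp only [hG, Set.indicator_of_mem (Set.mem_Ioi.2 hx), Set.indicator_of_mem (Set.mem_Ioi.2 hy)]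
    have hsx : 0 < √x := Real.sqrt_pos.2 hx
    have hsy : 0 < √y := Real.sqrt_pos.2 hy
    rw [← ENNReal.ofReal_mul (by positivity), ← ENNReal.ofReal_mul (by positivity),
      ← ENNReal.ofReal_add (by positivity) (by positivity),
      show (2⁻¹ : ENNReal) = ENNReal.ofReal (2⁻¹) by
        rw [ENNReal.ofReal_inv_of_pos (by norm_num)]; norm_num,
      ← ENNReal.ofReal_mul (by norm_num)]
    apply ENNReal.ofReal_le_ofReal
    have e : 2⁻¹ * (f x ^ 2 * (√x / √y / (√x + √y) ^ 2) + f y ^ 2 * (√y / √x / (√y + √x) ^ 2))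
        - f x * f y * (1 / (√x + √y) ^ 2) =
        (f x * √x - f y * √y) ^ 2 / (2 * √x * √y * (√x + √y) ^ 2) := by
      rw [add_comm (√y) (√x)]
      field_simp
      ring
    have : 0 ≤ (f x * √x - f y * √y) ^ 2 / (2 * √x * √y * (√x + √y) ^ 2) := by positivity
    linarith
  calc _ ≤ ∫⁻ z : ℝ × ℝ, 2⁻¹ * (G z.1 z.2 + G z.2 z.1) := lintegral_mono hpt
    _ = 2⁻¹ * (∫⁻ z : ℝ × ℝ, G z.1 z.2) + 2⁻¹ * ∫⁻ z : ℝ × ℝ, G z.2 z.1 := by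
      have h : ∫⁻ z : ℝ × ℝ, G z.1 z.2 + G z.2 z.1 =
          (∫⁻ z : ℝ × ℝ, G z.1 z.2) + ∫⁻ z : ℝ × ℝ, G z.2 z.1 := lintegral_add_left hGm _
      rw [lintegral_const_mul' _ _ (by simp), h, mul_add]
    _ = 2 * ∫⁻ x, ENNReal.ofReal (f x ^ 2) := by
      have h1 : ∫⁻ z : ℝ × ℝ, G z.1 z.2 = 2 * ∫⁻ x, ENNReal.ofReal (f x ^ 2) := by
        have h : ∫⁻ z : ℝ × ℝ, G z.1 z.2 = ∫⁻ x, ∫⁻ y, G x y :=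
          lintegral_prod _ hGm.aemeasurable
        rw [h]
        simp only [hint]
        rw [lintegral_const_mul' _ _ (by simp)]
      have h2 : ∫⁻ z : ℝ × ℝ, G z.2 z.1 = 2 * ∫⁻ x, ENNReal.ofReal (f x ^ 2) := by
        rw [← h1, Measure.volume_eq_prod, ← lintegral_prod_swap]
        rfl
      rw [h1, h2, ← add_mul, ENNReal.inv_two_add_inv_two, one_mul]

lemma integrable_of_bounded_support {g : ℝ → ℂ} {M N : ℝ} (hm : Measurable g)
    (hM : ∀ x, ‖g x‖ ≤ M) (hN : ∀ x, N < |x| → g x = 0) : Integrable g := by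
  have h : IntegrableOn g (Set.Icc (-N) N) :=
    Measure.integrableOn_of_bounded (by simp) hm.aestronglyMeasurable
      (Filter.Eventually.of_forall hM)
  refine h.integrable_of_forall_notMem_eq_zero fun x hx => hN x ?_
  rw [← not_le, abs_le]
  exact hx

lemma integrable_mul_conj {g : ℝ → ℂ} (hg : Integrable g) :
    Integrable (fun z : ℝ × ℝ => g z.1 * conj (g z.2)) :=
  hg.mul_prod (hg.norm.mono' (Complex.continuous_conj.comp_aestronglyMeasurable hg.1) (by simp) :
    Integrable fun x => conj (g x))

lemma integrable_form_of_bounded_kernel {g : ℝ → ℂ} {N C : ℝ} (hg : Integrable g)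
    (hN : ∀ x, N < |x| → g x = 0) {k : ℝ × ℝ → ℂ} (hk : Measurable k)
    (hC : ∀ z : ℝ × ℝ, |z.1| ≤ N → |z.2| ≤ N → ‖k z‖ ≤ C) :
    Integrable (fun z : ℝ × ℝ => k z * (g z.1 * conj (g z.2))) := by
  have hg2 : Integrable (fun z : ℝ × ℝ => g z.1 * conj (g z.2)) :=
    integrable_mul_conj hg
  refine (hg2.norm.const_mul C).mono' (hk.aestronglyMeasurable.mul hg2.aestronglyMeasurable)
    (Filter.Eventually.of_forall fun z => ?_)
  rw [norm_mul]
  by_cases h1 : |z.1| ≤ N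
  · by_cases h2 : |z.2| ≤ N
    · gcongr
      exact hC z h1 h2
    · simp [hN _ (not_le.1 h2)]
  · simp [hN _ (not_le.1 h1)]

lemma ae_fst_ne_snd_s14 : ∀ᵐ z : ℝ × ℝ, z.1 ≠ z.2 := by
  have hs : MeasurableSet {z : ℝ × ℝ | z.1 = z.2} :=
    measurableSet_eq_fun measurable_fst measurable_snd
  rw [ae_iff]
  simp only [ne_eq, not_not]
  rw [Measure.volume_eq_prod, Measure.measure_prod_null hs]
  refine Filter.Eventually.of_forall fun x => ?_
  have : (Prod.mk x ⁻¹' {z : ℝ × ℝ | z.1 = z.2}) = {x} := by ext y; simp [eq_comm]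
  simp only [this]
  simp

lemma integral_exp_mul_I_symm (a : ℝ) {w : ℝ} (hw : w ≠ 0) :
    ∫ ξ in (-a)..a, Complex.exp (I * ξ * w) = ((2 * (Real.sin (a * w) / w) : ℝ) : ℂ) := by
  have hc : (I * w : ℂ) ≠ 0 := by simp [hw]
  have := integral_exp_mul_complex (a := -a) (b := a) hc
  have e : ∀ ξ : ℝ, I * ξ * w = I * w * ξ := fun ξ => by ring
  simp only [e]
  rw [this]
  push_cast
  rw [Complex.sin]
  have hw' : (w : ℂ) ≠ 0 := by exact_mod_cast hw
  field_simp
  simp only [I_sq]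
  ring

lemma sin_form_nonneg {h : ℝ → ℂ} (hh : Integrable h) (hpos : ∀ x ≤ 0, h x = 0) {a : ℝ}
    (ha : 0 ≤ a) :
    0 ≤ (∫ z : ℝ × ℝ, ((2 * (Real.sin (a * (z.1 ^ 2 - z.2 ^ 2)) / (z.1 ^ 2 - z.2 ^ 2)) : ℝ) : ℂ)
      * (h z.1 * conj (h z.2))).re := by
  have hh2 : Integrable (fun z : ℝ × ℝ => h z.1 * conj (h z.2)) :=
    integrable_mul_conj hh
  have e1 : ∫ z : ℝ × ℝ, ((2 * (Real.sin (a * (z.1 ^ 2 - z.2 ^ 2)) / (z.1 ^ 2 - z.2 ^ 2)) : ℝ) : ℂ)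
      * (h z.1 * conj (h z.2)) = ∫ z : ℝ × ℝ, ∫ ξ in Set.Ioc (-a) a,
        Complex.exp (I * ξ * ((z.1 ^ 2 - z.2 ^ 2 : ℝ) : ℂ)) * (h z.1 * conj (h z.2)) := by
    refine integral_congr_ae ?_
    filter_upwards [ae_fst_ne_snd_s14] with z hz
    rw [integral_mul_const, ← intervalIntegral.integral_of_le (by linarith)]
    by_cases h1 : z.1 ≤ 0
    · simp [hpos _ h1]
    by_cases h2 : z.2 ≤ 0
    · simp [hpos _ h2]
    rw [integral_exp_mul_I_symm]
    push Not at h1 h2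
    rw [sq_sub_sq]
    exact mul_ne_zero (by positivity) (sub_ne_zero.2 hz)
  rw [e1, integral_integral_swap]
  · have e2 : ∀ ξ : ℝ, ∫ z : ℝ × ℝ, Complex.exp (I * ξ * ((z.1 ^ 2 - z.2 ^ 2 : ℝ) : ℂ)) *
        (h z.1 * conj (h z.2)) = ((‖∫ x : ℝ, Complex.exp (I * ξ * x ^ 2) * h x‖ ^ 2 : ℝ) : ℂ) := by
      intro ξ
      rw [Complex.ofReal_pow, ← Complex.mul_conj', ← integral_conj,
        ← integral_prod_mul]
      refine integral_congr_ae (Filter.Eventually.of_forall fun z => ?_)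
      simp only [map_mul, ← Complex.exp_conj, Complex.conj_I, Complex.conj_ofReal, map_pow]
      rw [mul_mul_mul_comm, ← Complex.exp_add]
      push_cast
      ring_nf
    simp only [e2]
    rw [integral_complex_ofReal, Complex.ofReal_re]
    exact integral_nonneg fun ξ => by positivity
  · have i1 : Integrable (fun p : (ℝ × ℝ) × ℝ => (h p.1.1 * conj (h p.1.2)) * (1:ℂ))
        ((volume : Measure (ℝ × ℝ)).prod (volume.restrict (Set.Ioc (-a) a))) :=
      hh2.mul_prod (integrable_const (1:ℂ))
    refine i1.norm.mono' ?_ (Filter.Eventually.of_forall fun p => ?_)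
    · refine AEStronglyMeasurable.mul ?_ (by simpa using i1.aestronglyMeasurable)
      exact Continuous.aestronglyMeasurable (by fun_prop)
    · simp only [Function.uncurry, norm_mul]
      rw [show I * (p.2 : ℂ) * ((p.1.1 ^ 2 - p.1.2 ^ 2 : ℝ) : ℂ) =
        ((p.2 * (p.1.1 ^ 2 - p.1.2 ^ 2) : ℝ) : ℂ) * I by push_cast; ring,
        Complex.norm_exp_ofReal_mul_I]
      simp

lemma abs_sin_mul_div_le {a : ℝ} (ha : 0 ≤ a) (w : ℝ) : |Real.sin (a * w) / w| ≤ a := by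
  rw [abs_div]
  refine div_le_of_le_mul₀ (abs_nonneg _) ha ?_
  refine (Real.abs_sin_le_abs).trans ?_
  rw [abs_mul, abs_of_nonneg ha]

lemma abs_sin_sq_sub_div_sub_le {a N : ℝ} (ha : 0 ≤ a) {x y : ℝ} (hx : |x| ≤ N) (hy : |y| ≤ N) :
    |Real.sin (a * (x ^ 2 - y ^ 2)) / (x - y)| ≤ a * (2 * N) := by
  rw [abs_div]
  have hN : 0 ≤ N := (abs_nonneg x).trans hx
  refine div_le_of_le_mul₀ (abs_nonneg _) (by positivity) ?_
  refine (Real.abs_sin_le_abs).trans ?_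
  rw [abs_mul, abs_of_nonneg ha, sq_sub_sq, abs_mul, mul_assoc]
  gcongr
  exact (abs_add_le x y).trans (by linarith)

lemma abs_sin_mul_sqrt_sub_sq_le {x y : ℝ} (hx : 0 < x) (hy : 0 < y) (θ : ℝ) :
    |Real.sin θ / (x - y) - 2 * (Real.sin θ / (x ^ 2 - y ^ 2)) * (√x * √y)| ≤
      1 / (√x + √y) ^ 2 := by
  rcases eq_or_ne x y with rfl | hne
  · simp
  obtain ⟨u, hu, rfl⟩ : ∃ u, 0 < u ∧ x = u ^ 2 :=
    ⟨√x, Real.sqrt_pos.2 hx, (Real.sq_sqrt hx.le).symm⟩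
  obtain ⟨v, hv, rfl⟩ : ∃ v, 0 < v ∧ y = v ^ 2 :=
    ⟨√y, Real.sqrt_pos.2 hy, (Real.sq_sqrt hy.le).symm⟩
  rw [Real.sqrt_sq hu.le, Real.sqrt_sq hv.le]
  have huv : u - v ≠ 0 := fun h => hne (by rw [sub_eq_zero.1 h])
  have h1 : u ^ 2 - v ^ 2 = (u - v) * (u + v) := by ring
  have h2 : (u ^ 2) ^ 2 - (v ^ 2) ^ 2 = (u - v) * (u + v) * (u ^ 2 + v ^ 2) := by ring
  have e : Real.sin θ / (u ^ 2 - v ^ 2) -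
      2 * (Real.sin θ / ((u ^ 2) ^ 2 - (v ^ 2) ^ 2)) * (u * v) =
      Real.sin θ * ((u - v) * (u + v) / (u ^ 2 + v ^ 2)) * (1 / (u + v) ^ 2) := by
    rw [h2, h1]
    field_simp
    ring
  rw [e, abs_mul, abs_mul, abs_of_nonneg (by positivity : 0 ≤ 1 / (u + v) ^ 2)]
  have h3 : |(u - v) * (u + v) / (u ^ 2 + v ^ 2)| ≤ 1 := by
    rw [abs_div, abs_of_pos (by positivity : 0 < u ^ 2 + v ^ 2)]
    refine div_le_one_of_le₀ ?_ (by positivity)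
    rw [abs_le]
    constructor <;> nlinarith
  have h4 := mul_le_mul (Real.abs_sin_le_one θ) h3 (abs_nonneg _) zero_le_one
  calc _ ≤ 1 * 1 * (1 / (u + v) ^ 2) := by gcongr
    _ = _ := by ring

lemma sin_form_re_ge {g : ℝ → ℂ} {M N : ℝ} (hm : Measurable g)
    (hM : ∀ x, ‖g x‖ ≤ M) (hN : ∀ x, N < |x| → g x = 0) (hpos : ∀ x ≤ 0, g x = 0)
    {a : ℝ} (ha : 0 ≤ a) :
    -(2 * ∫ x, ‖g x‖ ^ 2) ≤
      (∫ z : ℝ × ℝ, ((Real.sin (a * (z.1 ^ 2 - z.2 ^ 2)) / (z.1 - z.2) : ℝ) : ℂ)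
        * (g z.1 * conj (g z.2))).re := by
  have hg := integrable_of_bounded_support hm hM hN
  have hg2 : Integrable (fun x => ‖g x‖ ^ 2) := by
    refine (hg.norm.const_mul M).mono' (by fun_prop) (Filter.Eventually.of_forall fun x => ?_)
    rw [Real.norm_of_nonneg (by positivity), sq]
    gcongr
    exact hM x
  have hM0 : 0 ≤ M := (norm_nonneg _).trans (hM 0)
  set h : ℝ → ℂ := fun x => (√x : ℂ) * g x with hh
  have hhm : Measurable h := by fun_prop
  have hhN : ∀ x, N < |x| → h x = 0 := fun x hx => by simp [hh, hN x hx]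
  have hhM : ∀ x, ‖h x‖ ≤ √N * M := by
    intro x
    by_cases hx : |x| ≤ N
    · rw [hh, norm_mul, Complex.norm_real, Real.norm_of_nonneg (Real.sqrt_nonneg _)]
      gcongr
      · exact (le_abs_self x).trans hx
      · exact hM x
    · rw [hhN x (not_le.1 hx), norm_zero]; positivity
  have hhi := integrable_of_bounded_support hhm hhM hhN
  have hhpos : ∀ x ≤ 0, h x = 0 := fun x hx => by simp [hh, hpos x hx]
  set A : ℝ × ℝ → ℂ := fun z => ((Real.sin (a * (z.1 ^ 2 - z.2 ^ 2)) / (z.1 - z.2) : ℝ) : ℂ)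
    * (g z.1 * conj (g z.2)) with hA
  set B : ℝ × ℝ → ℂ := fun z =>
    ((2 * (Real.sin (a * (z.1 ^ 2 - z.2 ^ 2)) / (z.1 ^ 2 - z.2 ^ 2)) : ℝ) : ℂ)
    * (h z.1 * conj (h z.2)) with hB
  have hAi : Integrable A := by
    refine integrable_form_of_bounded_kernel hg hN (C := a * (2 * N)) (by fun_prop)
      fun z h1 h2 => ?_
    rw [Complex.norm_real]
    exact abs_sin_sq_sub_div_sub_le ha h1 h2
  have hBi : Integrable B := by
    refine integrable_form_of_bounded_kernel hhi hhN (C := 2 * a) (by fun_prop) fun z h1 h2 => ?_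
    rw [Complex.norm_real, norm_mul, Real.norm_of_nonneg zero_le_two]
    gcongr
    exact abs_sin_mul_div_le ha _
  have hBnn : 0 ≤ (∫ z, B z).re := sin_form_nonneg hhi hhpos ha
  have hle : ∀ z, ‖A z - B z‖ ≤ ‖g z.1‖ * ‖g z.2‖ * (1 / (√z.1 + √z.2) ^ 2) := by
    rintro ⟨x, y⟩
    rcases le_or_gt x 0 with hx | hx
    · simp [hA, hB, hpos x hx, hhpos x hx]
    rcases le_or_gt y 0 with hy | hy
    · simp [hA, hB, hpos y hy, hhpos y hy]
    have e : A (x, y) - B (x, y) = ((Real.sin (a * (x ^ 2 - y ^ 2)) / (x - y) -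
        2 * (Real.sin (a * (x ^ 2 - y ^ 2)) / (x ^ 2 - y ^ 2)) * (√x * √y) : ℝ) : ℂ) *
        (g x * conj (g y)) := by
      simp only [hA, hB, hh, map_mul, Complex.conj_ofReal]
      push_cast
      ring
    rw [e, norm_mul, norm_mul, RCLike.norm_conj, Complex.norm_real, mul_comm]
    gcongr
    exact abs_sin_mul_sqrt_sub_sq_le hx hy _
  have hD : ‖∫ z, (A z - B z)‖ ≤ 2 * ∫ x, ‖g x‖ ^ 2 := by
    refine (norm_integral_le_lintegral_norm _).trans ?_
    refine ENNReal.toReal_le_of_le_ofReal (by positivity) ?_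
    rw [ENNReal.ofReal_mul zero_le_two, ofReal_integral_eq_lintegral_ofReal hg2
      (Filter.Eventually.of_forall fun x => by positivity), ENNReal.ofReal_ofNat]
    refine le_trans ?_ (lintegral_schur_le (f := fun x => ‖g x‖) (by fun_prop)
      fun x hx => by simp [hpos x hx])
    exact lintegral_mono fun z => ENNReal.ofReal_le_ofReal (hle z)
  rw [integral_sub hAi hBi] at hD
  have := (abs_le.1 ((Complex.abs_re_le_norm _).trans hD)).1
  rw [Complex.sub_re] at this
  linarith

lemma sin_form_re_le {g : ℝ → ℂ} {M N : ℝ} (hm : Measurable g)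
    (hM : ∀ x, ‖g x‖ ≤ M) (hN : ∀ x, N < |x| → g x = 0) (hneg : ∀ x, 0 ≤ x → g x = 0)
    {a : ℝ} (ha : 0 ≤ a) :
    (∫ z : ℝ × ℝ, ((Real.sin (a * (z.1 ^ 2 - z.2 ^ 2)) / (z.1 - z.2) : ℝ) : ℂ)
        * (g z.1 * conj (g z.2))).re ≤ 2 * ∫ x, ‖g x‖ ^ 2 := by
  have := sin_form_re_ge (g := fun x => g (-x)) (M := M) (N := N) (by fun_prop) (fun x => hM _)
    (fun x hx => hN _ (by rwa [abs_neg])) (fun x hx => hneg _ (by linarith)) ha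
  rw [integral_neg_eq_self (fun x => ‖g x‖ ^ 2) volume] at this
  rw [← integral_neg_eq_self _ (volume : Measure (ℝ × ℝ))]
  simp only [Prod.fst_neg, Prod.snd_neg, neg_sq]
  have e : ∀ z : ℝ × ℝ, -z.1 - -z.2 = -(z.1 - z.2) := fun z => by ring
  simp only [e, div_neg, Complex.ofReal_neg, neg_mul, integral_neg, Complex.neg_re]
  linarith

lemma abs_realSign_le_one (p : ℝ) : |Real.sign p| ≤ 1 := by
  rcases Real.sign_apply_eq p with h | h | h <;> simp [h]

lemma integrable_sign_mul_exp {ε : ℝ} (hε : 0 < ε) :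
    Integrable (fun p : ℝ => Real.sign p * Real.exp (-ε * |p|)) := by
  have h : Integrable (fun p : ℝ => Real.exp (-ε * |p|)) := by
    rw [← integrableOn_univ, ← Set.Iic_union_Ioi (a := (0:ℝ))]
    refine IntegrableOn.union ?_ ?_
    · refine (integrableOn_exp_mul_Iic hε 0).congr_fun (fun p hp => ?_) measurableSet_Iic
      simp only [abs_of_nonpos (Set.mem_Iic.1 hp)]
      ring_nf
    · refine (integrableOn_exp_mul_Ioi (neg_lt_zero.2 hε) 0).congr_fun (fun p hp => ?_)
        measurableSet_Ioi
      simp only [abs_of_pos (Set.mem_Ioi.1 hp)]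
  refine h.mono' ?_ (Filter.Eventually.of_forall fun p => ?_)
  · exact (measurable_realSign.mul (by fun_prop)).aestronglyMeasurable
  · rw [norm_mul, Real.norm_of_nonneg (Real.exp_pos _).le]
    refine mul_le_of_le_one_left (Real.exp_pos _).le ?_
    exact abs_realSign_le_one p

lemma integral_sign_mul_exp {ε : ℝ} (hε : 0 < ε) (w : ℝ) :
    ∫ p : ℝ, ((Real.sign p * Real.exp (-ε * |p|) : ℝ) : ℂ) * Complex.exp (-I * p * w) =
      -2 * I * ((w / (w ^ 2 + ε ^ 2) : ℝ) : ℂ) := by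
  have hi : Integrable
      (fun p : ℝ => ((Real.sign p * Real.exp (-ε * |p|) : ℝ) : ℂ) * Complex.exp (-I * p * w)) := by
    refine (integrable_sign_mul_exp hε).norm.mono'
      ((integrable_sign_mul_exp hε).ofReal.aestronglyMeasurable.mul
        (Continuous.aestronglyMeasurable (by fun_prop)))
      (Filter.Eventually.of_forall fun p => ?_)
    rw [norm_mul, Complex.norm_real,
      show -I * (p : ℂ) * (w : ℂ) = ((-(p * w) : ℝ) : ℂ) * I by push_cast; ring,
      Complex.norm_exp_ofReal_mul_I, mul_one]
  rw [← intervalIntegral.integral_Iic_add_Ioi hi.integrableOn hi.integrableOn (b := 0)]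
  have h1 : ∫ p in Set.Ioi (0:ℝ), ((Real.sign p * Real.exp (-ε * |p|) : ℝ) : ℂ) *
      Complex.exp (-I * p * w) = ∫ p in Set.Ioi (0:ℝ), Complex.exp ((-ε - I * w) * p) := by
    refine setIntegral_congr_fun measurableSet_Ioi fun p hp => ?_
    simp only [Real.sign_of_pos (Set.mem_Ioi.1 hp), abs_of_pos (Set.mem_Ioi.1 hp), one_mul]
    rw [Complex.ofReal_exp, ← Complex.exp_add]
    push_cast
    ring_nf
  have h2 : ∫ p in Set.Iic (0:ℝ), ((Real.sign p * Real.exp (-ε * |p|) : ℝ) : ℂ) *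
      Complex.exp (-I * p * w) = -∫ p in Set.Iic (0:ℝ), Complex.exp ((ε - I * w) * p) := by
    rw [integral_Iic_eq_integral_Iio, integral_Iic_eq_integral_Iio, ← integral_neg]
    refine setIntegral_congr_fun measurableSet_Iio fun p hp => ?_
    simp only [Real.sign_of_neg (Set.mem_Iio.1 hp), abs_of_neg (Set.mem_Iio.1 hp), neg_mul, one_mul]
    rw [Complex.ofReal_neg, neg_mul, Complex.ofReal_exp, ← Complex.exp_add]
    push_cast
    ring_nf
  rw [h1, h2, integral_exp_mul_complex_Ioi (by simpa using hε),
    integral_exp_mul_complex_Iic (by simpa using hε)]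
  have n1 : (-ε - I * w : ℂ) ≠ 0 := fun h => by
    have := congrArg Complex.re h
    simp at this
    linarith
  have n2 : (ε - I * w : ℂ) ≠ 0 := fun h => by
    have := congrArg Complex.re h
    simp at this
    linarith
  have n3 : (w ^ 2 + ε ^ 2 : ℂ) ≠ 0 := by
    have : w ^ 2 + ε ^ 2 ≠ 0 := by positivity
    exact_mod_cast this
  push_cast
  simp only [mul_zero, Complex.exp_zero]
  field_simp
  ring_nf
  simp only [I_pow_three]
  ring

/-- The Fourier integral `(2π)^{-1/2} ∫ e^{-ipq} g(q) dq`. -/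
def fourierIntegralL1 (g : ℝ → ℂ) (p : ℝ) : ℂ :=
  (((2 * π) ^ (-(1:ℝ)/2) : ℝ) : ℂ) * ∫ q : ℝ, Complex.exp (-(Complex.I) * (p : ℂ) * (q : ℂ)) * g q

lemma norm_sq_fourierIntegralL1 (g : ℝ → ℂ) (p : ℝ) :
    ((‖fourierIntegralL1 g p‖ ^ 2 : ℝ) : ℂ) = ((1 / (2 * π) : ℝ) : ℂ) *
      ∫ z : ℝ × ℝ, Complex.exp (-I * p * ((z.1 - z.2 : ℝ) : ℂ)) * (g z.1 * conj (g z.2)) := by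
  have hc : ((2 * π) ^ (-(1:ℝ)/2) : ℝ) * ((2 * π) ^ (-(1:ℝ)/2) : ℝ) = 1 / (2 * π) := by
    rw [← Real.rpow_add (by positivity)]
    norm_num
    rw [Real.rpow_neg_one]
    field_simp
  rw [Complex.ofReal_pow, ← Complex.mul_conj', fourierIntegralL1, map_mul, Complex.conj_ofReal,
    mul_mul_mul_comm, ← Complex.ofReal_mul, hc, ← integral_conj, ← integral_prod_mul]
  congr 1
  refine integral_congr_ae (Filter.Eventually.of_forall fun z => ?_)
  simp only [map_mul, ← Complex.exp_conj, Complex.conj_I, Complex.conj_ofReal, map_neg]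
  rw [mul_mul_mul_comm, ← Complex.exp_add]
  push_cast
  ring_nf

lemma integral_sign_mul_exp_mul_fourier {g : ℝ → ℂ} (hg : Integrable g) {ε : ℝ} (hε : 0 < ε) :
    ((∫ p : ℝ, Real.sign p * Real.exp (-ε * |p|) * ‖fourierIntegralL1 g p‖ ^ 2 : ℝ) : ℂ) =
      ∫ z : ℝ × ℝ, (-I / π * (((z.1 - z.2) / ((z.1 - z.2) ^ 2 + ε ^ 2) : ℝ) : ℂ)) *
        (g z.1 * conj (g z.2)) := by
  have hg2 := integrable_mul_conj hg
  have hs := integrable_sign_mul_exp hε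
  rw [← integral_complex_ofReal]
  have e1 : ∀ p : ℝ,
      ((Real.sign p * Real.exp (-ε * |p|) * ‖fourierIntegralL1 g p‖ ^ 2 : ℝ) : ℂ) =
      ∫ z : ℝ × ℝ, ((1 / (2 * π) : ℝ) : ℂ) * (g z.1 * conj (g z.2)) *
        (((Real.sign p * Real.exp (-ε * |p|) : ℝ) : ℂ) *
          Complex.exp (-I * p * ((z.1 - z.2 : ℝ) : ℂ))) := by
    intro p
    rw [Complex.ofReal_mul, norm_sq_fourierIntegralL1, ← integral_const_mul, ← integral_const_mul]
    refine integral_congr_ae (Filter.Eventually.of_forall fun z => ?_)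
    ring
  simp only [e1]
  rw [integral_integral_swap]
  · refine integral_congr_ae (Filter.Eventually.of_forall fun z => ?_)
    simp only
    rw [integral_const_mul, integral_sign_mul_exp hε]
    have : (π : ℂ) ≠ 0 := by exact_mod_cast Real.pi_ne_zero
    push_cast
    field_simp
  · have i1 : Integrable (fun y : ℝ × (ℝ × ℝ) =>
        ((Real.sign y.1 * Real.exp (-ε * |y.1|) : ℝ) : ℂ) *
          (((1 / (2 * π) : ℝ) : ℂ) * (g y.2.1 * conj (g y.2.2))))
        ((volume : Measure ℝ).prod (volume : Measure (ℝ × ℝ))) :=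
      (hs.ofReal (𝕜 := ℂ)).mul_prod (hg2.const_mul _)
    have i2 : AEStronglyMeasurable (fun y : ℝ × (ℝ × ℝ) =>
        Complex.exp (-I * y.1 * ((y.2.1 - y.2.2 : ℝ) : ℂ)))
        ((volume : Measure ℝ).prod (volume : Measure (ℝ × ℝ))) :=
      Continuous.aestronglyMeasurable (by fun_prop)
    refine i1.norm.mono' ((i1.aestronglyMeasurable.mul i2).congr
      (Filter.Eventually.of_forall fun y => ?_)) (Filter.Eventually.of_forall fun y => ?_)
    · simp only [Function.uncurry, Pi.mul_apply]
      ring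
    · simp only [Function.uncurry, norm_mul]
      rw [show -I * (y.1 : ℂ) * ((y.2.1 - y.2.2 : ℝ) : ℂ) =
        ((-(y.1 * (y.2.1 - y.2.2)) : ℝ) : ℂ) * I by push_cast; ring,
        Complex.norm_exp_ofReal_mul_I, mul_one]
      apply le_of_eq
      ring

lemma tendsto_integral_sign_mul_exp {F : ℝ → ℝ} (hF : Integrable F) :
    Filter.Tendsto (fun ε : ℝ => ∫ p : ℝ, Real.sign p * Real.exp (-ε * |p|) * F p)
      (nhdsWithin 0 (Set.Ioi 0)) (nhds (∫ p : ℝ, Real.sign p * F p)) := by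
  refine tendsto_integral_filter_of_dominated_convergence (fun p => ‖F p‖) ?_ ?_ hF.norm ?_
  · refine Filter.Eventually.of_forall fun ε => ?_
    exact ((measurable_realSign.mul (by fun_prop)).aestronglyMeasurable).mul hF.aestronglyMeasurable
  · filter_upwards [self_mem_nhdsWithin] with ε hε
    refine Filter.Eventually.of_forall fun p => ?_
    rw [norm_mul, norm_mul]
    have h1 : ‖Real.exp (-ε * |p|)‖ ≤ 1 := by
      rw [Real.norm_of_nonneg (Real.exp_pos _).le, Real.exp_le_one_iff]
      nlinarith [abs_nonneg p, Set.mem_Ioi.1 hε]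
    exact mul_le_of_le_one_left (norm_nonneg _)
      (mul_le_one₀ (abs_realSign_le_one p) (norm_nonneg _) h1)
  · refine Filter.Eventually.of_forall fun p => ?_
    have : Continuous fun ε : ℝ => Real.sign p * Real.exp (-ε * |p|) * F p := by fun_prop
    have := this.tendsto 0
    simp only [neg_zero, zero_mul, Real.exp_zero, mul_one] at this
    exact this.mono_left nhdsWithin_le_nhds

lemma tendsto_div_sq_add_sq (w : ℝ) :
    Filter.Tendsto (fun ε : ℝ => w / (w ^ 2 + ε ^ 2)) (nhdsWithin 0 (Set.Ioi 0))
      (nhds (1 / w)) := by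
  rcases eq_or_ne w 0 with rfl | hw
  · simp
  · have : Continuous fun ε : ℝ => w / (w ^ 2 + ε ^ 2) :=
      continuous_const.div (by fun_prop) fun ε => by positivity
    have := this.tendsto 0
    have e : w / (w ^ 2 + 0 ^ 2) = 1 / w := by field_simp; simp
    rw [e] at this
    exact this.mono_left nhdsWithin_le_nhds

lemma integral_sign_fourier_chirp_sub {g : ℝ → ℂ} {M N : ℝ} (hm : Measurable g)
    (hM : ∀ x, ‖g x‖ ≤ M) (hN : ∀ x, N < |x| → g x = 0) {α β : ℝ} (hαβ : β ≤ α)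
    (hα : Integrable fun p =>
      ‖fourierIntegralL1 (fun q => Complex.exp (I / 2 * α * q ^ 2) * g q) p‖ ^ 2)
    (hβ : Integrable fun p =>
      ‖fourierIntegralL1 (fun q => Complex.exp (I / 2 * β * q ^ 2) * g q) p‖ ^ 2) :
    (((∫ p, Real.sign p *
        ‖fourierIntegralL1 (fun q => Complex.exp (I / 2 * α * q ^ 2) * g q) p‖ ^ 2)
      - ∫ p, Real.sign p *
        ‖fourierIntegralL1 (fun q => Complex.exp (I / 2 * β * q ^ 2) * g q) p‖ ^ 2
        : ℝ) : ℂ) =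
    (2 / π) * ∫ z : ℝ × ℝ,
      ((Real.sin ((α - β) / 4 * (z.1 ^ 2 - z.2 ^ 2)) / (z.1 - z.2) : ℝ) : ℂ) *
      ((Complex.exp (I / 4 * (α + β) * z.1 ^ 2) * g z.1) *
        conj (Complex.exp (I / 4 * (α + β) * z.2 ^ 2) * g z.2)) := by
  have hexp : ∀ (γ q : ℝ) , ‖Complex.exp (I * γ * q ^ 2)‖ = 1 := fun γ q => by
    rw [show I * (γ:ℂ) * (q:ℂ) ^ 2 = ((γ * q ^ 2 : ℝ) : ℂ) * I by push_cast; ring,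
      Complex.norm_exp_ofReal_mul_I]
  have hchirp : ∀ γ : ℝ, Integrable fun q : ℝ => Complex.exp (I * γ * q ^ 2) * g q := fun γ =>
    integrable_of_bounded_support (M := M) (N := N) (by fun_prop)
      (fun x => by rw [norm_mul, hexp, one_mul]; exact hM x) (fun x hx => by simp [hN x hx])
  set a : ℝ := (α - β) / 4 with ha_def
  have ha : 0 ≤ a := by rw [ha_def]; linarith
  set φ : ℝ → ℂ := fun q => Complex.exp (I / 4 * (α + β) * q ^ 2) * g q with hφ
  have hφm : Measurable φ := by fun_prop
  have hφi : Integrable φ := by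
    have := hchirp ((α + β) / 4)
    refine this.congr (Filter.Eventually.of_forall fun q => ?_)
    simp only [hφ]
    push_cast
    ring_nf
  have hφN : ∀ x, N < |x| → φ x = 0 := fun x hx => by simp [hφ, hN x hx]
  have hhalf : ∀ γ : ℝ, Integrable fun q : ℝ => Complex.exp (I / 2 * γ * q ^ 2) * g q := fun γ => by
    refine (hchirp (γ / 2)).congr (Filter.Eventually.of_forall fun q => ?_)
    push_cast
    ring_nf
  set K : ℝ → ℝ × ℝ → ℝ := fun ε z => Real.sin (a * (z.1 ^ 2 - z.2 ^ 2)) *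
    ((z.1 - z.2) / ((z.1 - z.2) ^ 2 + ε ^ 2)) with hK
  have hKm : ∀ ε, Measurable (K ε) := fun ε => by fun_prop
  have hKb : ∀ ε, ∀ z : ℝ × ℝ, |K ε z| ≤ |Real.sin (a * (z.1 ^ 2 - z.2 ^ 2)) / (z.1 - z.2)| := by
    intro ε z
    rw [hK]
    simp only
    rw [abs_mul, abs_div (Real.sin _), div_eq_mul_inv |Real.sin _|]
    gcongr
    rcases eq_or_ne (z.1 - z.2) 0 with h | h
    · simp [h]
    · rw [abs_div, abs_of_nonneg (by positivity : 0 ≤ (z.1 - z.2) ^ 2 + ε ^ 2)]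
      rw [div_le_iff₀ (by positivity), ← div_eq_inv_mul, le_div_iff₀ (abs_pos.2 h),
        abs_mul_abs_self]
      nlinarith [sq_nonneg ε]
  have hpre : ∀ ε : ℝ, 0 < ε →
      (((∫ p, Real.sign p * Real.exp (-ε * |p|) *
        ‖fourierIntegralL1 (fun q => Complex.exp (I / 2 * α * q ^ 2) * g q) p‖ ^ 2)
      - ∫ p, Real.sign p * Real.exp (-ε * |p|) *
        ‖fourierIntegralL1 (fun q => Complex.exp (I / 2 * β * q ^ 2) * g q) p‖ ^ 2 : ℝ) : ℂ) =
      (2 / π) * ∫ z : ℝ × ℝ, ((K ε z : ℝ) : ℂ) * (φ z.1 * conj (φ z.2)) := by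
    intro ε hε
    have hb : ∀ γ : ℝ, Integrable fun z : ℝ × ℝ =>
        (-I / π * (((z.1 - z.2) / ((z.1 - z.2) ^ 2 + ε ^ 2) : ℝ) : ℂ)) *
        ((Complex.exp (I / 2 * γ * z.1 ^ 2) * g z.1) *
          conj (Complex.exp (I / 2 * γ * z.2 ^ 2) * g z.2)) := fun γ => by
      refine integrable_form_of_bounded_kernel (hhalf γ) (N := N) (C := 1 / π * (2 * N / ε ^ 2))
        (fun x hx => by simp [hN x hx]) (by fun_prop) fun z h1 h2 => ?_
      rw [norm_mul, norm_div, norm_neg, Complex.norm_I, Complex.norm_real, Complex.norm_real,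
        Real.norm_of_nonneg Real.pi_pos.le, norm_div,
        Real.norm_of_nonneg (by positivity : 0 ≤ (z.1 - z.2) ^ 2 + ε ^ 2)]
      have h3 : ‖z.1 - z.2‖ ≤ 2 * N := (norm_sub_le _ _).trans (by
        rw [Real.norm_eq_abs, Real.norm_eq_abs]; linarith)
      have h4 : 0 ≤ 2 * N := (norm_nonneg _).trans h3
      gcongr
      nlinarith [sq_nonneg (z.1 - z.2)]
    rw [Complex.ofReal_sub, integral_sign_mul_exp_mul_fourier (hhalf α) hε,
      integral_sign_mul_exp_mul_fourier (hhalf β) hε, ← integral_sub (hb α) (hb β),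
      ← integral_const_mul]
    refine integral_congr_ae (Filter.Eventually.of_forall fun z => ?_)
    simp only [hφ, hK, map_mul, ← Complex.exp_conj, Complex.conj_I, Complex.conj_ofReal, map_pow,
      map_div₀, map_ofNat, map_add]
    set w : ℂ := (((z.1 - z.2) / ((z.1 - z.2) ^ 2 + ε ^ 2) : ℝ) : ℂ)
    rw [Complex.ofReal_mul, Complex.ofReal_sin, Complex.sin]
    have eα : Complex.exp (I / 2 * α * z.1 ^ 2) * Complex.exp (-I / 2 * α * z.2 ^ 2) =
        Complex.exp (I / 4 * (α + β) * z.1 ^ 2) * Complex.exp (-I / 4 * (α + β) * z.2 ^ 2) *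
        Complex.exp (((a * (z.1 ^ 2 - z.2 ^ 2) : ℝ) : ℂ) * I) := by
      rw [← Complex.exp_add, ← Complex.exp_add, ← Complex.exp_add, ha_def]
      push_cast
      ring_nf
    have eβ : Complex.exp (I / 2 * β * z.1 ^ 2) * Complex.exp (-I / 2 * β * z.2 ^ 2) =
        Complex.exp (I / 4 * (α + β) * z.1 ^ 2) * Complex.exp (-I / 4 * (α + β) * z.2 ^ 2) *
        Complex.exp (-((a * (z.1 ^ 2 - z.2 ^ 2) : ℝ) : ℂ) * I) := by
      rw [← Complex.exp_add, ← Complex.exp_add, ← Complex.exp_add, ha_def]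
      push_cast
      ring_nf
    linear_combination (-I / π * w * g z.1 * conj (g z.2)) * (eα - eβ)
  have hL : Filter.Tendsto (fun ε : ℝ => (((∫ p, Real.sign p * Real.exp (-ε * |p|) *
        ‖fourierIntegralL1 (fun q => Complex.exp (I / 2 * α * q ^ 2) * g q) p‖ ^ 2)
      - ∫ p, Real.sign p * Real.exp (-ε * |p|) *
        ‖fourierIntegralL1 (fun q => Complex.exp (I / 2 * β * q ^ 2) * g q) p‖ ^ 2 : ℝ) : ℂ))
      (nhdsWithin 0 (Set.Ioi 0)) (nhds _) :=
    (Complex.continuous_ofReal.tendsto _).comp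
      ((tendsto_integral_sign_mul_exp hα).sub (tendsto_integral_sign_mul_exp hβ))
  have hR : Filter.Tendsto (fun ε : ℝ => (2 / π : ℂ) * ∫ z : ℝ × ℝ,
      ((K ε z : ℝ) : ℂ) * (φ z.1 * conj (φ z.2))) (nhdsWithin 0 (Set.Ioi 0))
      (nhds ((2 / π) * ∫ z : ℝ × ℝ,
        ((Real.sin (a * (z.1 ^ 2 - z.2 ^ 2)) / (z.1 - z.2) : ℝ) : ℂ) *
          (φ z.1 * conj (φ z.2)))) := by
    refine Filter.Tendsto.const_mul _ (tendsto_integral_filter_of_dominated_convergence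
      (fun z => ‖((Real.sin (a * (z.1 ^ 2 - z.2 ^ 2)) / (z.1 - z.2) : ℝ) : ℂ) *
          (φ z.1 * conj (φ z.2))‖) ?_ ?_ ?_ ?_)
    · refine Filter.Eventually.of_forall fun ε => ?_
      exact (Complex.measurable_ofReal.comp (hKm ε)).aestronglyMeasurable.mul
        (integrable_mul_conj hφi).aestronglyMeasurable
    · refine Filter.Eventually.of_forall fun ε => Filter.Eventually.of_forall fun z => ?_
      simp only [norm_mul, Complex.norm_real]
      gcongr
      exact hKb ε z
    · refine (integrable_form_of_bounded_kernel hφi hφN (C := a * (2 * N)) (by fun_prop)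
        fun z h1 h2 => ?_).norm
      rw [Complex.norm_real]
      exact abs_sin_sq_sub_div_sub_le ha h1 h2
    · refine Filter.Eventually.of_forall fun z => ?_
      refine Filter.Tendsto.mul_const _ ((Complex.continuous_ofReal.tendsto _).comp ?_)
      rw [div_eq_mul_one_div]
      exact (tendsto_div_sq_add_sq _).const_mul _
  refine tendsto_nhds_unique hL (hR.congr' ?_)
  filter_upwards [self_mem_nhdsWithin] with ε hε
  exact (hpre ε hε).symm

lemma L2.norm_eq_of_ae {u v : L2} {g : ℝ → ℂ} (hg : ∀ᵐ q, ‖g q‖ = 1)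
    (h : (u : ℝ → ℂ) =ᵐ[volume] fun q => g q * v q) : ‖u‖ = ‖v‖ := by
  rw [Lp.norm_def, Lp.norm_def]
  congr 1
  refine eLpNorm_congr_norm_ae ?_
  filter_upwards [hg, h] with q h1 h2
  rw [h2, norm_mul, h1, one_mul]

lemma L2.norm_sq_eq_integral {ψ : L2} {g : ℝ → ℂ} (h : (ψ : ℝ → ℂ) =ᵐ[volume] g) :
    ‖ψ‖ ^ 2 = ∫ q, ‖g q‖ ^ 2 := by
  have e : ((‖ψ‖ ^ 2 : ℝ) : ℂ) = ((∫ q, ‖g q‖ ^ 2 : ℝ) : ℂ) := by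
    have := inner_self_eq_norm_sq_to_K (𝕜 := ℂ) ψ
    rw [L2.inner_def] at this
    rw [Complex.ofReal_pow]
    refine this.symm.trans ?_
    rw [← integral_complex_ofReal]
    refine integral_congr_ae ?_
    filter_upwards [h] with q hq
    rw [hq, inner_self_eq_norm_sq_to_K]
    norm_cast
  exact_mod_cast e

lemma ae_norm_realSign_eq_one : ∀ᵐ q : ℝ, ‖((Real.sign q : ℝ) : ℂ)‖ = 1 := by
  filter_upwards [Measure.ae_ne volume (0:ℝ)] with q hq
  rcases lt_or_gt_of_ne hq with h | h
  · simp [Real.sign_of_neg h]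
  · simp [Real.sign_of_pos h]

lemma IsMulOp.norm_apply {g : ℝ → ℂ} {T : L2 →L[ℂ] L2} (hT : IsMulOp g T)
    (hg : ∀ᵐ q, ‖g q‖ = 1) (ψ : L2) : ‖T ψ‖ = ‖ψ‖ :=
  L2.norm_eq_of_ae hg (hT ψ)

lemma IsMulOp.apply_apply {g g' : ℝ → ℂ} {T T' : L2 →L[ℂ] L2} (hT : IsMulOp g T)
    (hT' : IsMulOp g' T') (hg : ∀ q, g q * g' q = 1) (ψ : L2) : T (T' ψ) = ψ := by
  refine Lp.ext ?_
  filter_upwards [hT (T' ψ), hT' ψ] with q h1 h2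
  rw [h1, h2, ← mul_assoc, hg, one_mul]

lemma IsMulOp.inner_apply {g g' : ℝ → ℂ} {T T' : L2 →L[ℂ] L2} (hT : IsMulOp g T)
    (hT' : IsMulOp g' T') (hg : ∀ q, conj (g' q) = g q) (ψ φ : L2) :
    ⟪ψ, T φ⟫_ℂ = ⟪T' ψ, φ⟫_ℂ := by
  rw [L2.inner_def, L2.inner_def]
  refine integral_congr_ae ?_
  filter_upwards [hT φ, hT' ψ] with q h1 h2
  rw [h1, h2]
  simp only [RCLike.inner_apply, map_mul, hg]
  ring

lemma IsSgnP.norm_apply {P : L2 →L[ℂ] L2} (hP : IsSgnP P) (ψ : L2) : ‖P ψ‖ = ‖ψ‖ := by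
  obtain ⟨F, -, h⟩ := hP
  rw [← F.norm_map (P ψ), ← F.norm_map ψ]
  exact L2.norm_eq_of_ae ae_norm_realSign_eq_one (h ψ)

lemma IsSgnP.apply_apply {P : L2 →L[ℂ] L2} (hP : IsSgnP P) (ψ : L2) : P (P ψ) = ψ := by
  obtain ⟨F, -, h⟩ := hP
  refine F.injective (Lp.ext ?_)
  filter_upwards [h (P ψ), h ψ, Measure.ae_ne volume (0:ℝ)] with q h1 h2 hq
  rw [h1, h2, ← mul_assoc, ← Complex.ofReal_mul]
  rcases lt_or_gt_of_ne hq with h | h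
  · simp [Real.sign_of_neg h]
  · simp [Real.sign_of_pos h]

lemma IsSgnP.inner_apply_self {P : L2 →L[ℂ] L2} (hP : IsSgnP P) {ψ : L2} {g : ℝ → ℂ}
    (hg : Integrable g) (hψ : (ψ : ℝ → ℂ) =ᵐ[volume] g) :
    Integrable (fun p => ‖fourierIntegralL1 g p‖ ^ 2) ∧
      ⟪ψ, P ψ⟫_ℂ = ((∫ p, Real.sign p * ‖fourierIntegralL1 g p‖ ^ 2 : ℝ) : ℂ) := by
  obtain ⟨F, hF, h⟩ := hP
  have hFψ : (F ψ : ℝ → ℂ) =ᵐ[volume] fourierIntegralL1 g := by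
    refine (hF ψ (hg.congr hψ.symm)).trans (Filter.Eventually.of_forall fun p => ?_)
    simp only [fourierIntegralL1]
    congr 1
    refine integral_congr_ae ?_
    filter_upwards [hψ] with q hq
    rw [hq]
  constructor
  · refine ((Lp.memLp (F ψ)).integrable_norm_pow two_ne_zero).congr ?_
    filter_upwards [hFψ] with p hp
    rw [hp]
  · rw [← F.inner_map_map, L2.inner_def, ← integral_complex_ofReal]
    refine integral_congr_ae ?_
    filter_upwards [h ψ, hFψ] with p h1 h2
    rw [h1, h2, RCLike.inner_apply, mul_assoc, Complex.mul_conj']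
    push_cast
    ring

lemma inv_chi (t q : ℝ) :
    (chi t q)⁻¹ = Complex.exp (I / 2 * ((Real.cos t / Real.sin t : ℝ) : ℂ) * (q : ℂ) ^ 2) := by
  rw [chi, ← Complex.exp_neg]
  ring_nf

lemma conj_inv_chi (t q : ℝ) : conj (chi t q)⁻¹ = chi t q := by
  rw [Complex.inv_eq_conj (norm_chi t q), Complex.conj_conj]

lemma IsSgnQ.isometry_involution_form {t : ℝ} {T : L2 →L[ℂ] L2} (hT : IsSgnQ t T)
    (ht : Real.sin t ≠ 0) :
    (∀ ψ, ‖T ψ‖ = ‖ψ‖) ∧ (∀ ψ, T (T ψ) = ψ) ∧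
    ∀ (ψ : L2) (g : ℝ → ℂ), Integrable g → (ψ : ℝ → ℂ) =ᵐ[volume] g →
      Integrable (fun p => ‖fourierIntegralL1 (fun q =>
        Complex.exp (I / 2 * ((Real.cos t / Real.sin t : ℝ) : ℂ) * (q : ℂ) ^ 2) * g q) p‖ ^ 2) ∧
      ⟪ψ, T ψ⟫_ℂ = ((Real.sign (Real.sin t) * ∫ p, Real.sign p * ‖fourierIntegralL1 (fun q =>
        Complex.exp (I / 2 * ((Real.cos t / Real.sin t : ℝ) : ℂ) * (q : ℂ) ^ 2) * g q) p‖ ^ 2 : ℝ) :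
          ℂ) := by
  have ht0 : t ≠ 0 := fun h => ht (by rw [h, Real.sin_zero])
  rw [IsSgnQ, if_neg ht0] at hT
  obtain ⟨P, Mc, Mci, hP, hc, hci, rfl⟩ := hT
  set σ : ℂ := ((Real.sign (Real.sin t) : ℝ) : ℂ) with hσ
  have hσ1 : ‖σ‖ = 1 ∧ σ * σ = 1 := by
    rcases lt_or_gt_of_ne ht with h | h
    · simp [hσ, Real.sign_of_neg h]
    · simp [hσ, Real.sign_of_pos h]
  have hap : ∀ ψ, (σ • (Mc ∘L P ∘L Mci)) ψ = σ • Mc (P (Mci ψ)) := fun ψ => rfl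
  have hχ0 : ∀ q, chi t q ≠ 0 := fun q => Complex.exp_ne_zero _
  refine ⟨fun ψ => ?_, fun ψ => ?_, fun ψ g hg hψ => ?_⟩
  · rw [hap, norm_smul, hσ1.1, one_mul, hc.norm_apply (Filter.Eventually.of_forall (norm_chi t)),
      hP.norm_apply, hci.norm_apply (Filter.Eventually.of_forall fun q => by
        rw [norm_inv, norm_chi, inv_one])]
  · rw [hap, hap, map_smul, map_smul, map_smul, smul_smul, hσ1.2, one_smul,
      hci.apply_apply hc (fun q => inv_mul_cancel₀ (hχ0 q)), hP.apply_apply,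
      hc.apply_apply hci (fun q => mul_inv_cancel₀ (hχ0 q))]
  · have hg' : Integrable fun q : ℝ =>
        Complex.exp (I / 2 * ((Real.cos t / Real.sin t : ℝ) : ℂ) * (q : ℂ) ^ 2) * g q := by
      refine hg.norm.mono' ((Continuous.aestronglyMeasurable (by fun_prop)).mul
        hg.aestronglyMeasurable) (Filter.Eventually.of_forall fun q => ?_)
      rw [norm_mul, ← inv_chi, norm_inv, norm_chi, inv_one, one_mul]
    have hψ' : (Mci ψ : ℝ → ℂ) =ᵐ[volume] fun q : ℝ =>
        Complex.exp (I / 2 * ((Real.cos t / Real.sin t : ℝ) : ℂ) * (q : ℂ) ^ 2) * g q := by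
      filter_upwards [hci ψ, hψ] with q h1 h2
      rw [h1, h2, inv_chi]
    obtain ⟨hi, hin⟩ := hP.inner_apply_self hg' hψ'
    refine ⟨hi, ?_⟩
    rw [hap, inner_smul_right, hc.inner_apply hci (conj_inv_chi t), hin, Complex.ofReal_mul]

lemma L2.dense_continuous_hasCompactSupport :
    Dense {ψ : L2 | ∃ f : ℝ → ℂ, Continuous f ∧ HasCompactSupport f ∧
      (ψ : ℝ → ℂ) =ᵐ[volume] f} := by
  intro ψ
  rw [EMetric.mem_closure_iff]
  intro ε hε
  obtain ⟨f, hfs, hle, hfc, hfm⟩ := (Lp.memLp ψ).exists_hasCompactSupport_eLpNorm_sub_le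
    (by simp) (ENNReal.half_pos hε.ne').ne'
  rcases eq_or_ne ε ⊤ with rfl | hε'
  · exact ⟨hfm.toLp f, ⟨f, hfc, hfs, hfm.coeFn_toLp⟩, edist_lt_top _ _⟩
  refine ⟨hfm.toLp f, ⟨f, hfc, hfs, hfm.coeFn_toLp⟩, ?_⟩
  rw [Lp.edist_def]
  refine lt_of_le_of_lt ?_ (ENNReal.half_lt_self hε.ne' hε')
  refine le_trans (le_of_eq (eLpNorm_congr_ae ?_)) hle
  filter_upwards [hfm.coeFn_toLp] with q hq
  simp [hq]

lemma exists_re_inner_eq_sin_form {s t : ℝ} {As At : L2 →L[ℂ] L2} (hAs : IsSgnQ s As)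
    (hAt : IsSgnQ t At) (hs : 0 < Real.sin s) (ht : Real.sin t < 0)
    (hst : Real.cos s / Real.sin s ≤ Real.cos t / Real.sin t) {ψ : L2} {g : ℝ → ℂ} {M N : ℝ}
    (hm : Measurable g) (hM : ∀ x, ‖g x‖ ≤ M) (hN : ∀ x, N < |x| → g x = 0)
    (hψ : (ψ : ℝ → ℂ) =ᵐ[volume] g) :
    ∃ (φ : ℝ → ℂ) (a : ℝ), Measurable φ ∧ (∀ x, ‖φ x‖ = ‖g x‖) ∧ 0 ≤ a ∧
      (⟪ψ, As ψ + At ψ⟫_ℂ).re = -(2 / π * (∫ z : ℝ × ℝ,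
        ((Real.sin (a * (z.1 ^ 2 - z.2 ^ 2)) / (z.1 - z.2) : ℝ) : ℂ)
          * (φ z.1 * conj (φ z.2))).re) := by
  have hg := integrable_of_bounded_support hm hM hN
  obtain ⟨is, es⟩ := (hAs.isometry_involution_form hs.ne').2.2 ψ g hg hψ
  obtain ⟨it, et⟩ := (hAt.isometry_involution_form ht.ne).2.2 ψ g hg hψ
  set α := Real.cos t / Real.sin t
  set β := Real.cos s / Real.sin s
  refine ⟨fun q => Complex.exp (I / 4 * (α + β) * q ^ 2) * g q, (α - β) / 4, by fun_prop,
    fun x => ?_, by linarith, ?_⟩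
  · rw [norm_mul, show I / 4 * ((α : ℂ) + β) * (x : ℂ) ^ 2 =
      (((α + β) / 4 * x ^ 2 : ℝ) : ℂ) * I by push_cast; ring,
      Complex.norm_exp_ofReal_mul_I, one_mul]
  · have key := congrArg Complex.re (integral_sign_fourier_chirp_sub hm hM hN hst it is)
    rw [Complex.ofReal_re, show (2 / π : ℂ) = ((2 / π : ℝ) : ℂ) by push_cast; rfl,
      Complex.re_ofReal_mul] at key
    rw [inner_add_right, Complex.add_re, es, et, Complex.ofReal_re, Complex.ofReal_re,
      Real.sign_of_pos hs, Real.sign_of_neg ht, ← key]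
    ring

lemma re_inner_sgnQ_add_le {s t : ℝ} {As At : L2 →L[ℂ] L2} (hAs : IsSgnQ s As)
    (hAt : IsSgnQ t At) (hs : 0 < Real.sin s) (ht : Real.sin t < 0)
    (hst : Real.cos s / Real.sin s ≤ Real.cos t / Real.sin t) {ψ : L2} {g : ℝ → ℂ} {M N : ℝ}
    (hm : Measurable g) (hM : ∀ x, ‖g x‖ ≤ M) (hN : ∀ x, N < |x| → g x = 0)
    (hpos : ∀ x ≤ 0, g x = 0) (hψ : (ψ : ℝ → ℂ) =ᵐ[volume] g) :
    (⟪ψ, As ψ + At ψ⟫_ℂ).re ≤ 4 / π * ‖ψ‖ ^ 2 := by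
  obtain ⟨φ, a, hφm, hφ, ha, e⟩ := exists_re_inner_eq_sin_form hAs hAt hs ht hst hm hM hN hψ
  have h0 : ∀ x, g x = 0 → φ x = 0 := fun x hx => by rw [← norm_eq_zero, hφ, hx, norm_zero]
  have := sin_form_re_ge hφm (fun x => (hφ x).trans_le (hM x)) (fun x hx => h0 x (hN x hx))
    (fun x hx => h0 x (hpos x hx)) ha
  rw [e, L2.norm_sq_eq_integral hψ]
  simp only [hφ] at this
  have hπ : 0 < 2 / π := by positivity
  calc _ ≤ 2 / π * (2 * ∫ x, ‖g x‖ ^ 2) := by nlinarith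
    _ = _ := by ring

lemma le_re_inner_sgnQ_add {s t : ℝ} {As At : L2 →L[ℂ] L2} (hAs : IsSgnQ s As)
    (hAt : IsSgnQ t At) (hs : 0 < Real.sin s) (ht : Real.sin t < 0)
    (hst : Real.cos s / Real.sin s ≤ Real.cos t / Real.sin t) {ψ : L2} {g : ℝ → ℂ} {M N : ℝ}
    (hm : Measurable g) (hM : ∀ x, ‖g x‖ ≤ M) (hN : ∀ x, N < |x| → g x = 0)
    (hneg : ∀ x, 0 ≤ x → g x = 0) (hψ : (ψ : ℝ → ℂ) =ᵐ[volume] g) :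
    -(4 / π * ‖ψ‖ ^ 2) ≤ (⟪ψ, As ψ + At ψ⟫_ℂ).re := by
  obtain ⟨φ, a, hφm, hφ, ha, e⟩ := exists_re_inner_eq_sin_form hAs hAt hs ht hst hm hM hN hψ
  have h0 : ∀ x, g x = 0 → φ x = 0 := fun x hx => by rw [← norm_eq_zero, hφ, hx, norm_zero]
  have := sin_form_re_le hφm (fun x => (hφ x).trans_le (hM x)) (fun x hx => h0 x (hN x hx))
    (fun x hx => h0 x (hneg x hx)) ha
  rw [e, L2.norm_sq_eq_integral hψ]
  simp only [hφ] at this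
  have hπ : 0 < 2 / π := by positivity
  refine neg_le_neg ?_
  calc _ ≤ 2 / π * (2 * ∫ x, ‖g x‖ ^ 2) := by gcongr
    _ = _ := by ring

lemma exists_bound_of_hasCompactSupport {f : ℝ → ℂ} (hf : Continuous f)
    (hs : HasCompactSupport f) (S : Set ℝ) :
    ∃ M N : ℝ, (∀ x, ‖S.indicator (fun q => 2 * f q) x‖ ≤ M) ∧
      ∀ x, N < |x| → S.indicator (fun q => 2 * f q) x = 0 := by
  obtain ⟨C, hC⟩ := hs.exists_bound_of_continuous hf
  obtain ⟨N, hN⟩ := hs.isCompact.isBounded.exists_norm_le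
  refine ⟨2 * C, N, fun x => ?_, fun x hx => ?_⟩
  · refine (norm_indicator_le_norm_self _ _).trans ?_
    rw [norm_mul, Complex.norm_ofNat]
    gcongr
    exact hC x
  · have : f x = 0 := image_eq_zero_of_notMem_tsupport fun h => hx.not_ge (hN x h)
    simp [Set.indicator, this]

/-- If `s < π < t < s + π` (so `sin s ≠ 0`, `sin t ≠ 0`, `sin(t−s) ≠ 0`),
then `‖sgn Q(0) + sgn Q(s) + sgn Q(t)‖ < 3`. -/
theorem opNorm_sgnQ_sum_lt_three_general (s t : ℝ)
    (hs : s < π) (hst : π < t) (hts : t < s + π)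
    (A0 As At : L2 →L[ℂ] L2)
    (h0 : IsSgnQ 0 A0) (hAs : IsSgnQ s As) (hAt : IsSgnQ t At) :
    ‖A0 + As + At‖ < 3 := by
  have hsin_s : 0 < Real.sin s := Real.sin_pos_of_pos_of_lt_pi (by linarith) hs
  have hsin_t : Real.sin t < 0 := by
    have := Real.sin_pos_of_pos_of_lt_pi (x := t - π) (by linarith) (by linarith)
    rw [Real.sin_sub_pi] at this
    linarith
  have hcot : Real.cos s / Real.sin s ≤ Real.cos t / Real.sin t := by
    have h1 := Real.sin_pos_of_pos_of_lt_pi (x := t - s) (by linarith) (by linarith)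
    rw [Real.sin_sub] at h1
    rw [← neg_div_neg_eq (Real.cos t), div_le_div_iff₀ hsin_s (by linarith)]
    linarith
  rw [IsSgnQ, if_pos rfl] at h0
  obtain ⟨hs1, hs2, -⟩ := hAs.isometry_involution_form hsin_s.ne'
  obtain ⟨ht1, ht2, -⟩ := hAt.isometry_involution_form hsin_t.ne
  refine norm_involution_sum_lt_three A0 As At (h0.norm_apply ae_norm_realSign_eq_one) hs1 ht1
    hs2 ht2 (γ := 4 / π) ?_ ?_ ?_
  · rw [div_lt_iff₀ Real.pi_pos]
    linarith [Real.pi_gt_three]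
  · intro ψ
    have hcl : IsClosed {ψ : L2 | (⟪ψ + A0 ψ, As (ψ + A0 ψ) + At (ψ + A0 ψ)⟫_ℂ).re ≤
        4 / π * ‖ψ + A0 ψ‖ ^ 2} :=
      isClosed_le (Complex.continuous_re.comp (Continuous.inner (by fun_prop) (by fun_prop)))
        (by fun_prop)
    refine hcl.closure_subset_iff.2 ?_ (L2.dense_continuous_hasCompactSupport ψ)
    rintro ψ ⟨f, hfc, hfs, hψ⟩
    obtain ⟨M, N, hM, hN⟩ := exists_bound_of_hasCompactSupport hfc hfs (Set.Ioi 0)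
    refine re_inner_sgnQ_add_le hAs hAt hsin_s hsin_t hcot
      ((measurable_const.mul hfc.measurable).indicator measurableSet_Ioi) hM hN
      (fun x hx => Set.indicator_of_notMem (by simpa using hx) _) ?_
    filter_upwards [Lp.coeFn_add ψ (A0 ψ), h0 ψ, hψ, Measure.ae_ne volume (0:ℝ)] with q h1 h2 h3 hq
    rw [h1, Pi.add_apply, h2, h3]
    rcases lt_or_gt_of_ne hq with h | h
    · simp [Real.sign_of_neg h, h.le]
    · simp [Real.sign_of_pos h, h, two_mul]
  · intro ψ
    have hcl : IsClosed {ψ : L2 | -(4 / π * ‖ψ - A0 ψ‖ ^ 2) ≤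
        (⟪ψ - A0 ψ, As (ψ - A0 ψ) + At (ψ - A0 ψ)⟫_ℂ).re} :=
      isClosed_le (by fun_prop)
        (Complex.continuous_re.comp (Continuous.inner (by fun_prop) (by fun_prop)))
    refine hcl.closure_subset_iff.2 ?_ (L2.dense_continuous_hasCompactSupport ψ)
    rintro ψ ⟨f, hfc, hfs, hψ⟩
    obtain ⟨M, N, hM, hN⟩ := exists_bound_of_hasCompactSupport hfc hfs (Set.Iio 0)
    refine le_re_inner_sgnQ_add hAs hAt hsin_s hsin_t hcot
      ((measurable_const.mul hfc.measurable).indicator measurableSet_Iio) hM hN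
      (fun x hx => Set.indicator_of_notMem (by simpa using hx) _) ?_
    filter_upwards [Lp.coeFn_sub ψ (A0 ψ), h0 ψ, hψ, Measure.ae_ne volume (0:ℝ)] with q h1 h2 h3 hq
    rw [h1, Pi.sub_apply, h2, h3]
    rcases lt_or_gt_of_ne hq with h | h
    · simp [Real.sign_of_neg h, h, two_mul]
    · simp [Real.sign_of_pos h, h.le]
end
end
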